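/- arXiv:2411.09060 — 3 statements merged into one kernel-verified Lean document; each statement's English description precedes it below -/
import Mathlib

section
/- There exists a positive integer n₀ such that for all integers n ≥ n₀ and b ≥ 2, every prime p ≥ 7, and every positive integer a satisfying n! = (b^p − 1)/(b − 1) + a, one has a ≥ 0.5·(log log n)/(log log log n). -/
open Finset in
theorem Nat.Prime.eq_or_modEq_one_of_dvd_geom_sum {p q b : ℕ} (hp : p.Prime) (hq : q.Prime)
    (h : q ∣ ∑ i ∈ range p, b ^ i) : q = p ∨ q ≡ 1 [MOD p] := by
  have := Fact.mk hp
  have := Fact.mk hq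
  have hS : ∑ i ∈ range p, (b : ZMod q) ^ i = 0 := by
    exact_mod_cast (ZMod.natCast_eq_zero_iff _ q).2 h
  have hb : (b : ZMod q) ^ p = 1 := by
    have := geom_sum_mul (b : ZMod q) p
    rw [hS, zero_mul] at this
    exact (sub_eq_zero.1 this.symm)
  by_cases h1 : (b : ZMod q) = 1
  · left
    simp only [h1, one_pow, sum_const, card_range, nsmul_eq_mul, mul_one] at hS
    exact (Nat.prime_dvd_prime_iff_eq hq hp).1 ((ZMod.natCast_eq_zero_iff _ _).1 hS)
  · right
    have hb0 : (b : ZMod q) ≠ 0 := by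
      intro h0
      rw [h0, zero_pow hp.ne_zero] at hb
      exact zero_ne_one hb
    have hdvd := ZMod.orderOf_dvd_card_sub_one hb0
    rw [orderOf_eq_prime hb h1] at hdvd
    exact ((Nat.modEq_iff_dvd' hq.one_le).2 hdvd).symm

open Finset in
/-- Divisors of a repunit of prime length `p` that are coprime to `p` are `1` modulo `p`. -/
theorem Nat.Prime.modEq_one_of_dvd_geom_sum {p b d : ℕ} (hp : p.Prime)
    (hd : d ∣ ∑ i ∈ range p, b ^ i) (hpd : ¬ p ∣ d) : d ≡ 1 [MOD p] := by
  induction d using Nat.recOnMul with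
  | zero => simp at hpd
  | one => rfl
  | prime q hq =>
    rcases hp.eq_or_modEq_one_of_dvd_geom_sum hq hd with rfl | h
    · simp at hpd
    · exact h
  | mul x y hx hy =>
    simpa using (hx (dvd_of_mul_right_dvd hd) fun h => hpd (h.mul_right y)).mul
      (hy (dvd_of_mul_left_dvd hd) fun h => hpd (h.mul_left x))

open Finset in
theorem Nat.Prime.not_sq_dvd_geom_sum {p b : ℕ} (hp : p.Prime) (hp2 : p ≠ 2) :
    ¬ p ^ 2 ∣ ∑ i ∈ range p, b ^ i := by
  intro h
  have := Fact.mk hp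
  have hS : ∑ i ∈ range p, (b : ZMod p) ^ i = 0 := by
    exact_mod_cast (ZMod.natCast_eq_zero_iff _ p).2 ((dvd_pow_self p two_ne_zero).trans h)
  have hb : (b : ZMod p) = 1 := by
    have := geom_sum_mul (b : ZMod p) p
    rw [hS, zero_mul, ZMod.pow_card] at this
    exact (sub_eq_zero.1 this.symm)
  obtain ⟨t, ht⟩ : (p : ℤ) ∣ b - 1 := by
    rw [← ZMod.intCast_zmod_eq_zero_iff_dvd]
    simp [hb]
  have key := odd_sq_dvd_geom_sum₂_sub (R := ℤ) (a := 1) t (hp.odd_of_ne_two hp2)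
  rw [show (1 + p * t : ℤ) = b by linarith] at key
  simp only [one_pow, mul_one] at key
  have h' : (p : ℤ) ^ 2 ∣ ∑ i ∈ range p, (b : ℤ) ^ i := by exact_mod_cast h
  have hdvd : (p : ℤ) ^ 2 ∣ p := by simpa using _root_.dvd_sub h' key
  have := Nat.le_of_dvd hp.pos (by exact_mod_cast hdvd : p ^ 2 ∣ p)
  nlinarith [hp.two_le]

open Finset in
/-- If `n!` exceeds a repunit of odd prime length by `a > 0`, then `a` is at least `n / 2`. -/
theorem Nat.le_two_mul_of_factorial_eq_geom_sum_add {n b p a : ℕ} (hn : 3 ≤ n) (hb : 2 ≤ b)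
    (hp : p.Prime) (hp2 : p ≠ 2) (ha : 0 < a)
    (h : n.factorial = (∑ i ∈ range p, b ^ i) + a) : n ≤ 2 * a := by
  by_contra! hlt
  have han : a ∣ n.factorial := Nat.dvd_factorial ha (by lia)
  have haS : a ∣ ∑ i ∈ range p, b ^ i := by
    rw [h] at han
    exact (Nat.dvd_add_left dvd_rfl).1 han
  rcases le_or_gt p n with hpn | hpn
  · have hpf : p ∣ n.factorial := Nat.dvd_factorial hp.pos hpn
    by_cases hpa : p ∣ a
    · obtain ⟨c, hc⟩ := haS
      have hpc : ¬ p ∣ c := fun hpc => hp.not_sq_dvd_geom_sum (b := b) hp2 <| by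
        rw [hc, sq]
        exact mul_dvd_mul hpa hpc
      have hc1 : c ≡ 1 [MOD p] := hp.modEq_one_of_dvd_geom_sum (hc ▸ dvd_mul_left c a) hpc
      have hpa2 : ¬ p ^ 2 ∣ a := fun h2 => hp.not_sq_dvd_geom_sum (b := b) hp2 <| by
        rw [hc]
        exact h2.mul_right c
      have hsq : p ^ 2 ∣ n.factorial := by
        have hle := Nat.le_of_dvd ha hpa
        have h1 : p ^ 2 ∣ p.factorial * p.factorial := by
          rw [sq]
          exact mul_dvd_mul (Nat.dvd_factorial hp.pos le_rfl) (Nat.dvd_factorial hp.pos le_rfl)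
        exact (h1.trans (Nat.factorial_mul_factorial_dvd_factorial_add p p)).trans
          (Nat.factorial_dvd_factorial (by lia))
      obtain ⟨a', rfl⟩ := hpa
      rw [h, hc, sq, show p * a' * c + p * a' = p * (a' * (c + 1)) by ring] at hsq
      rcases hp.dvd_mul.1 (Nat.dvd_of_mul_dvd_mul_left hp.pos hsq) with h1 | h1
      · exact hpa2 (by rw [sq]; exact mul_dvd_mul_left p h1)
      · have h2 : 1 + 1 ≡ 0 [MOD p] :=
          (hc1.add_right 1).symm.trans (Nat.modEq_zero_iff_dvd.2 h1)
        exact hp2 ((Nat.prime_dvd_prime_iff_eq hp Nat.prime_two).1 (Nat.modEq_zero_iff_dvd.1 h2))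
    · have ha1 := hp.modEq_one_of_dvd_geom_sum haS hpa
      by_cases hpS : p ∣ ∑ i ∈ range p, b ^ i
      · rw [h] at hpf
        exact hpa ((Nat.dvd_add_right hpS).1 hpf)
      · have h2 := (hp.modEq_one_of_dvd_geom_sum dvd_rfl hpS).add ha1
        rw [← h] at h2
        have h3 := h2.symm.trans (Nat.modEq_zero_iff_dvd.2 hpf)
        exact hp2 ((Nat.prime_dvd_prime_iff_eq hp Nat.prime_two).1 (Nat.modEq_zero_iff_dvd.1 h3))
  · have hpa : ¬ p ∣ a := fun hpa => by
      have := Nat.le_of_dvd ha hpa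
      lia
    have ha1 : a = 1 :=
      (hp.modEq_one_of_dvd_geom_sum haS hpa).eq_of_lt_of_lt (by lia) hp.one_lt
    subst ha1
    have hbn : b ≤ n := by
      by_contra! hbn
      have h1 : b ^ n ≤ ∑ i ∈ range p, b ^ i :=
        single_le_sum (f := fun i => b ^ i) (fun _ _ => Nat.zero_le _) (mem_range.2 hpn)
      have h2 := Nat.factorial_le_pow n
      have h3 := Nat.pow_le_pow_left hbn.le n
      lia
    have hbf : b ∣ n.factorial := Nat.dvd_factorial (by lia) hbn
    obtain ⟨k, rfl⟩ : ∃ k, p = k + 1 := ⟨p - 1, by have := hp.pos; lia⟩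
    have hb2 : b ∣ 2 := by
      rw [h, geom_sum_succ, add_assoc] at hbf
      exact (Nat.dvd_add_right (dvd_mul_right _ _)).1 hbf
    obtain rfl : b = 2 := le_antisymm (Nat.le_of_dvd two_pos hb2) hb
    have h2 : n.factorial = 2 ^ (k + 1) := by
      have := Nat.geomSum_eq (m := 2) le_rfl (k + 1)
      have hpos := Nat.one_le_two_pow (n := k + 1)
      simp only [Nat.reduceSub, Nat.div_one] at this
      lia
    have h3 : 3 ∣ 2 ^ (k + 1) := h2 ▸ Nat.dvd_factorial (by norm_num) hn
    have := Nat.prime_three.dvd_of_dvd_pow h3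
    lia

/-- **Theorem 1.** There exists a positive integer `n₀` such that for all integers
`n ≥ n₀` and `b ≥ 2`, every prime `p ≥ 7`, and every positive integer `a` satisfying
`n! = (b^p − 1)/(b − 1) + a`, one has `a ≥ 0.5 · (log log n)/(log log log n)`. -/
theorem factorial_repunit_distance_lower_bound :
    ∃ n₀ : ℕ, 0 < n₀ ∧ ∀ (n : ℕ) (b : ℤ) (p : ℕ) (a : ℤ),
      n₀ ≤ n → 2 ≤ b → Nat.Prime p → 7 ≤ p → 0 < a →
      (Nat.factorial n : ℤ) = (∑ i ∈ Finset.range p, b ^ i) + a →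
      0.5 * Real.log (Real.log n) / Real.log (Real.log (Real.log n)) ≤ (a : ℝ) := by
  have hlog := Real.tendsto_log_atTop
  obtain ⟨N, hN⟩ := Filter.eventually_atTop.1 <|
    (((hlog.comp (hlog.comp hlog)).comp tendsto_natCast_atTop_atTop).eventually_ge_atTop 1).and
    ((((hlog.comp hlog).comp tendsto_natCast_atTop_atTop).eventually_ge_atTop 1).and
    ((hlog.comp (tendsto_natCast_atTop_atTop (R := ℝ))).eventually_ge_atTop 1))
  refine ⟨max N 3, by positivity, fun n b p a hn hb hp hp7 ha h => ?_⟩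
  obtain ⟨h3, h2, h1⟩ := hN n (le_of_max_le_left hn)
  simp only [Function.comp_apply] at h1 h2 h3
  lift b to ℕ using by lia
  lift a to ℕ using ha.le
  have hna : n ≤ 2 * a := Nat.le_two_mul_of_factorial_eq_geom_sum_add (le_of_max_le_right hn)
    (by exact_mod_cast hb) hp (by lia) (by exact_mod_cast ha) (by exact_mod_cast h)
  have hna' : (n : ℝ) ≤ 2 * a := by exact_mod_cast hna
  have hle1 : Real.log n ≤ n := Real.log_le_self n.cast_nonneg
  have hle2 : Real.log (Real.log n) ≤ Real.log n := Real.log_le_self (by linarith)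
  calc 0.5 * Real.log (Real.log n) / Real.log (Real.log (Real.log n))
      ≤ 0.5 * Real.log (Real.log n) := div_le_self (by linarith) h3
    _ ≤ a := by linarith
    _ = ((a : ℤ) : ℝ) := by norm_cast
end

section
/- Let b ≥ 2 and n ≥ 2 be integers, let a be an integer with |a| ≤ n, and let p ≥ 7 be prime. If n! = (b^p − 1)/(b − 1) + a, then p divides a or |a| ≡ 1 (mod p). -/
/-- A prime divisor of a repunit of prime length `p` is `p` itself or is `1` modulo `p`. -/
theorem prime_eq_or_modeq_one_of_dvd_geom_sum {b : ℤ} {p q : ℕ} (hp : p.Prime) (hq : q.Prime)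
    (h : (q : ℤ) ∣ ∑ i ∈ Finset.range p, b ^ i) : q = p ∨ q ≡ 1 [MOD p] := by
  have := Fact.mk hp
  have := Fact.mk hq
  have hsum : ∑ i ∈ Finset.range p, (b : ZMod q) ^ i = 0 := by
    exact_mod_cast (ZMod.intCast_zmod_eq_zero_iff_dvd _ q).2 h
  have hpow : (b : ZMod q) ^ p = 1 := by
    have := geom_sum_mul (b : ZMod q) p
    rw [hsum, zero_mul] at this
    exact sub_eq_zero.1 this.symm
  by_cases h1 : (b : ZMod q) = 1
  · left
    simp only [h1, one_pow, Finset.sum_const, Finset.card_range, nsmul_eq_mul, mul_one] at hsum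
    exact (Nat.prime_dvd_prime_iff_eq hq hp).1 ((ZMod.natCast_eq_zero_iff p q).1 hsum)
  · right
    have hb0 : (b : ZMod q) ≠ 0 := by
      intro h0
      simp [h0, hp.ne_zero] at hpow
    have hdvd := ZMod.orderOf_dvd_card_sub_one hb0
    rw [orderOf_eq_prime hpow h1] at hdvd
    exact ((Nat.modEq_iff_dvd' hq.one_le).2 hdvd).symm

/-- A divisor of a repunit of prime length `p` is `0` or `1` modulo `p`. -/
theorem dvd_or_modeq_one_of_dvd_geom_sum {b : ℤ} {p : ℕ} (hp : p.Prime) (d : ℕ)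
    (h : (d : ℤ) ∣ ∑ i ∈ Finset.range p, b ^ i) : p ∣ d ∨ d ≡ 1 [MOD p] := by
  induction d using induction_on_primes with
  | zero => exact Or.inl (dvd_zero p)
  | one => exact Or.inr rfl
  | prime_mul q d hq ih =>
    push_cast at h
    rcases prime_eq_or_modeq_one_of_dvd_geom_sum hp hq (dvd_of_mul_right_dvd h) with rfl | hq1
    · exact Or.inl (dvd_mul_right q d)
    · rcases ih (dvd_of_mul_left_dvd h) with hd | hd
      · exact Or.inl (hd.mul_left q)
      · exact Or.inr (by simpa using hq1.mul hd)

/-- **Theorem 2 (i).** Let `b ≥ 2` and `n ≥ 2` be integers, `a` an integer with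
`|a| ≤ n`, and `p ≥ 7` a prime. If `n! = (b^p − 1)/(b − 1) + a`, then `p ∣ a`
or `|a| ≡ 1 (mod p)`. -/
theorem dvd_or_abs_modeq_one (b : ℤ) (n : ℕ) (a : ℤ) (p : ℕ)
    (hb : 2 ≤ b) (hn : 2 ≤ n) (ha : |a| ≤ (n : ℤ))
    (hp : Nat.Prime p) (hp7 : 7 ≤ p)
    (heq : (Nat.factorial n : ℤ) = (∑ i ∈ Finset.range p, b ^ i) + a) :
    (p : ℤ) ∣ a ∨ |a| ≡ 1 [ZMOD (p : ℤ)] := by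
  by_cases ha0 : a = 0
  · exact Or.inl (ha0 ▸ dvd_zero _)
  have natAbs_le : a.natAbs ≤ n := by
    rw [Int.abs_eq_natAbs] at ha
    exact_mod_cast ha
  have hfac : (a.natAbs : ℤ) ∣ (n.factorial : ℤ) :=
    Int.natCast_dvd_natCast.2 (Nat.dvd_factorial (Int.natAbs_pos.2 ha0) natAbs_le)
  have hdvd : (a.natAbs : ℤ) ∣ ∑ i ∈ Finset.range p, b ^ i := by
    rw [heq] at hfac
    exact (dvd_add_left (Int.natAbs_dvd.2 dvd_rfl)).1 hfac
  rcases dvd_or_modeq_one_of_dvd_geom_sum hp a.natAbs hdvd with h | h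
  · exact Or.inl (Int.natCast_dvd.2 h)
  · right
    rw [Int.abs_eq_natAbs]
    exact_mod_cast Int.natCast_modEq_iff.2 h
end

section
/- There exists a positive integer n₀ with the following property. Let p ≥ 7 be prime and let a be a nonzero integer such that the polynomial Φ_p(X) + a is either irreducible over ℚ, or equal to a product of a linear polynomial and an irreducible polynomial in ℤ[X]. If n ≥ n₀ and b ≥ 2 are integers with n! = (b^p − 1)/(b − 1) + a, then |a| ≥ 0.5·(log log log n)/(log log log log n). -/
open Polynomial

/-- A uniform bound for the partial sums of `log k / k ^ 2`. -/
lemma exists_sum_log_div_sq_le :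
    ∃ c : ℝ, 0 < c ∧ ∀ s : Finset ℕ, ∑ k ∈ s, Real.log k / (k : ℝ) ^ 2 ≤ c := by
  have hs : Summable fun k : ℕ => 2 * (1 / (k : ℝ) ^ (3 / 2 : ℝ)) :=
    (Real.summable_one_div_nat_rpow.mpr (by norm_num)).mul_left 2
  refine ⟨∑' k : ℕ, 2 * (1 / (k : ℝ) ^ (3 / 2 : ℝ)) + 1, ?_, fun s => ?_⟩
  · have : 0 ≤ ∑' k : ℕ, 2 * (1 / (k : ℝ) ^ (3 / 2 : ℝ)) :=
      tsum_nonneg fun k => by positivity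
    linarith
  · refine le_trans (Finset.sum_le_sum fun k _ => ?_)
      ((hs.sum_le_tsum s fun k _ => by positivity).trans (by linarith))
    rcases Nat.eq_zero_or_pos k with rfl | hk
    · simp
    · have hk' : (0 : ℝ) < k := by exact_mod_cast hk
      have h1 := Real.log_le_rpow_div hk'.le (ε := 1 / 2) (by norm_num)
      have h2 : (k : ℝ) ^ (1 / 2 : ℝ) * (k : ℝ) ^ (3 / 2 : ℝ) = (k : ℝ) ^ 2 := by
        rw [← Real.rpow_add hk']; norm_num
      rw [mul_one_div, div_le_div_iff₀ (by positivity) (by positivity), ← h2]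
      have h3 : (0 : ℝ) < (k : ℝ) ^ (3 / 2 : ℝ) := by positivity
      nlinarith

lemma sum_log_primesLE_le (n : ℕ) :
    ∑ q ∈ Nat.primesLE n, Real.log q ≤ Real.log 4 * n := by
  rw [← Chebyshev.theta_eq_sum_primesLE_log]
  exact Chebyshev.theta_le_log4_mul_x (by positivity)

lemma log_factorial_ge (n : ℕ) : n * Real.log n - n ≤ Real.log n.factorial := by
  rcases Nat.eq_zero_or_pos n with rfl | hn
  · simp
  · have h := Real.pow_div_factorial_le_exp (n : ℝ) (by positivity) n
    have hf : (0 : ℝ) < n.factorial := by exact_mod_cast n.factorial_pos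
    have hn' : (0 : ℝ) < n := by exact_mod_cast hn
    have h2 := Real.log_le_log (by positivity) h
    rw [Real.log_div (by positivity) hf.ne', Real.log_pow, Real.log_exp] at h2
    linarith

lemma log_factorial_eq_sum (n : ℕ) :
    Real.log n.factorial =
      ∑ q ∈ Nat.primesLE n, (padicValNat q n.factorial : ℝ) * Real.log q := by
  have h := Nat.prod_pow_prime_padicValNat n.factorial n.factorial_ne_zero (n.factorial + 1)
    (Nat.lt_succ_self _)
  have h2 : ∏ q ∈ Nat.primesLE n, q ^ padicValNat q n.factorial = n.factorial := by
    conv_rhs => rw [← h]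
    refine Finset.prod_subset (fun q hq => ?_) (fun q hq hq' => ?_)
    · rw [Nat.mem_primesLE] at hq
      simp only [Finset.mem_filter, Finset.mem_range]
      exact ⟨Nat.lt_succ_of_le (hq.1.trans n.self_le_factorial), hq.2⟩
    · simp only [Finset.mem_filter, Finset.mem_range] at hq
      rw [Nat.mem_primesLE] at hq'
      rw [padicValNat.eq_zero_of_not_dvd, pow_zero]
      intro h3
      exact hq' ⟨(hq.2.dvd_factorial).1 h3, hq.2⟩
  conv_lhs => rw [← h2]
  push_cast
  rw [Real.log_prod]
  · exact Finset.sum_congr rfl fun q _ => Real.log_pow _ _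
  · intro q hq
    have := (Nat.mem_primesLE.1 hq).2.pos
    positivity

/-- The lower bound in Mertens' first theorem. -/
lemma exists_log_sub_le_sum_primesLE :
    ∃ c : ℝ, 0 < c ∧ ∀ n : ℕ, 0 < n →
      Real.log n - c ≤ ∑ q ∈ Nat.primesLE n, Real.log q / q := by
  obtain ⟨c, hc, hsum⟩ := exists_sum_log_div_sq_le
  refine ⟨2 * c + 1, by positivity, fun n hn => ?_⟩
  have hn' : (0 : ℝ) < n := by exact_mod_cast hn
  have h1 := log_factorial_ge n
  rw [log_factorial_eq_sum] at h1
  have h2 : ∑ q ∈ Nat.primesLE n, (padicValNat q n.factorial : ℝ) * Real.log q ≤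
      ∑ q ∈ Nat.primesLE n, n * (Real.log q / q + 2 * (Real.log q / (q : ℝ) ^ 2)) := by
    refine Finset.sum_le_sum fun q hq => ?_
    have hq' := (Nat.mem_primesLE.1 hq).2
    have := Fact.mk hq'
    have h3 := sub_one_mul_padicValNat_factorial (p := q) n
    have h4 : (q - 1) * padicValNat q n.factorial ≤ n := by omega
    have hq2 : (2 : ℝ) ≤ q := by exact_mod_cast hq'.two_le
    have h5 : ((q : ℝ) - 1) * (padicValNat q n.factorial : ℝ) ≤ n := by
      have := hq'.one_le
      have h6 : (((q - 1 : ℕ) * padicValNat q n.factorial : ℕ) : ℝ) ≤ n := by exact_mod_cast h4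
      rwa [Nat.cast_mul, Nat.cast_sub this, Nat.cast_one] at h6
    have hl : 0 ≤ Real.log q := Real.log_nonneg (by linarith)
    have h7 : (padicValNat q n.factorial : ℝ) ≤ n * (1 / q + 2 * (1 / (q : ℝ) ^ 2)) := by
      have h8 : (padicValNat q n.factorial : ℝ) ≤ n / ((q : ℝ) - 1) := by
        rw [le_div_iff₀ (by linarith)]; linarith
      refine h8.trans ?_
      rw [div_eq_mul_one_div]
      refine mul_le_mul_of_nonneg_left ?_ hn'.le
      have : 1 / (q : ℝ) + 2 * (1 / (q : ℝ) ^ 2) = (q + 2) / (q : ℝ) ^ 2 := by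
        field_simp
      rw [this, div_le_div_iff₀ (by linarith) (by positivity)]
      nlinarith
    calc _ ≤ n * (1 / q + 2 * (1 / (q : ℝ) ^ 2)) * Real.log q :=
          mul_le_mul_of_nonneg_right h7 hl
      _ = _ := by ring
  rw [← Finset.mul_sum, Finset.sum_add_distrib, ← Finset.mul_sum] at h2
  have h3 := hsum (Nat.primesLE n)
  have h4 : n * (Real.log n - 1) ≤ n * (∑ q ∈ Nat.primesLE n, Real.log q / q +
      2 * ∑ q ∈ Nat.primesLE n, Real.log q / (q : ℝ) ^ 2) := by linarith
  have h5 := le_of_mul_le_mul_left h4 hn'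
  linarith

/-- If `N` takes up the full `q`-part of `n!` for all `q` in a set of primes, the set is small. -/
lemma sum_log_div_le_of_dvd {n N : ℕ} (hn : 0 < n) (hN : N ≠ 0) (s : Finset ℕ)
    (hs : s ⊆ Nat.primesLE n) (h : ∀ q ∈ s, q ^ padicValNat q n.factorial ∣ N) :
    ∑ q ∈ s, Real.log q / q ≤ Real.log N / n + Real.log 4 := by
  have hn' : (0 : ℝ) < n := by exact_mod_cast hn
  have hdvd : ∏ q ∈ s, q ^ padicValNat q n.factorial ∣ N := by
    refine Finset.prod_dvd_of_isRelPrime (fun q hq r hr hqr => ?_) h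
    exact Nat.coprime_iff_isRelPrime.1 (Nat.Coprime.pow _ _ ((Nat.coprime_primes
      (Nat.mem_primesLE.1 (hs hq)).2 (Nat.mem_primesLE.1 (hs hr)).2).2 hqr))
  have hle : ((∏ q ∈ s, q ^ padicValNat q n.factorial : ℕ) : ℝ) ≤ N := by
    exact_mod_cast Nat.le_of_dvd (Nat.pos_of_ne_zero hN) hdvd
  have hpos : ∀ q ∈ s, 0 < q := fun q hq => (Nat.mem_primesLE.1 (hs hq)).2.pos
  have h1 := Real.log_le_log (by
    exact_mod_cast Finset.prod_pos fun q hq => pow_pos (hpos q hq) _) hle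
  push_cast at h1
  rw [Real.log_prod (fun q hq => by have := hpos q hq; positivity)] at h1
  have h2 : ∑ q ∈ s, (n * (Real.log q / q) - Real.log q) ≤
      ∑ q ∈ s, Real.log ((q : ℝ) ^ padicValNat q n.factorial) := by
    refine Finset.sum_le_sum fun q hq => ?_
    have hq' := (Nat.mem_primesLE.1 (hs hq)).2
    have hq0 : (0 : ℝ) < q := by exact_mod_cast hq'.pos
    have := Fact.mk hq'
    rw [Real.log_pow]
    have h3 : n / q ≤ padicValNat q n.factorial := by
      have h4 : q ^ (n / q) ∣ n.factorial := by
        have h5 : q ^ (n / q) * (n / q).factorial ∣ n.factorial := by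
          have h9 : ∀ k : ℕ, q ^ k * k.factorial ∣ (q * k).factorial := by
            intro k
            induction k with
            | zero => simp
            | succ k ih =>
              have h10 : (q * (k + 1)).factorial = (q * k + q).factorial := by ring_nf
              have h11 : (q * k + q).factorial =
                  (q * k + q) * (q * k + (q - 1)).factorial := by
                obtain ⟨r, rfl⟩ : ∃ r, q = r + 1 := ⟨q - 1, by have := hq'.pos; omega⟩
                rw [← add_assoc, Nat.factorial_succ]; simp
              rw [h10, h11, pow_succ, Nat.factorial_succ]
              have h12 : (q * k).factorial ∣ (q * k + (q - 1)).factorial :=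
                Nat.factorial_dvd_factorial (Nat.le_add_right _ _)
              calc q ^ k * q * ((k + 1) * k.factorial)
                  = (q * k + q) * (q ^ k * k.factorial) := by ring
                _ ∣ _ := mul_dvd_mul_left _ (ih.trans h12)
          exact (h9 _).trans (Nat.factorial_dvd_factorial (Nat.mul_div_le n q))
        exact (dvd_mul_right _ _).trans h5
      exact (padicValNat_dvd_iff_le n.factorial_ne_zero).1 h4
    have h4 : (n : ℝ) / q - 1 ≤ padicValNat q n.factorial := by
      have h5 : (n : ℝ) / q < (n / q : ℕ) + 1 := by
        rw [div_lt_iff₀ hq0]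
        have := Nat.lt_mul_div_succ n hq'.pos
        calc (n : ℝ) < (q * (n / q + 1) : ℕ) := by exact_mod_cast this
          _ = _ := by push_cast; ring
      have h6 : ((n / q : ℕ) : ℝ) ≤ padicValNat q n.factorial := by exact_mod_cast h3
      linarith
    have hl : 0 ≤ Real.log q := Real.log_nonneg (by exact_mod_cast hq'.one_le)
    calc _ = (n / q - 1) * Real.log q := by ring
      _ ≤ _ := mul_le_mul_of_nonneg_right h4 hl
  rw [Finset.sum_sub_distrib, ← Finset.mul_sum] at h2
  have h3 : ∑ q ∈ s, Real.log q ≤ Real.log 4 * n := by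
    refine le_trans (Finset.sum_le_sum_of_subset_of_nonneg hs fun q hq _ => ?_)
      (sum_log_primesLE_le n)
    exact Real.log_nonneg (by exact_mod_cast (Nat.mem_primesLE.1 hq).2.one_le)
  rw [div_add' _ _ _ hn'.ne', le_div_iff₀ hn']
  linarith

lemma sum_log_le_of_prime_dvd {N : ℕ} (hN : N ≠ 0) (s : Finset ℕ)
    (hs : ∀ q ∈ s, q.Prime ∧ q ∣ N) : ∑ q ∈ s, Real.log q ≤ Real.log N := by
  have hdvd : ∏ q ∈ s, q ∣ N := by
    refine Finset.prod_dvd_of_isRelPrime (fun q hq r hr hqr => ?_) fun q hq => (hs q hq).2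
    exact Nat.coprime_iff_isRelPrime.1 ((Nat.coprime_primes (hs q hq).1 (hs r hr).1).2 hqr)
  rw [← Real.log_prod (fun q hq => by have := (hs q hq).1.pos; positivity)]
  refine Real.log_le_log ?_ ?_
  · exact Finset.prod_pos fun q hq => by exact_mod_cast (hs q hq).1.pos
  · have h := Nat.le_of_dvd (Nat.pos_of_ne_zero hN) hdvd
    calc ∏ q ∈ s, (q : ℝ) = ((∏ q ∈ s, q : ℕ) : ℝ) := by push_cast; rfl
      _ ≤ N := by exact_mod_cast h

/-- Chebyshev's bound on the interval `(Y, k * Y]`. -/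
lemma sum_log_div_primesLE_sdiff_le (Y k : ℕ) (hY : 0 < Y) :
    ∑ q ∈ Nat.primesLE (k * Y) \ Nat.primesLE Y, Real.log q / q ≤ Real.log 4 * k := by
  have hY' : (0 : ℝ) < Y := by exact_mod_cast hY
  have h1 : ∑ q ∈ Nat.primesLE (k * Y) \ Nat.primesLE Y, Real.log q / q ≤
      ∑ q ∈ Nat.primesLE (k * Y) \ Nat.primesLE Y, Real.log q / Y := by
    refine Finset.sum_le_sum fun q hq => ?_
    rw [Finset.mem_sdiff, Nat.mem_primesLE, Nat.mem_primesLE] at hq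
    have h2 : Y < q := by
      by_contra h; exact hq.2 ⟨not_lt.1 h, hq.1.2⟩
    have h3 : (Y : ℝ) ≤ q := by exact_mod_cast h2.le
    exact div_le_div_of_nonneg_left
      (Real.log_nonneg (by exact_mod_cast hq.1.2.one_le)) hY' h3
  refine h1.trans ?_
  rw [← Finset.sum_div, div_le_iff₀ hY']
  refine le_trans (Finset.sum_le_sum_of_subset_of_nonneg Finset.sdiff_subset fun q hq _ => ?_)
    ((sum_log_primesLE_le (k * Y)).trans (by push_cast; linarith))
  exact Real.log_nonneg (by exact_mod_cast (Nat.mem_primesLE.1 hq).2.one_le)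

/-- The integer points of the half-open cube `[lo, hi) ^ d`. -/
noncomputable def intBox (d : ℕ) (lo hi : ℤ) : Finset (Fin d → ℤ) :=
  Fintype.piFinset fun _ => Finset.Ico lo hi

lemma mem_intBox {d : ℕ} {lo hi : ℤ} {c : Fin d → ℤ} :
    c ∈ intBox d lo hi ↔ ∀ i, lo ≤ c i ∧ c i < hi := by
  simp [intBox]

lemma card_intBox (d : ℕ) (lo hi : ℤ) : (intBox d lo hi).card = (hi - lo).toNat ^ d := by
  simp [intBox]

open Classical in
/-- A cube meets all fibres of a homomorphism about equally often (upper bound). -/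
lemma card_mul_card_fiber_le {d : ℕ} {A : Type*} [AddCommGroup A] [Fintype A]
    (g : (Fin d → ℤ) →+ A) (S X : ℕ)
    (hS : ∀ a, ∃ z : Fin d → ℤ, (∀ i, |z i| ≤ S) ∧ g z = a) :
    Fintype.card A * ((intBox d 0 X).filter fun c => g c = 0).card ≤ (X + 2 * S) ^ d := by
  have h1 : (intBox d (-S) (X + S)).card = (X + 2 * S) ^ d := by
    rw [card_intBox]; congr 1; omega
  rw [← h1, Finset.card_eq_sum_card_fiberwise (s := intBox d (-S) (X + S)) (f := g)
    (t := Finset.univ) (fun _ _ => by simp), ← Finset.card_univ, ← smul_eq_mul, ← Finset.sum_const]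
  refine Finset.sum_le_sum fun a _ => ?_
  obtain ⟨z, hz, rfl⟩ := hS a
  refine Finset.card_le_card_of_injOn (fun c => c + z) (fun c hc => ?_)
    (fun c _ c' _ h => add_right_cancel h)
  simp only [Finset.coe_filter, Set.mem_ofPred_eq, mem_intBox] at hc ⊢
  refine ⟨fun i => ?_, by simp [hc.2]⟩
  have h2 := hc.1 i
  have h3 := abs_le.1 (hz i)
  simp only [Pi.add_apply]
  omega

open Classical in
/-- A cube meets all fibres of a homomorphism about equally often (lower bound). -/
lemma le_card_mul_card_fiber {d : ℕ} {A : Type*} [AddCommGroup A] [Fintype A]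
    (g : (Fin d → ℤ) →+ A) (S X : ℕ)
    (hS : ∀ a, ∃ z : Fin d → ℤ, (∀ i, |z i| ≤ S) ∧ g z = a) :
    (X - 2 * S) ^ d ≤ Fintype.card A * ((intBox d 0 X).filter fun c => g c = 0).card := by
  have h1 : (intBox d S (X - S)).card = (X - 2 * S) ^ d := by
    rw [card_intBox]; congr 1; omega
  rw [← h1, Finset.card_eq_sum_card_fiberwise (f := g) (t := Finset.univ) (fun _ _ => by simp),
    ← Finset.card_univ, ← smul_eq_mul, ← Finset.sum_const]
  refine Finset.sum_le_sum fun a _ => ?_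
  obtain ⟨z, hz, rfl⟩ := hS a
  refine Finset.card_le_card_of_injOn (fun c => c - z) (fun c hc => ?_)
    (fun c _ c' _ h => sub_left_injective h)
  simp only [Finset.coe_filter, Set.mem_ofPred_eq, mem_intBox] at hc ⊢
  refine ⟨fun i => ?_, by simp [hc.2]⟩
  have h2 := hc.1 i
  have h3 := abs_le.1 (hz i)
  simp only [Pi.sub_apply]
  omega

/-- Packing bound for separated subsets of a cube. -/
lemma card_mul_pow_le_of_separated {d : ℕ} {s X : ℕ} (hs : 0 < s) (hsX : s ≤ X)
    (T : Finset (Fin d → ℤ)) (hT : T ⊆ intBox d 0 X)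
    (hsep : ∀ x ∈ T, ∀ y ∈ T, (∀ i, |x i - y i| < s) → x = y) :
    T.card * s ^ d ≤ (2 * X) ^ d := by
  have hs' : (0 : ℤ) < s := by exact_mod_cast hs
  have h1 : T.card ≤ (intBox d 0 (X / s + 1 : ℤ)).card := by
    refine Finset.card_le_card_of_injOn (fun c i => c i / s) (fun c hc => ?_) ?_
    · have h2 := mem_intBox.1 (hT hc)
      refine mem_intBox.2 fun i => ⟨Int.ediv_nonneg (h2 i).1 hs'.le, ?_⟩
      exact Int.lt_add_one_of_le (Int.ediv_le_ediv hs' (h2 i).2.le)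
    · intro x hx y hy h
      refine hsep x hx y hy fun i => ?_
      have h2 : x i / s = y i / s := congrFun h i
      have h3 := Int.emod_add_mul_ediv (x i) s
      have h4 := Int.emod_add_mul_ediv (y i) s
      have h5 := Int.emod_nonneg (x i) hs'.ne'
      have h6 := Int.emod_nonneg (y i) hs'.ne'
      have h7 := Int.emod_lt_of_pos (x i) hs'
      have h8 := Int.emod_lt_of_pos (y i) hs'
      rw [h2] at h3
      rw [abs_lt]
      constructor <;> linarith
  rw [card_intBox] at h1
  have h2 : ((X / s + 1 : ℤ) - 0).toNat = X / s + 1 := by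
    have : ((X : ℤ) / s + 1 - 0) = ((X / s + 1 : ℕ) : ℤ) := by push_cast; ring
    rw [this, Int.toNat_natCast]
  rw [h2] at h1
  calc T.card * s ^ d ≤ (X / s + 1) ^ d * s ^ d := Nat.mul_le_mul_right _ h1
    _ = ((X / s + 1) * s) ^ d := (mul_pow _ _ _).symm
    _ ≤ (2 * X) ^ d := by
      refine Nat.pow_le_pow_left ?_ d
      have := Nat.div_mul_le_self X s
      rw [add_mul]; omega

lemma exists_small_ne_zero_of_card_lt {d : ℕ} {A : Type*} [AddCommGroup A] [Fintype A]
    (g : (Fin d → ℤ) →+ A) (Z : ℕ) (h : Fintype.card A < (Z + 1) ^ d) :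
    ∃ v : Fin d → ℤ, v ≠ 0 ∧ (∀ i, |v i| ≤ Z) ∧ g v = 0 := by
  have h1 : (Finset.univ : Finset A).card < (intBox d 0 (Z + 1)).card := by
    rw [card_intBox, Finset.card_univ]
    have : ((Z : ℤ) + 1 - 0).toNat = Z + 1 := by omega
    rwa [this]
  obtain ⟨x, hx, y, hy, hxy, hg⟩ := Finset.exists_ne_map_eq_of_card_lt_of_maps_to h1
    (f := g) (fun _ _ => by simp)
  refine ⟨x - y, sub_ne_zero.2 hxy, fun i => ?_, by simp [hg]⟩
  have h2 := mem_intBox.1 hx i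
  have h3 := mem_intBox.1 hy i
  rw [Pi.sub_apply, abs_le]
  omega

/-- The combination `∑ cᵢ xⁱ`. -/
noncomputable def intComb {R : Type*} [CommRing R] (x : R) (d : ℕ) : (Fin d → ℤ) →+ R where
  toFun c := ∑ i, (c i : R) * x ^ (i : ℕ)
  map_zero' := by simp
  map_add' a b := by simp [add_mul, Finset.sum_add_distrib]

lemma intComb_apply {R : Type*} [CommRing R] (x : R) (d : ℕ) (c : Fin d → ℤ) :
    intComb x d c = ∑ i, (c i : R) * x ^ (i : ℕ) := rfl

lemma map_intComb {R S F : Type*} [CommRing R] [CommRing S] [FunLike F R S] [RingHomClass F R S]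
    (f : F) (x : R) (d : ℕ) (c : Fin d → ℤ) :
    f (intComb x d c) = intComb (f x) d c := by
  simp [intComb_apply]

lemma aeval_intComb_X {R : Type*} [CommRing R] (x : R) (d : ℕ) (c : Fin d → ℤ) :
    aeval x (intComb (X : ℤ[X]) d c) = intComb x d c := by
  rw [map_intComb, aeval_X]

lemma exists_dvd_sub_intComb {F : ℤ[X]} (hF : F.Monic) {d : ℕ} (hd : F.natDegree = d) (P : ℤ[X]) :
    ∃ z : Fin d → ℤ, F ∣ P - intComb X d z := by
  subst hd
  by_cases h1 : F = 1
  · exact ⟨0, by rw [h1]; exact one_dvd _⟩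
  refine ⟨fun i => (P %ₘ F).coeff i, P /ₘ F, ?_⟩
  have h2 : intComb (X : ℤ[X]) F.natDegree (fun i => (P %ₘ F).coeff i) = P %ₘ F := by
    rw [intComb_apply]
    conv_rhs => rw [as_sum_range' (P %ₘ F) F.natDegree (natDegree_modByMonic_lt P hF h1)]
    rw [Finset.sum_range]
    refine Finset.sum_congr rfl fun i _ => ?_
    rw [← C_mul_X_pow_eq_monomial]; simp
  rw [h2, sub_eq_iff_eq_add']
  exact (modByMonic_add_div P F).symm

section PowerBasis

variable {K : Type*} [Field K] [NumberField K] (pb : PowerBasis ℚ K)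

lemma repr_intComb (c : Fin pb.dim → ℤ) (i : Fin pb.dim) :
    pb.basis.repr (intComb pb.gen pb.dim c) i = c i := by
  have h : intComb pb.gen pb.dim c = ∑ j, (c j : ℚ) • pb.basis j := by
    simp [intComb_apply, Algebra.smul_def]
  rw [h, pb.basis.repr_sum_self]

lemma intComb_gen_ne_zero {c : Fin pb.dim → ℤ} (hc : c ≠ 0) :
    intComb pb.gen pb.dim c ≠ 0 := by
  intro h
  apply hc
  funext i
  have := repr_intComb pb c i
  rw [h] at this
  simpa using this.symm

lemma abs_repr_mul_le {h : ℕ} (hh : ∀ i, |(minpoly ℚ pb.gen).coeff i| ≤ h) {x y : K} {a b : ℚ}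
    (hx : ∀ i, |pb.basis.repr x i| ≤ a) (hy : ∀ i, |pb.basis.repr y i| ≤ b) (i : Fin pb.dim) :
    |pb.basis.repr (x * y) i| ≤ (pb.dim * (pb.dim * (h + 1)) ^ pb.dim : ℕ) * a * b := by
  have hd : 1 ≤ pb.dim := pb.dim_pos
  have ha : 0 ≤ a := (abs_nonneg _).trans (hx ⟨0, hd⟩)
  have hb : 0 ≤ b := (abs_nonneg _).trans (hy ⟨0, hd⟩)
  set D : ℕ := pb.dim * (h + 1) with hD
  have hD1 : 1 ≤ D := Nat.mul_pos hd (by omega)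
  have hD1' : (1 : ℚ) ≤ D := by exact_mod_cast hD1
  have step : ∀ (y : K) (b : ℚ), 0 ≤ b → (∀ i, |pb.basis.repr y i| ≤ b) →
      ∀ i, |pb.basis.repr (pb.gen * y) i| ≤ D * b := by
    intro y b hb hy i
    rw [← Algebra.leftMulMatrix_mulVec_repr, Matrix.mulVec, dotProduct]
    refine (Finset.abs_sum_le_sum_abs _ _).trans ?_
    have h1 : ∀ j ∈ Finset.univ, |Algebra.leftMulMatrix pb.basis pb.gen i j *
        pb.basis.repr y j| ≤ (h + 1) * b := by
      intro j _
      rw [abs_mul]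
      refine mul_le_mul ?_ (hy j) (abs_nonneg _) (by positivity)
      rw [PowerBasis.leftMulMatrix, Matrix.of_apply]
      split_ifs
      · rw [abs_neg, ← PowerBasis.minpolyGen_eq] at *
        exact (hh i).trans (by linarith)
      · simp
      · simp; positivity
    refine (Finset.sum_le_sum h1).trans ?_
    simp [hD, mul_assoc]
  have step2 : ∀ n, ∀ i, |pb.basis.repr (pb.gen ^ n * y) i| ≤ (D : ℚ) ^ n * b := by
    intro n
    induction n with
    | zero => simpa using hy
    | succ n ih =>
      intro i
      have := step _ _ (by positivity) ih i
      rwa [← mul_assoc, ← pow_succ', ← mul_assoc, ← pow_succ'] at this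
  have hx2 : x * y = ∑ j, pb.basis.repr x j • (pb.gen ^ (j : ℕ) * y) := by
    conv_lhs => rw [← pb.basis.sum_repr x]
    rw [Finset.sum_mul]
    refine Finset.sum_congr rfl fun j _ => ?_
    rw [PowerBasis.basis_eq_pow, smul_mul_assoc]
  rw [hx2, map_sum, Finsupp.finsetSum_apply]
  refine (Finset.abs_sum_le_sum_abs _ _).trans ?_
  have h2 : ∀ j ∈ Finset.univ, |pb.basis.repr (pb.basis.repr x j • (pb.gen ^ (j : ℕ) * y)) i| ≤
      a * ((D : ℚ) ^ pb.dim * b) := by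
    intro j _
    rw [map_smul, Finsupp.smul_apply, smul_eq_mul, abs_mul]
    refine mul_le_mul (hx j) ((step2 j i).trans ?_) (abs_nonneg _) ha
    exact mul_le_mul_of_nonneg_right (pow_le_pow_right₀ hD1' j.2.le) hb
  refine (Finset.sum_le_sum h2).trans ?_
  simp only [Finset.sum_const, Finset.card_univ, Fintype.card_fin, nsmul_eq_mul]
  push_cast
  apply le_of_eq
  ring

open NumberField

variable {pb} {θ : 𝓞 K}

lemma algebraMap_intComb (hθ : (θ : K) = pb.gen) (c : Fin pb.dim → ℤ) :
    (intComb θ pb.dim c : K) = intComb pb.gen pb.dim c := by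
  exact (map_intComb (algebraMap (𝓞 K) K) θ pb.dim c).trans (by rw [← hθ])

lemma intComb_ne_zero (hθ : (θ : K) = pb.gen) {c : Fin pb.dim → ℤ} (hc : c ≠ 0) :
    intComb θ pb.dim c ≠ 0 := by
  intro h
  apply intComb_gen_ne_zero pb hc
  rw [← algebraMap_intComb hθ, h]
  exact map_zero (algebraMap (𝓞 K) K)

lemma minpoly_map_eq (hθ : (θ : K) = pb.gen) :
    (minpoly ℤ θ).map (Int.castRingHom ℚ) = minpoly ℚ pb.gen := by
  have h := minpoly.isIntegrallyClosed_eq_field_fractions ℚ K (RingOfIntegers.isIntegral θ)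
  rw [← hθ]
  exact h.symm

lemma natDegree_minpoly_eq_dim (hθ : (θ : K) = pb.gen) :
    (minpoly ℤ θ).natDegree = pb.dim := by
  rw [← pb.natDegree_minpoly, ← minpoly_map_eq hθ,
    natDegree_map_eq_of_injective (RingHom.injective_int _)]

/-- Every residue class of a degree one prime of `ℤ[θ]` has a small representative. -/
lemma exists_small_representative (hθ : (θ : K) = pb.gen) {C : ℕ}
    (hC : ∀ (x y : K) (a b : ℚ), (∀ i, |pb.basis.repr x i| ≤ a) →
      (∀ i, |pb.basis.repr y i| ≤ b) → ∀ i, |pb.basis.repr (x * y) i| ≤ C * a * b)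
    {q Z : ℕ} [NeZero q] (hq : q ≤ Z ^ pb.dim) {t : ZMod q} (ht : aeval t (minpoly ℤ θ) = 0)
    (a : ZMod q) : ∃ z : Fin pb.dim → ℤ, (∀ i, |z i| ≤ (C * Z : ℕ)) ∧ intComb t pb.dim z = a := by
  obtain ⟨v, hv0, hvZ, hv⟩ := exists_small_ne_zero_of_card_lt (intComb t pb.dim) Z (by
    rw [ZMod.card]
    exact hq.trans_lt (Nat.pow_lt_pow_left (Nat.lt_succ_self Z) pb.dim_pos.ne'))
  set V : K := intComb pb.gen pb.dim v with hV
  have hV0 : V ≠ 0 := intComb_gen_ne_zero pb hv0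
  set u : Fin pb.dim → ℚ := fun i => pb.basis.repr ((a.val : K) / V) i with hu
  set m : Fin pb.dim → ℤ := fun i => ⌊u i⌋ with hm
  have hF : (minpoly ℤ θ).Monic := minpoly.monic (RingOfIntegers.isIntegral θ)
  have hdeg := natDegree_minpoly_eq_dim hθ
  obtain ⟨z, hz⟩ := exists_dvd_sub_intComb hF hdeg
    ((a.val : ℤ[X]) - intComb X pb.dim v * intComb X pb.dim m)
  have hzt : intComb t pb.dim z = a := by
    obtain ⟨r, hr⟩ := hz
    have h1 := congrArg (aeval t) hr
    rw [map_mul, ht, zero_mul, map_sub, map_sub, map_mul, aeval_intComb_X, aeval_intComb_X,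
      aeval_intComb_X, hv, zero_mul, sub_zero, map_natCast, sub_eq_zero] at h1
    rw [← h1, ZMod.natCast_zmod_val]
  have hzθ : intComb pb.gen pb.dim z = V * (((a.val : K) / V) - intComb pb.gen pb.dim m) := by
    obtain ⟨r, hr⟩ := hz
    have h0 : aeval pb.gen (minpoly ℤ θ) = 0 := by
      rw [← hθ]
      have := minpoly.aeval ℤ θ
      have h2 := congrArg (algebraMap (𝓞 K) K) this
      rwa [map_zero, ← aeval_algebraMap_apply] at h2
    have h1 := congrArg (aeval pb.gen) hr
    rw [map_mul, h0, zero_mul, map_sub, map_sub, map_mul, aeval_intComb_X, aeval_intComb_X,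
      aeval_intComb_X, map_natCast, sub_eq_zero] at h1
    rw [← h1, mul_sub, mul_div_cancel₀ _ hV0]
  refine ⟨z, fun i => ?_, hzt⟩
  have h3 := hC V (((a.val : K) / V) - intComb pb.gen pb.dim m) Z 1
    (fun i => by rw [hV, repr_intComb]; exact_mod_cast hvZ i)
    (fun i => by
      rw [map_sub, Finsupp.sub_apply, repr_intComb]
      have h4 := Int.fract_nonneg (u i)
      have h5 := Int.fract_lt_one (u i)
      rw [Int.fract] at h4 h5
      exact abs_le.2 ⟨by linarith, h5.le⟩) i
  rw [← hzθ, repr_intComb] at h3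
  rw [mul_one] at h3
  exact_mod_cast h3

end PowerBasis

section Norms

open NumberField

variable {K : Type*} [Field K] [NumberField K] {pb : PowerBasis ℚ K} {θ : 𝓞 K}

lemma absNorm_span_eq_prod (x : 𝓞 K) :
    (Ideal.absNorm (Ideal.span {x}) : ℝ) = ∏ σ : K →ₐ[ℚ] ℂ, ‖σ x‖ := by
  rw [Ideal.absNorm_span_singleton, ← norm_prod, ← Algebra.norm_eq_prod_embeddings ℚ ℂ (x : K),
    ← Algebra.coe_norm_int, Nat.cast_natAbs]
  simp

lemma card_embeddings (pb : PowerBasis ℚ K) : Fintype.card (K →ₐ[ℚ] ℂ) = pb.dim := by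
  rw [AlgHom.card, pb.finrank]

lemma prod_const_embeddings (pb : PowerBasis ℚ K) (B : ℝ) :
    ∏ _σ : K →ₐ[ℚ] ℂ, B = B ^ pb.dim := by
  rw [Finset.prod_const, Finset.card_univ, card_embeddings pb]

lemma absNorm_intComb_le (hθ : (θ : K) = pb.gen) {H : ℕ} (hH : 1 ≤ H)
    (hσ : ∀ σ : K →ₐ[ℚ] ℂ, ‖σ θ‖ ≤ H) {a : ℕ} {c : Fin pb.dim → ℤ} (hc : ∀ i, |c i| ≤ a) :
    Ideal.absNorm (Ideal.span {intComb θ pb.dim c}) ≤ (pb.dim * H ^ pb.dim * a) ^ pb.dim := by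
  have h : (Ideal.absNorm (Ideal.span {intComb θ pb.dim c}) : ℝ) ≤
      ((pb.dim * H ^ pb.dim * a : ℕ) : ℝ) ^ pb.dim := by
    rw [absNorm_span_eq_prod]
    rw [← prod_const_embeddings pb]
    refine Finset.prod_le_prod (fun _ _ => norm_nonneg _) fun σ _ => ?_
    rw [algebraMap_intComb hθ, map_intComb, ← hθ, intComb_apply]
    refine (norm_sum_le _ _).trans ?_
    have h1 : ∀ i ∈ Finset.univ, ‖((c i : ℤ) : ℂ) * σ θ ^ ((i : Fin pb.dim) : ℕ)‖ ≤
        a * (H : ℝ) ^ pb.dim := by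
      intro i _
      rw [norm_mul, norm_pow, Complex.norm_intCast]
      have hH' : (1 : ℝ) ≤ H := by exact_mod_cast hH
      refine mul_le_mul (by exact_mod_cast hc i) ?_ (by positivity) (by positivity)
      exact (pow_le_pow_left₀ (norm_nonneg _) (hσ σ) _).trans (pow_le_pow_right₀ hH' i.2.le)
    refine (Finset.sum_le_sum h1).trans (le_of_eq ?_)
    simp only [Finset.sum_const, Finset.card_univ, Fintype.card_fin, nsmul_eq_mul]
    push_cast
    ring
  exact_mod_cast h

open Classical in
/-- Crude upper bound for the number of points of an ideal in a cube. -/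
lemma card_ideal_mul_absNorm_le (hθ : (θ : K) = pb.gen) {C : ℕ}
    (hC : ∀ (a : ℕ) (c : Fin pb.dim → ℤ), (∀ i, |c i| ≤ a) →
      Ideal.absNorm (Ideal.span {intComb θ pb.dim c}) ≤ (C * a) ^ pb.dim)
    (I : Ideal (𝓞 K)) (X : ℕ) :
    (((intBox pb.dim 0 X).erase 0).filter fun c => intComb θ pb.dim c ∈ I).card *
      Ideal.absNorm I ≤ (2 * C * X) ^ pb.dim := by
  set T := ((intBox pb.dim 0 X).erase 0).filter fun c => intComb θ pb.dim c ∈ I with hT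
  rcases T.eq_empty_or_nonempty with h0 | ⟨c₀, hc₀⟩
  · simp [h0]
  have hTmem : ∀ c, c ∈ T ↔ (c ≠ 0 ∧ c ∈ intBox pb.dim 0 X) ∧ intComb θ pb.dim c ∈ I := by
    intro c; rw [hT, Finset.mem_filter, Finset.mem_erase]
  have hex : ∃ s : ℕ, ∃ v : Fin pb.dim → ℤ, v ≠ 0 ∧ intComb θ pb.dim v ∈ I ∧ ∀ i, |v i| ≤ s := by
    refine ⟨X, c₀, ((hTmem _).1 hc₀).1.1, ((hTmem _).1 hc₀).2, fun i => ?_⟩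
    have := mem_intBox.1 ((hTmem _).1 hc₀).1.2 i
    rw [abs_le]; omega
  set s := Nat.find hex with hs
  obtain ⟨v, hv0, hvI, hvs⟩ := Nat.find_spec hex
  have hsX : s ≤ X := by
    refine Nat.find_min' hex ⟨c₀, ((hTmem _).1 hc₀).1.1, ((hTmem _).1 hc₀).2, fun i => ?_⟩
    have := mem_intBox.1 ((hTmem _).1 hc₀).1.2 i
    rw [abs_le]; omega
  have hs0 : 0 < s := by
    rw [Nat.pos_iff_ne_zero]
    intro h
    rw [← hs, h] at hvs
    exact hv0 (funext fun i => by simpa using hvs i)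
  have hN : Ideal.absNorm I ≤ (C * s) ^ pb.dim := by
    refine le_trans (Nat.le_of_dvd ?_ (Ideal.absNorm_dvd_absNorm_of_le
      ((Ideal.span_singleton_le_iff_mem I).2 hvI))) (hC s v hvs)
    rw [Nat.pos_iff_ne_zero, Ne, Ideal.absNorm_eq_zero_iff, Ideal.span_singleton_eq_bot]
    exact intComb_ne_zero hθ hv0
  have hpack := card_mul_pow_le_of_separated hs0 hsX T
    (fun c hc => ((hTmem c).1 hc).1.2) (fun x hx y hy hxy => by
      by_contra hne
      have h1 : s ≤ s - 1 := by
        refine Nat.find_min' hex ⟨x - y, sub_ne_zero.2 hne, ?_, fun i => ?_⟩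
        · rw [map_sub]
          exact I.sub_mem ((hTmem x).1 hx).2 ((hTmem y).1 hy).2
        · have := hxy i
          rw [Pi.sub_apply]; omega
      omega)
  calc T.card * Ideal.absNorm I ≤ T.card * (C * s) ^ pb.dim := Nat.mul_le_mul_left _ hN
    _ = T.card * s ^ pb.dim * C ^ pb.dim := by rw [mul_pow]; ring
    _ ≤ (2 * X) ^ pb.dim * C ^ pb.dim := Nat.mul_le_mul_right _ hpack
    _ = _ := by rw [← mul_pow]; ring

open Classical in
lemma card_small_embedding_le (hθ : (θ : K) = pb.gen) (σ : K →ₐ[ℚ] ℂ) {r X : ℕ} (hr : 1 ≤ r) :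
    ((intBox pb.dim 0 X).filter fun c => ‖σ (intComb θ pb.dim c)‖ < r).card ≤
      3 * r * X ^ (pb.dim - 1) := by
  have hd := pb.dim_pos
  let i₀ : Fin pb.dim := ⟨0, hd⟩
  set T := (intBox pb.dim 0 X).filter fun c => ‖σ (intComb θ pb.dim c)‖ < r with hT
  set P : Finset (Fin pb.dim → ℤ) :=
    Fintype.piFinset fun i => if i = i₀ then {0} else Finset.Ico 0 (X : ℤ) with hP
  have hPcard : P.card = X ^ (pb.dim - 1) := by
    rw [hP, Fintype.card_piFinset]
    have : ∀ i : Fin pb.dim, (if i = i₀ then ({0} : Finset ℤ) else Finset.Ico 0 (X : ℤ)).card =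
        if i = i₀ then 1 else X := by
      intro i; split_ifs <;> simp
    simp only [this]
    rw [Finset.prod_ite, Finset.prod_const_one, one_mul, Finset.prod_const, Finset.filter_ne',
      Finset.card_erase_of_mem (Finset.mem_univ _), Finset.card_univ, Fintype.card_fin]
  rw [← hPcard]
  refine Finset.card_le_mul_card_image_of_maps_to (f := fun c => Function.update c i₀ 0)
    (fun c hc => ?_) _ fun b hb => ?_
  · rw [hT, Finset.mem_filter, mem_intBox] at hc
    rw [hP, Fintype.mem_piFinset]
    intro i
    by_cases hi : i = i₀
    · subst hi; simp
    · simp [hi, hc.1 i]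
  · set k : ℤ := ⌊-(σ (intComb θ pb.dim b)).re⌋ with hk
    have hcard : (Finset.Icc (k - r) (k + r)).card ≤ 3 * r := by
      rw [Int.card_Icc]; omega
    refine le_trans ?_ hcard
    refine Finset.card_le_card_of_injOn (fun c => c i₀) (fun c hc => ?_) ?_
    · simp only [Finset.coe_filter, Set.mem_ofPred_eq, hT, Finset.mem_filter] at hc
      have hcb : c = b + Pi.single i₀ (c i₀) := by
        rw [← hc.2]; ext i
        by_cases hi : i = i₀
        · subst hi; simp
        · simp [hi]
      have h1 : (intComb θ pb.dim c : K) = intComb θ pb.dim b + (c i₀ : K) := by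
        rw [algebraMap_intComb hθ, algebraMap_intComb hθ]
        conv_lhs => rw [hcb]
        rw [map_add]
        congr 1
        rw [intComb_apply, Finset.sum_eq_single i₀]
        · simp [i₀]
        · intro i _ hi; simp [hi]
        · simp
      have h2 := hc.1.2
      rw [h1, map_add, map_intCast] at h2
      have h3 := (Complex.abs_re_le_norm _).trans_lt h2
      rw [Complex.add_re, Complex.intCast_re, abs_lt] at h3
      have h4 := Int.floor_le (-(σ (intComb θ pb.dim b)).re)
      have h5 := Int.lt_floor_add_one (-(σ (intComb θ pb.dim b)).re)
      rw [← hk] at h4 h5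
      have h6 : ((k - r : ℤ) : ℝ) < (c i₀ : ℤ) := by push_cast; linarith
      have h7 : ((c i₀ : ℤ) : ℝ) < ((k + r + 1 : ℤ) : ℝ) := by push_cast; linarith
      have h8 := Int.cast_lt.1 h6
      have h9 := Int.cast_lt.1 h7
      rw [Finset.coe_Icc, Set.mem_Icc]
      change k - r ≤ c i₀ ∧ c i₀ ≤ k + r
      exact ⟨h8.le, by omega⟩
    · intro c hc c' hc' h
      simp only [Finset.coe_filter, Set.mem_ofPred_eq] at hc hc'
      ext i
      by_cases hi : i = i₀
      · subst hi; exact h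
      · have h1 := congrFun (hc.2.trans hc'.2.symm) i
        simpa [hi] using h1

lemma absNorm_intComb_pos (hθ : (θ : K) = pb.gen) {c : Fin pb.dim → ℤ} (hc : c ≠ 0) :
    0 < Ideal.absNorm (Ideal.span {intComb θ pb.dim c}) := by
  rw [Nat.pos_iff_ne_zero, Ne, Ideal.absNorm_eq_zero_iff, Ideal.span_singleton_eq_bot]
  exact intComb_ne_zero hθ hc

/-- Lower bound for the average size of a norm. -/
lemma le_sum_log_absNorm (hθ : (θ : K) = pb.gen) {E r X : ℕ} (hE : 1 ≤ E) (hr : 1 ≤ r)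
    (hX : X = 3 * pb.dim * E * r) :
    (1 - 1 / (E : ℝ)) * (X : ℝ) ^ pb.dim * (pb.dim * Real.log r) ≤
      ∑ c ∈ (intBox pb.dim 0 X).erase 0,
        Real.log (Ideal.absNorm (Ideal.span {intComb θ pb.dim c})) := by
  classical
  have hd := pb.dim_pos
  have hr' : (1 : ℝ) ≤ r := by exact_mod_cast hr
  have hE' : (1 : ℝ) ≤ E := by exact_mod_cast hE
  set bad := Finset.univ.biUnion fun σ : K →ₐ[ℚ] ℂ =>
    (intBox pb.dim 0 X).filter fun c => ‖σ (intComb θ pb.dim c)‖ < r with hbad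
  set good := intBox pb.dim 0 X \ bad with hgood
  have hbadc : bad.card ≤ pb.dim * (3 * r * X ^ (pb.dim - 1)) := by
    refine Finset.card_biUnion_le.trans ((Finset.sum_le_sum fun σ _ =>
      card_small_embedding_le hθ σ hr).trans ?_)
    rw [Finset.sum_const, Finset.card_univ, card_embeddings pb, smul_eq_mul]
  have hbadE : (bad.card : ℝ) ≤ 1 / E * (X : ℝ) ^ pb.dim := by
    have h1 : bad.card * E ≤ X ^ pb.dim := by
      calc bad.card * E ≤ pb.dim * (3 * r * X ^ (pb.dim - 1)) * E := Nat.mul_le_mul_right _ hbadc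
        _ = X ^ (pb.dim - 1) * (3 * pb.dim * E * r) := by ring
        _ = X ^ pb.dim := by rw [← hX, ← pow_succ]; congr 1; omega
    rw [one_div_mul_eq_div, le_div_iff₀ (by linarith)]
    exact_mod_cast h1
  have hgoodc : (1 - 1 / (E : ℝ)) * (X : ℝ) ^ pb.dim ≤ good.card := by
    have h1 : (intBox pb.dim 0 X).card ≤ good.card + bad.card := by
      have := Finset.le_card_sdiff bad (intBox pb.dim 0 X)
      rw [hgood]; omega
    rw [card_intBox, sub_zero, Int.toNat_natCast] at h1
    have h2 : (X : ℝ) ^ pb.dim ≤ good.card + bad.card := by exact_mod_cast h1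
    linarith
  have hsub : good ⊆ (intBox pb.dim 0 X).erase 0 := by
    intro c hc
    rw [hgood, Finset.mem_sdiff] at hc
    refine Finset.mem_erase.2 ⟨?_, hc.1⟩
    rintro rfl
    apply hc.2
    rw [hbad, Finset.mem_biUnion]
    have : Nonempty (K →ₐ[ℚ] ℂ) := by
      rw [← Fintype.card_pos_iff, card_embeddings pb]; exact hd
    refine ⟨this.some, Finset.mem_univ _, Finset.mem_filter.2 ⟨hc.1, ?_⟩⟩
    simp
    omega
  have hlog : ∀ c ∈ good, pb.dim * Real.log r ≤
      Real.log (Ideal.absNorm (Ideal.span {intComb θ pb.dim c})) := by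
    intro c hc
    rw [hgood, Finset.mem_sdiff] at hc
    rw [← Real.log_pow]
    refine Real.log_le_log (by positivity) ?_
    rw [absNorm_span_eq_prod, ← prod_const_embeddings pb]
    refine Finset.prod_le_prod (fun _ _ => by positivity) fun σ _ => ?_
    by_contra h
    exact hc.2 (Finset.mem_biUnion.2 ⟨σ, Finset.mem_univ _,
      Finset.mem_filter.2 ⟨hc.1, not_le.1 h⟩⟩)
  calc _ ≤ (good.card : ℝ) * (pb.dim * Real.log r) :=
        mul_le_mul_of_nonneg_right hgoodc (by have := Real.log_nonneg hr'; positivity)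
    _ = ∑ c ∈ good, pb.dim * Real.log r := by rw [Finset.sum_const, nsmul_eq_mul]
    _ ≤ ∑ c ∈ good, Real.log (Ideal.absNorm (Ideal.span {intComb θ pb.dim c})) :=
        Finset.sum_le_sum hlog
    _ ≤ _ := Finset.sum_le_sum_of_subset_of_nonneg hsub fun c hc _ => by
        have := absNorm_intComb_pos hθ (Finset.ne_of_mem_erase hc)
        exact Real.log_nonneg (by exact_mod_cast this)

/-- Upper bound for the average size of a norm. -/
lemma sum_log_absNorm_le (hθ : (θ : K) = pb.gen) {C : ℕ}
    (hC : ∀ (a : ℕ) (c : Fin pb.dim → ℤ), (∀ i, |c i| ≤ a) →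
      Ideal.absNorm (Ideal.span {intComb θ pb.dim c}) ≤ (C * a) ^ pb.dim)
    {X : ℕ} (hX : 1 ≤ C * X) :
    ∑ c ∈ (intBox pb.dim 0 X).erase 0,
        Real.log (Ideal.absNorm (Ideal.span {intComb θ pb.dim c})) ≤
      (X : ℝ) ^ pb.dim * (pb.dim * Real.log (C * X : ℕ)) := by
  have h1 : ∀ c ∈ (intBox pb.dim 0 X).erase 0,
      Real.log (Ideal.absNorm (Ideal.span {intComb θ pb.dim c})) ≤
        pb.dim * Real.log (C * X : ℕ) := by
    intro c hc
    rw [← Real.log_pow]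
    refine Real.log_le_log ?_ ?_
    · exact_mod_cast absNorm_intComb_pos hθ (Finset.ne_of_mem_erase hc)
    · refine le_trans (Nat.cast_le.2 (hC X c fun i => ?_)) (by push_cast; rfl)
      have := mem_intBox.1 (Finset.mem_of_mem_erase hc) i
      rw [abs_le]; omega
  refine (Finset.sum_le_sum h1).trans ?_
  rw [Finset.sum_const, nsmul_eq_mul]
  refine mul_le_mul_of_nonneg_right ?_ ?_
  · have h2 := Finset.card_erase_le (s := intBox pb.dim 0 X) (a := 0)
    rw [card_intBox, sub_zero, Int.toNat_natCast] at h2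
    exact_mod_cast h2
  · have : 0 ≤ Real.log (C * X : ℕ) := Real.log_nonneg (by exact_mod_cast hX)
    positivity

end Norms

/-- The roots of an integer polynomial modulo `q`, as natural numbers less than `q`. -/
noncomputable def rootsMod (F : ℤ[X]) (q : ℕ) : Finset ℕ :=
  (Finset.range q).filter fun t => (q : ℤ) ∣ F.eval (t : ℤ)

lemma mem_rootsMod {F : ℤ[X]} {q t : ℕ} :
    t ∈ rootsMod F q ↔ t < q ∧ (q : ℤ) ∣ F.eval (t : ℤ) := by
  simp [rootsMod]

lemma aeval_natCast_zmod (P : ℤ[X]) (q t : ℕ) :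
    aeval (t : ZMod q) P = ((P.eval (t : ℤ) : ℤ) : ZMod q) := by
  have h : (t : ZMod q) = algebraMap ℤ (ZMod q) (t : ℤ) := by simp
  rw [h, aeval_algebraMap_apply]
  simp

lemma aeval_natCast_zmod_eq_zero_iff {P : ℤ[X]} {q t : ℕ} :
    aeval (t : ZMod q) P = 0 ↔ (q : ℤ) ∣ P.eval (t : ℤ) := by
  rw [aeval_natCast_zmod, ZMod.intCast_zmod_eq_zero_iff_dvd]

lemma card_rootsMod_le {F : ℤ[X]} (hF : F.Monic) {q : ℕ} (hq : q.Prime) :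
    (rootsMod F q).card ≤ F.natDegree := by
  have : Fact q.Prime := ⟨hq⟩
  have h1 : (rootsMod F q).card ≤ (F.map (Int.castRingHom (ZMod q))).roots.toFinset.card := by
    refine Finset.card_le_card_of_injOn (fun t => (t : ZMod q)) (fun t ht => ?_) ?_
    · rw [Finset.mem_coe, mem_rootsMod] at ht
      rw [Finset.mem_coe, Multiset.mem_toFinset, mem_roots (hF.map _).ne_zero, IsRoot.def,
        eval_map, ← algebraMap_int_eq, ← aeval_def]
      exact aeval_natCast_zmod_eq_zero_iff.2 ht.2
    · intro t ht t' ht' h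
      rw [Finset.mem_coe, mem_rootsMod] at ht ht'
      have := (ZMod.natCast_eq_natCast_iff' t t' q).1 h
      rwa [Nat.mod_eq_of_lt ht.1, Nat.mod_eq_of_lt ht'.1] at this
  calc (rootsMod F q).card ≤ _ := h1
    _ ≤ (F.map (Int.castRingHom (ZMod q))).roots.card := Multiset.toFinset_card_le _
    _ ≤ (F.map (Int.castRingHom (ZMod q))).natDegree := card_roots' _
    _ = F.natDegree := hF.natDegree_map _

section UpperBound

open NumberField

variable {K : Type*} [Field K] [NumberField K] {pb : PowerBasis ℚ K} {θ : 𝓞 K}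

/-- A root of the minimal polynomial modulo `q` yields a prime ideal lying above it. -/
lemma exists_prime_above_root (θ : 𝓞 K) {q t : ℕ} (hq : q.Prime) (ht : t ∈ rootsMod (minpoly ℤ θ) q) :
    ∃ Q : Ideal (𝓞 K), Q.IsMaximal ∧
      ∀ P : ℤ[X], aeval θ P ∈ Q ↔ (q : ℤ) ∣ P.eval (t : ℤ) := by
  have : Fact q.Prime := ⟨hq⟩
  let _ : Algebra ℤ[X] (𝓞 K) := (aeval (R := ℤ) θ).toRingHom.toAlgebra
  have hmap : ∀ P : ℤ[X], algebraMap ℤ[X] (𝓞 K) P = aeval θ P := fun _ => rfl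
  have hint : Algebra.IsIntegral ℤ[X] (𝓞 K) := by
    refine ⟨fun x => ?_⟩
    obtain ⟨P, hP, hPx⟩ := RingOfIntegers.isIntegral x
    refine ⟨P.map C, hP.map _, ?_⟩
    rw [eval₂_map, RingHom.ext_int ((algebraMap ℤ[X] (𝓞 K)).comp C) (algebraMap ℤ (𝓞 K))]
    exact hPx
  let ev : ℤ[X] →+* ZMod q := (aeval (R := ℤ) (t : ZMod q)).toRingHom
  have hev : ∀ P, ev P = aeval (t : ZMod q) P := fun _ => rfl
  have hsurj : Function.Surjective ev := by
    intro a
    obtain ⟨k, rfl⟩ := ZMod.intCast_surjective a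
    exact ⟨C k, by simp [hev]⟩
  have hmax : (RingHom.ker ev).IsMaximal := RingHom.ker_isMaximal_of_surjective ev hsurj
  have hker : RingHom.ker (algebraMap ℤ[X] (𝓞 K)) ≤ RingHom.ker ev := by
    intro P hP
    rw [RingHom.mem_ker, hmap] at hP
    obtain ⟨G, rfl⟩ := minpoly.isIntegrallyClosed_dvd (RingOfIntegers.isIntegral θ) hP
    rw [RingHom.mem_ker, map_mul, hev, aeval_natCast_zmod_eq_zero_iff.2 (mem_rootsMod.1 ht).2,
      zero_mul]
  obtain ⟨Q, hQ, hcomap⟩ := Ideal.exists_ideal_over_maximal_of_isIntegral (RingHom.ker ev) hker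
  refine ⟨Q, hQ, fun P => ?_⟩
  rw [← hmap, ← Ideal.mem_comap, hcomap, RingHom.mem_ker, hev, aeval_natCast_zmod_eq_zero_iff]

lemma le_absNorm_of_natCast_mem {Q : Ideal (𝓞 K)} (hQ : Q.IsMaximal) {q : ℕ} (hq : q.Prime)
    (hqQ : (q : 𝓞 K) ∈ Q) : q ∣ Ideal.absNorm Q := by
  by_contra h
  have hco : IsCoprime (q : ℤ) (Ideal.absNorm Q : ℤ) :=
    Nat.isCoprime_iff_coprime.2 ((Nat.Prime.coprime_iff_not_dvd hq).2 h)
  obtain ⟨a, b, hab⟩ := hco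
  apply hQ.ne_top
  rw [Ideal.eq_top_iff_one]
  have h1 : ((a * q + b * Ideal.absNorm Q : ℤ) : 𝓞 K) = 1 := by rw [hab]; simp
  rw [← h1]
  push_cast
  exact Q.add_mem (Q.mul_mem_left _ hqQ) (Q.mul_mem_left _ (Ideal.absNorm_mem Q))

/-- The degree one primes dividing an element are controlled by its norm. -/
lemma sum_log_roots_le_log_absNorm (hθ : (θ : K) = pb.gen) {c : Fin pb.dim → ℤ} (hc : c ≠ 0)
    (s : Finset ℕ) (hs : ∀ q ∈ s, q.Prime) :
    ∑ q ∈ s, ∑ t ∈ rootsMod (minpoly ℤ θ) q,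
      (if intComb (t : ZMod q) pb.dim c = 0 then Real.log q else 0) ≤
      Real.log (Ideal.absNorm (Ideal.span {intComb θ pb.dim c})) := by
  classical
  set T := (s.sigma fun q => rootsMod (minpoly ℤ θ) q).filter fun x =>
    intComb ((x.2 : ℕ) : ZMod x.1) pb.dim c = 0 with hT
  have hsum : ∑ q ∈ s, ∑ t ∈ rootsMod (minpoly ℤ θ) q,
      (if intComb (t : ZMod q) pb.dim c = 0 then Real.log q else 0) = ∑ x ∈ T, Real.log x.1 := by
    rw [hT, Finset.sum_filter, Finset.sum_sigma]
  rw [hsum]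
  have hTmem : ∀ x ∈ T, x.1.Prime ∧ x.2 ∈ rootsMod (minpoly ℤ θ) x.1 ∧
      intComb ((x.2 : ℕ) : ZMod x.1) pb.dim c = 0 := by
    intro x hx
    rw [hT, Finset.mem_filter, Finset.mem_sigma] at hx
    exact ⟨hs _ hx.1.1, hx.1.2, hx.2⟩
  choose! Q hQmax hQ using fun x (hx : x ∈ T) => exists_prime_above_root θ (hTmem x hx).1 (hTmem x hx).2.1
  have hQq : ∀ x ∈ T, ((x.1 : ℕ) : 𝓞 K) ∈ Q x := by
    intro x hx
    have := (hQ x hx (C (x.1 : ℤ))).2 (by simp)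
    simpa using this
  have hinj : Set.InjOn Q T := by
    rintro ⟨q, t⟩ hx ⟨q', t'⟩ hx' h
    have h1 := (hQ _ hx (C (q' : ℤ))).1 (by rw [h]; simpa using hQq _ hx')
    simp only [eval_C] at h1
    have h2 : q = q' := (Nat.prime_dvd_prime_iff_eq (hTmem _ hx).1 (hTmem _ hx').1).1
      (by exact_mod_cast h1)
    subst h2
    have h3 := (hQ _ hx (X - C (t' : ℤ))).1 (by
      rw [h]
      exact (hQ _ hx' (X - C (t' : ℤ))).2 (by simp))
    simp only [eval_sub, eval_X, eval_C] at h3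
    have h4 : t' = t := by
      have := (Nat.modEq_iff_dvd.2 h3 : t' ≡ t [MOD q])
      rw [Nat.ModEq, Nat.mod_eq_of_lt (mem_rootsMod.1 (hTmem _ hx').2.1).1,
        Nat.mod_eq_of_lt (mem_rootsMod.1 (hTmem _ hx).2.1).1] at this
      exact this
    rw [h4]
  have hbot : ∀ x ∈ T, Q x ≠ ⊥ := by
    intro x hx h
    have := hQq x hx
    rw [h, Ideal.mem_bot] at this
    exact (hTmem x hx).1.ne_zero (by exact_mod_cast this)
  have hdvd : ∏ I ∈ T.image Q, I ∣ Ideal.span {intComb θ pb.dim c} := by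
    refine Finset.prod_primes_dvd _ (fun I hI => ?_) (fun I hI => ?_)
    · obtain ⟨x, hx, rfl⟩ := Finset.mem_image.1 hI
      exact Ideal.prime_of_isPrime (hbot x hx) (hQmax x hx).isPrime
    · obtain ⟨x, hx, rfl⟩ := Finset.mem_image.1 hI
      rw [Ideal.dvd_span_singleton, ← aeval_intComb_X]
      rw [hQ x hx, ← aeval_natCast_zmod_eq_zero_iff, aeval_intComb_X]
      exact (hTmem x hx).2.2
  rw [Finset.prod_image hinj] at hdvd
  have h5 := Ideal.absNorm_dvd_absNorm_of_le (Ideal.le_of_dvd hdvd)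
  rw [map_prod] at h5
  have h6 := Nat.le_of_dvd (absNorm_intComb_pos hθ hc) h5
  have hpos : ∀ x ∈ T, 0 < Ideal.absNorm (Q x) := by
    intro x hx
    rw [Nat.pos_iff_ne_zero, Ne, Ideal.absNorm_eq_zero_iff]
    exact hbot x hx
  calc ∑ x ∈ T, Real.log x.1 ≤ ∑ x ∈ T, Real.log (Ideal.absNorm (Q x)) := by
        refine Finset.sum_le_sum fun x hx => Real.log_le_log ?_ ?_
        · exact_mod_cast (hTmem x hx).1.pos
        · exact_mod_cast Nat.le_of_dvd (hpos x hx)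
            (le_absNorm_of_natCast_mem (hQmax x hx) (hTmem x hx).1 (hQq x hx))
    _ = Real.log (∏ x ∈ T, (Ideal.absNorm (Q x) : ℝ)) := by
        rw [Real.log_prod]
        intro x hx
        exact_mod_cast (hpos x hx).ne'
    _ ≤ _ := by
        refine Real.log_le_log ?_ ?_
        · exact Finset.prod_pos fun x hx => by exact_mod_cast hpos x hx
        · exact_mod_cast h6

/-- Upper bound for the weighted number of roots modulo primes. -/
lemma sum_card_rootsMod_le (hθ : (θ : K) = pb.gen) {C E Z : ℕ} (hC1 : 1 ≤ C) (hE : 1 ≤ E)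
    (hZ : 1 ≤ Z)
    (hC : ∀ (x y : K) (a b : ℚ), (∀ i, |pb.basis.repr x i| ≤ a) →
      (∀ i, |pb.basis.repr y i| ≤ b) → ∀ i, |pb.basis.repr (x * y) i| ≤ C * a * b)
    (hN : ∀ (a : ℕ) (c : Fin pb.dim → ℤ), (∀ i, |c i| ≤ a) →
      Ideal.absNorm (Ideal.span {intComb θ pb.dim c}) ≤ (C * a) ^ pb.dim) :
    (1 - 1 / (E : ℝ)) * ∑ q ∈ Nat.primesLE (Z ^ pb.dim),
        ((rootsMod (minpoly ℤ θ) q).card : ℝ) * (Real.log q / q) ≤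
      pb.dim * Real.log Z + pb.dim * (Real.log (2 * pb.dim * E * C ^ 2 : ℕ) + 2) := by
  classical
  have hd := pb.dim_pos
  set d := pb.dim with hd'
  set S := C * Z with hS
  set X := 2 * d * E * S with hX
  set F := minpoly ℤ θ with hF
  set s := Nat.primesLE (Z ^ d) with hs
  set B := (intBox d 0 X).erase 0 with hB
  have hSpos : 1 ≤ S := Nat.mul_pos hC1 hZ
  have hXpos : 1 ≤ X := Nat.mul_pos (Nat.mul_pos (by omega) hE) hSpos
  have hZX : Z ≤ X := by
    calc Z = 1 * (1 * Z) := by ring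
      _ ≤ (2 * d * E) * (C * Z) := Nat.mul_le_mul (Nat.mul_pos (by omega) hE)
          (Nat.mul_le_mul_right _ hC1)
  have hX' : (0 : ℝ) < X := by exact_mod_cast hXpos
  have hE' : (1 : ℝ) ≤ E := by exact_mod_cast hE
  have hmemS : ∀ q ∈ s, q ≤ Z ^ d ∧ q.Prime := fun q hq => Nat.mem_primesLE.1 hq
  have hcount : ∀ q ∈ s, ∀ t ∈ rootsMod F q,
      (1 - 1 / (E : ℝ)) * (X : ℝ) ^ d / q - 1 ≤
        ((B.filter fun c => intComb (t : ZMod q) d c = 0).card : ℝ) := by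
    intro q hq t ht
    have hqp := (hmemS q hq).2
    have : NeZero q := ⟨hqp.ne_zero⟩
    have h1 := le_card_mul_card_fiber (intComb (t : ZMod q) d) S X
      (exists_small_representative hθ hC (hmemS q hq).1
        (aeval_natCast_zmod_eq_zero_iff.2 (mem_rootsMod.1 ht).2))
    rw [ZMod.card] at h1
    have h2 : ((intBox d 0 X).filter fun c => intComb (t : ZMod q) d c = 0).card ≤
        (B.filter fun c => intComb (t : ZMod q) d c = 0).card + 1 := by
      rw [hB, Finset.filter_erase]
      exact Nat.le_add_of_sub_le Finset.pred_card_le_card_erase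
    have h3 : (1 - 1 / (E : ℝ)) * (X : ℝ) ^ d ≤ ((X - 2 * S : ℕ) : ℝ) ^ d := by
      have h2S : 2 * S ≤ X := by
        calc 2 * S = 2 * 1 * 1 * S := by ring
          _ ≤ 2 * d * E * S := Nat.mul_le_mul_right _ (Nat.mul_le_mul (by omega) hE)
      have h4 : ((X - 2 * S : ℕ) : ℝ) = X * (1 + -(1 / (d * E : ℝ))) := by
        rw [Nat.cast_sub h2S, hX]
        push_cast
        field_simp
        ring
      rw [h4, mul_pow, mul_comm]
      refine mul_le_mul_of_nonneg_left ?_ (by positivity)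
      have h5 : (-2 : ℝ) ≤ -(1 / (d * E : ℝ)) := by
        have : 1 / (d * E : ℝ) ≤ 1 := by
          rw [div_le_one (by positivity)]
          exact_mod_cast Nat.mul_pos hd hE
        linarith
      have h6 := one_add_mul_le_pow h5 d
      refine le_trans (le_of_eq ?_) h6
      field_simp
      ring
    have hq' : (0 : ℝ) < q := by exact_mod_cast hqp.pos
    rw [sub_le_iff_le_add, div_le_iff₀ hq']
    calc (1 - 1 / (E : ℝ)) * (X : ℝ) ^ d ≤ ((X - 2 * S : ℕ) : ℝ) ^ d := h3
      _ ≤ (q * ((intBox d 0 X).filter fun c => intComb (t : ZMod q) d c = 0).card : ℕ) := by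
          exact_mod_cast h1
      _ ≤ (q * ((B.filter fun c => intComb (t : ZMod q) d c = 0).card + 1) : ℕ) := by
          exact_mod_cast Nat.mul_le_mul_left _ h2
      _ = _ := by push_cast; ring
  have hroots : ∀ q ∈ s, ((rootsMod F q).card : ℝ) ≤ d := by
    intro q hq
    have := card_rootsMod_le (minpoly.monic (RingOfIntegers.isIntegral θ)) (hmemS q hq).2
    rw [natDegree_minpoly_eq_dim hθ] at this
    exact_mod_cast this
  have hlog : ∀ q ∈ s, 0 ≤ Real.log q := fun q _ => Real.log_natCast_nonneg q
  -- double counting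
  have hdouble : ∑ q ∈ s, ∑ t ∈ rootsMod F q, Real.log q *
      ((B.filter fun c => intComb (t : ZMod q) d c = 0).card : ℝ) ≤
      (X : ℝ) ^ d * (d * Real.log (C * X : ℕ)) := by
    refine le_trans (le_of_eq ?_) ((Finset.sum_le_sum fun c hc =>
      sum_log_roots_le_log_absNorm hθ (Finset.ne_of_mem_erase hc) s
        fun q hq => (hmemS q hq).2).trans (sum_log_absNorm_le hθ hN (Nat.mul_pos hC1 hXpos)))
    rw [Finset.sum_comm]
    refine Finset.sum_congr rfl fun q _ => ?_
    rw [Finset.sum_comm]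
    refine Finset.sum_congr rfl fun t _ => ?_
    rw [← Finset.sum_filter, Finset.sum_const, nsmul_eq_mul, mul_comm]
  have hmain : (1 - 1 / (E : ℝ)) * (X : ℝ) ^ d *
      ∑ q ∈ s, ((rootsMod F q).card : ℝ) * (Real.log q / q) - d * (Real.log 4 * (Z ^ d : ℕ)) ≤
      (X : ℝ) ^ d * (d * Real.log (C * X : ℕ)) := by
    refine le_trans ?_ hdouble
    calc _ ≤ (1 - 1 / (E : ℝ)) * (X : ℝ) ^ d *
          ∑ q ∈ s, ((rootsMod F q).card : ℝ) * (Real.log q / q) - d * ∑ q ∈ s, Real.log q := by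
          gcongr
          exact sum_log_primesLE_le _
      _ ≤ ∑ q ∈ s, ∑ t ∈ rootsMod F q, Real.log q *
          ((1 - 1 / (E : ℝ)) * (X : ℝ) ^ d / q - 1) := by
          rw [Finset.mul_sum, Finset.mul_sum, ← Finset.sum_sub_distrib]
          refine Finset.sum_le_sum fun q hq => ?_
          rw [Finset.sum_const, nsmul_eq_mul]
          have := mul_le_mul_of_nonneg_right (hroots q hq) (hlog q hq)
          calc _ ≤ (1 - 1 / (E : ℝ)) * (X : ℝ) ^ d * (((rootsMod F q).card : ℝ) * (Real.log q / q))
                - ((rootsMod F q).card : ℝ) * Real.log q := by linarith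
            _ = _ := by ring
      _ ≤ _ := by
          refine Finset.sum_le_sum fun q hq => Finset.sum_le_sum fun t ht => ?_
          exact mul_le_mul_of_nonneg_left (hcount q hq t ht) (hlog q hq)
  have hXd : (0 : ℝ) < (X : ℝ) ^ d := by positivity
  have hZd : ((Z ^ d : ℕ) : ℝ) ≤ (X : ℝ) ^ d := by exact_mod_cast Nat.pow_le_pow_left hZX d
  have hlog4 : Real.log 4 ≤ 2 := by
    have : Real.log 4 = 2 * Real.log 2 := by
      rw [show (4 : ℝ) = 2 ^ 2 by norm_num, Real.log_pow]; norm_num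
    have := Real.log_two_lt_d9
    linarith
  have hlogCX : Real.log (C * X : ℕ) = Real.log Z + Real.log (2 * d * E * C ^ 2 : ℕ) := by
    rw [show C * X = Z * (2 * d * E * C ^ 2) by rw [hX, hS]; ring, Nat.cast_mul, Real.log_mul]
    · exact_mod_cast (by omega : Z ≠ 0)
    · have : 0 < 2 * d * E * C ^ 2 := by positivity
      exact_mod_cast this.ne'
  have h7 : (d : ℝ) * (Real.log 4 * (Z ^ d : ℕ)) ≤ d * (2 * (X : ℝ) ^ d) := by
    gcongr
  have h8 : (X : ℝ) ^ d * ((1 - 1 / (E : ℝ)) *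
      ∑ q ∈ s, ((rootsMod F q).card : ℝ) * (Real.log q / q)) ≤
      (X : ℝ) ^ d * (d * Real.log Z + d * (Real.log (2 * d * E * C ^ 2 : ℕ) + 2)) := by
    rw [hlogCX] at hmain
    linarith
  exact le_of_mul_le_mul_left h8 hXd

end UpperBound

lemma aeval_map_minpoly_eq_zero {A R : Type*} [CommRing A] [CommRing R]
    (Ψ : A →+* R) (x : A) :
    aeval (Ψ x) (minpoly ℤ x) = 0 := by
  have h := congrArg Ψ (minpoly.aeval ℤ x)
  rw [map_zero, aeval_def, hom_eval₂] at h
  rw [aeval_def, ← h]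
  congr 1
  exact RingHom.ext_int _ _

section LowerBound

open NumberField UniqueFactorizationMonoid

variable {K : Type*} [Field K] [NumberField K] {pb : PowerBasis ℚ K} {θ : 𝓞 K}

lemma sum_pow_Icc_two_le {x : ℝ} (hx0 : 0 ≤ x) (hx : x ≤ 1 / 2) (L : ℕ) :
    ∑ j ∈ Finset.Icc 2 (L + 1), x ^ j ≤ 2 * x ^ 2 := by
  have h : ∑ j ∈ Finset.Icc 2 (L + 1), x ^ j ≤ 2 * x ^ 2 * (1 - (1 / 2) ^ L) := by
    induction L with
    | zero => simp
    | succ L ih =>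
      rw [Finset.sum_Icc_succ_top (by omega)]
      have h1 : x ^ (L + 1 + 1) ≤ x ^ 2 * (1 / 2) ^ L := by
        rw [show L + 1 + 1 = 2 + L by ring, pow_add]
        gcongr
      have h2 : (1 / 2 : ℝ) ^ (L + 1) = (1 / 2) ^ L / 2 := by rw [pow_succ]; ring
      rw [h2]
      nlinarith
  refine h.trans ?_
  have : (0 : ℝ) ≤ (1 / 2) ^ L := by positivity
  nlinarith [sq_nonneg x]

open Classical in
lemma log_absNorm_eq_sum {I : Ideal (𝓞 K)} (hI : I ≠ ⊥) :
    Real.log (Ideal.absNorm I) = ∑ Q ∈ (normalizedFactors I).toFinset,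
      ((normalizedFactors I).count Q : ℝ) * Real.log (Ideal.absNorm Q) := by
  conv_lhs => rw [← Ideal.prod_normalizedFactors_eq_self hI, map_multiset_prod,
    Finset.prod_multiset_map_count]
  push_cast
  rw [Real.log_prod]
  · exact Finset.sum_congr rfl fun Q _ => Real.log_pow _ _
  · intro Q hQ
    have h1 : Q ≠ 0 := (prime_of_normalized_factor Q (Multiset.mem_toFinset.1 hQ)).ne_zero
    have h2 : Ideal.absNorm Q ≠ 0 := by rwa [Ne, Ideal.absNorm_eq_zero_iff]
    exact pow_ne_zero _ (by exact_mod_cast h2)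

open Classical in
lemma log_absNorm_le_sum {I : Ideal (𝓞 K)} (hI : I ≠ ⊥) {𝒬 : Finset (Ideal (𝓞 K))}
    (h𝒬 : (normalizedFactors I).toFinset ⊆ 𝒬) {L : ℕ}
    (hL : ∀ Q, (normalizedFactors I).count Q ≤ L) :
    Real.log (Ideal.absNorm I) ≤ ∑ Q ∈ 𝒬, ∑ j ∈ Finset.Icc 1 L,
      if I ≤ Q ^ j then Real.log (Ideal.absNorm Q) else 0 := by
  rw [log_absNorm_eq_sum hI]
  have hnn : ∀ Q : Ideal (𝓞 K), 0 ≤ Real.log (Ideal.absNorm Q) := fun Q =>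
    Real.log_natCast_nonneg _
  refine le_trans (Finset.sum_le_sum fun Q hQ => ?_)
    (Finset.sum_le_sum_of_subset_of_nonneg h𝒬 fun Q _ _ => Finset.sum_nonneg fun j _ => by
      split_ifs
      · exact hnn Q
      · exact le_rfl)
  rw [← Finset.sum_filter, Finset.sum_const, nsmul_eq_mul]
  refine mul_le_mul_of_nonneg_right ?_ (hnn Q)
  have hQ' := Multiset.mem_toFinset.1 hQ
  have hsub : Finset.Icc 1 ((normalizedFactors I).count Q) ⊆
      (Finset.Icc 1 L).filter fun j => I ≤ Q ^ j := by
    intro j hj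
    rw [Finset.mem_Icc] at hj
    rw [Finset.mem_filter, Finset.mem_Icc]
    refine ⟨⟨hj.1, hj.2.trans (hL Q)⟩, Ideal.le_of_dvd ?_⟩
    rw [pow_dvd_iff_le_emultiplicity, emultiplicity_eq_count_normalizedFactors
      (irreducible_of_normalized_factor Q hQ') hI, normalize_eq]
    exact_mod_cast hj.2
  have := Finset.card_le_card hsub
  rw [Nat.card_Icc, Nat.add_sub_cancel] at this
  exact_mod_cast this

/-- A nonzero prime ideal contains a rational prime, of which its norm is a power. -/
lemma exists_absNorm_eq_pow {Q : Ideal (𝓞 K)} (hQ : Q.IsPrime) (hQ0 : Q ≠ ⊥) :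
    ∃ q f : ℕ, q.Prime ∧ 1 ≤ f ∧ f ≤ Module.finrank ℚ K ∧ Ideal.absNorm Q = q ^ f ∧
      (q : 𝓞 K) ∈ Q := by
  have hfin : Finite (𝓞 K ⧸ Q) := Ideal.finiteQuotientOfFreeOfNeBot Q hQ0
  have hq : (ringChar (𝓞 K ⧸ Q)).Prime := CharP.char_is_prime (𝓞 K ⧸ Q) _
  set q := ringChar (𝓞 K ⧸ Q) with hqdef
  have hqQ : (q : 𝓞 K) ∈ Q := by
    rw [← Ideal.Quotient.eq_zero_iff_mem, map_natCast]
    exact ringChar.Nat.cast_ringChar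
  have h1 : Ideal.absNorm Q ∣ q ^ Module.finrank ℚ K := by
    rw [← RingOfIntegers.rank K, ← Ideal.absNorm_span_natCast (S := 𝓞 K)]
    exact Ideal.absNorm_dvd_absNorm_of_le ((Ideal.span_singleton_le_iff_mem Q).2 hqQ)
  obtain ⟨f, hf, hf'⟩ := (Nat.dvd_prime_pow hq).1 h1
  refine ⟨q, f, hq, ?_, hf, hf', hqQ⟩
  rw [Nat.one_le_iff_ne_zero]
  rintro rfl
  exact hQ.ne_top (Ideal.absNorm_eq_one_iff.1 (by simpa using hf'))

lemma card_primes_above_le {q : ℕ} (hq : q.Prime) (T : Finset (Ideal (𝓞 K)))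
    (hT : ∀ Q ∈ T, Q.IsPrime ∧ Q ≠ ⊥ ∧ (q : 𝓞 K) ∈ Q) : T.card ≤ Module.finrank ℚ K := by
  have h1 : ∏ Q ∈ T, Q ∣ Ideal.span {(q : 𝓞 K)} :=
    Finset.prod_primes_dvd _ (fun Q hQ => Ideal.prime_of_isPrime (hT Q hQ).2.1 (hT Q hQ).1)
      fun Q hQ => Ideal.dvd_span_singleton.2 (hT Q hQ).2.2
  have h2 := Ideal.absNorm_dvd_absNorm_of_le (Ideal.le_of_dvd h1)
  rw [Ideal.absNorm_span_natCast, RingOfIntegers.rank, map_prod] at h2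
  have h3 : q ^ T.card ∣ ∏ Q ∈ T, Ideal.absNorm Q := by
    rw [← Finset.prod_const]
    refine Finset.prod_dvd_prod_of_dvd _ _ fun Q hQ => ?_
    exact le_absNorm_of_natCast_mem ((hT Q hQ).1.isMaximal (hT Q hQ).2.1) hq (hT Q hQ).2.2
  exact Nat.pow_dvd_pow_iff_le_right hq.one_lt |>.1 (h3.trans h2)

lemma exists_ringHom_of_absNorm_prime {Q : Ideal (𝓞 K)} {q : ℕ} (hq : q.Prime)
    (h : Ideal.absNorm Q = q) : ∃ Ψ : 𝓞 K →+* ZMod q, RingHom.ker Ψ = Q := by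
  have hQ0 : Q ≠ ⊥ := by
    rintro rfl
    rw [Ideal.absNorm_bot] at h
    exact hq.ne_zero h.symm
  have hfin : Finite (𝓞 K ⧸ Q) := Ideal.finiteQuotientOfFreeOfNeBot Q hQ0
  let _ : Fintype (𝓞 K ⧸ Q) := Fintype.ofFinite _
  have hcard : Fintype.card (𝓞 K ⧸ Q) = q := by
    rw [← Nat.card_eq_fintype_card, ← h, Ideal.absNorm_apply, Submodule.cardQuot_apply]
  refine ⟨(ZMod.ringEquivOfPrime (𝓞 K ⧸ Q) hq hcard).symm.toRingHom.comp (Ideal.Quotient.mk Q), ?_⟩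
  ext x
  simp [RingHom.mem_ker, Ideal.Quotient.eq_zero_iff_mem]

open Classical in
/-- Sharp count of the points of a degree one prime in a cube. -/
lemma card_degree_one_le (hθ : (θ : K) = pb.gen) {C Z q : ℕ} (X : ℕ)
    (hC : ∀ (x y : K) (a b : ℚ), (∀ i, |pb.basis.repr x i| ≤ a) →
      (∀ i, |pb.basis.repr y i| ≤ b) → ∀ i, |pb.basis.repr (x * y) i| ≤ C * a * b)
    (hq : q.Prime) (hqZ : q ≤ Z ^ pb.dim) {Q : Ideal (𝓞 K)} (hQ : Ideal.absNorm Q = q) :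
    q * (((intBox pb.dim 0 X).erase 0).filter fun c => intComb θ pb.dim c ∈ Q).card ≤
      (X + 2 * (C * Z)) ^ pb.dim := by
  obtain ⟨Ψ, hΨ⟩ := exists_ringHom_of_absNorm_prime hq hQ
  have : NeZero q := ⟨hq.ne_zero⟩
  have h1 := card_mul_card_fiber_le (intComb (Ψ θ) pb.dim) (C * Z) X
    (exists_small_representative hθ hC hqZ (aeval_map_minpoly_eq_zero Ψ θ))
  rw [ZMod.card] at h1
  refine le_trans (Nat.mul_le_mul_left _ (Finset.card_le_card ?_)) h1
  intro c hc
  rw [Finset.mem_filter, Finset.mem_erase, ← hΨ, RingHom.mem_ker, map_intComb] at hc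
  simpa only [Finset.mem_filter] using And.intro hc.1.2 hc.2

end LowerBound

lemma sum_ite_mem_le_of_card_fiber_le {ι : Type*} (T : Finset ι) (φ : ι → ℕ) (s : Finset ℕ)
    (g D : ℕ → ℝ) (hg : ∀ q ∈ s, 0 ≤ g q)
    (hD : ∀ q ∈ s, ((T.filter fun i => φ i = q).card : ℝ) ≤ D q) :
    ∑ i ∈ T, (if φ i ∈ s then g (φ i) else 0) ≤ ∑ q ∈ s, D q * g q := by
  rw [← Finset.sum_filter, ← Finset.sum_fiberwise_of_maps_to' (t := s) (g := φ)
    (fun i hi => (Finset.mem_filter.1 hi).2)]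
  refine Finset.sum_le_sum fun q hq => ?_
  rw [Finset.sum_const, nsmul_eq_mul]
  refine mul_le_mul_of_nonneg_right (le_trans ?_ (hD q hq)) (hg q hq)
  exact_mod_cast Finset.card_le_card (Finset.filter_subset_filter _ (Finset.filter_subset _ _))

lemma log_four_le_two : Real.log 4 ≤ 2 := by
  have : Real.log 4 = 2 * Real.log 2 := by
    rw [show (4 : ℝ) = 2 ^ 2 by norm_num, Real.log_pow]; norm_num
  have := Real.log_two_lt_d9
  linarith

section LowerBound

open NumberField UniqueFactorizationMonoid

variable {K : Type*} [Field K] [NumberField K] {pb : PowerBasis ℚ K} {θ : 𝓞 K}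

/-- The number of ideals of given norm. -/
noncomputable def normCount (K : Type*) [Field K] [NumberField K] (q : ℕ) : ℕ :=
  {I : Ideal (𝓞 K) | Ideal.absNorm I = q}.ncard

lemma card_le_normCount (T : Finset (Ideal (𝓞 K))) {q : ℕ} (hT : ∀ I ∈ T, Ideal.absNorm I = q) :
    T.card ≤ normCount K q := by
  rw [← Set.ncard_coe_finset]
  exact Set.ncard_le_ncard hT (Ideal.finite_setOfPred_absNorm_eq q)

lemma le_sum_normCount (hθ : (θ : K) = pb.gen) {C E Z : ℕ} (hC1 : 1 ≤ C) (hE : 1 ≤ E)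
    (hZ : 1 ≤ Z)
    (hC : ∀ (x y : K) (a b : ℚ), (∀ i, |pb.basis.repr x i| ≤ a) →
      (∀ i, |pb.basis.repr y i| ≤ b) → ∀ i, |pb.basis.repr (x * y) i| ≤ C * a * b)
    (hN : ∀ (a : ℕ) (c : Fin pb.dim → ℤ), (∀ i, |c i| ≤ a) →
      Ideal.absNorm (Ideal.span {intComb θ pb.dim c}) ≤ (C * a) ^ pb.dim)
    {c₀ : ℝ} (hc₀ : ∀ s : Finset ℕ, ∑ k ∈ s, Real.log k / (k : ℝ) ^ 2 ≤ c₀) :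
    (1 - 1 / (E : ℝ)) * (pb.dim * Real.log Z) - (2 * C) ^ pb.dim *
        (2 * pb.dim * (6 * pb.dim * E * C ^ 2) ^ pb.dim + 3 * pb.dim ^ 2 * c₀) ≤
      (1 + 1 / (E : ℝ)) * ∑ q ∈ Nat.primesLE (Z ^ pb.dim),
        (normCount K q : ℝ) * (Real.log q / q) := by
  classical
  have hd := pb.dim_pos
  have hfr : Module.finrank ℚ K = pb.dim := pb.finrank
  set d := pb.dim with hd'
  set r := 2 * C * Z with hr
  set X := 3 * d * E * r with hX
  set B := (intBox d 0 X).erase 0 with hB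
  set k := (6 * d * E * C ^ 2) ^ d with hk
  have hrpos : 1 ≤ r := Nat.mul_pos (by omega) hZ
  have hXpos : 1 ≤ X := Nat.mul_pos (Nat.mul_pos (by omega) hE) hrpos
  have hE' : (1 : ℝ) ≤ E := by exact_mod_cast hE
  have hX' : (0 : ℝ) < X := by exact_mod_cast hXpos
  have hY : (C * X) ^ d = k * Z ^ d := by
    rw [hk, ← mul_pow, hX, hr]; congr 1; ring
  set M : ℝ := (2 * C : ℝ) ^ d * (X : ℝ) ^ d with hM
  have hM0 : 0 ≤ M := by positivity
  set el : (Fin d → ℤ) → Ideal (𝓞 K) := fun c => Ideal.span {intComb θ pb.dim c} with hel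
  have hel0 : ∀ c ∈ B, el c ≠ ⊥ := by
    intro c hc
    rw [hel, Ne, Ideal.span_singleton_eq_bot]
    exact intComb_ne_zero hθ (Finset.ne_of_mem_erase hc)
  set 𝒬 : Finset (Ideal (𝓞 K)) := B.biUnion fun c => (normalizedFactors (el c)).toFinset with h𝒬
  set L₀ := B.sup fun c => (normalizedFactors (el c)).card with hL₀
  have h𝒬mem : ∀ Q ∈ 𝒬, Q.IsPrime ∧ Q ≠ ⊥ ∧ Ideal.absNorm Q ≤ k * Z ^ d := by
    intro Q hQ
    obtain ⟨c, hc, hcQ⟩ := Finset.mem_biUnion.1 hQ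
    have h1 := Multiset.mem_toFinset.1 hcQ
    have h2 := prime_of_normalized_factor Q h1
    refine ⟨Ideal.isPrime_of_prime h2, h2.ne_zero, ?_⟩
    rw [← hY]
    refine le_trans (Nat.le_of_dvd (absNorm_intComb_pos hθ (Finset.ne_of_mem_erase hc))
      (Ideal.absNorm_dvd_absNorm_of_le (Ideal.le_of_dvd (dvd_of_mem_normalizedFactors h1))))
      (hN X c fun i => ?_)
    have := mem_intBox.1 (Finset.mem_of_mem_erase hc) i
    rw [abs_le]; omega
  choose! q f hqp hf1 hfd hNq hqQ using fun Q (hQ : Q ∈ 𝒬) =>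
    exists_absNorm_eq_pow (h𝒬mem Q hQ).1 (h𝒬mem Q hQ).2.1
  have hN2 : ∀ Q ∈ 𝒬, 2 ≤ Ideal.absNorm Q := by
    intro Q hQ
    rw [hNq Q hQ]
    exact (hqp Q hQ).two_le.trans (Nat.le_self_pow (by have := hf1 Q hQ; omega) _)
  set cnt : Ideal (𝓞 K) → ℕ := fun I => (B.filter fun c => intComb θ pb.dim c ∈ I).card with hcnt
  have hcrude : ∀ I : Ideal (𝓞 K), I ≠ ⊥ → (cnt I : ℝ) ≤ M / Ideal.absNorm I := by
    intro I hI
    have h1 := card_ideal_mul_absNorm_le hθ hN I X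
    have h2 : (0 : ℝ) < Ideal.absNorm I := by
      have : Ideal.absNorm I ≠ 0 := by rwa [Ne, Ideal.absNorm_eq_zero_iff]
      exact_mod_cast Nat.pos_of_ne_zero this
    rw [le_div_iff₀ h2, hM, ← mul_pow]
    exact_mod_cast h1
  have hfactor : ∑ c ∈ B, Real.log (Ideal.absNorm (el c)) ≤
      ∑ Q ∈ 𝒬, ∑ j ∈ Finset.Icc 1 (L₀ + 1), Real.log (Ideal.absNorm Q) * cnt (Q ^ j) := by
    refine (Finset.sum_le_sum fun c hc => log_absNorm_le_sum (hel0 c hc) (𝒬 := 𝒬)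
      (Finset.subset_biUnion_of_mem (fun c => (normalizedFactors (el c)).toFinset) hc)
      (L := L₀ + 1) fun Q => ?_).trans (le_of_eq ?_)
    · have h1 := Multiset.count_le_card Q (normalizedFactors (el c))
      have h2 : (normalizedFactors (el c)).card ≤ L₀ :=
        Finset.le_sup (f := fun c => (normalizedFactors (el c)).card) hc
      omega
    · rw [Finset.sum_comm]
      refine Finset.sum_congr rfl fun Q _ => ?_
      rw [Finset.sum_comm]
      refine Finset.sum_congr rfl fun j _ => ?_
      rw [← Finset.sum_filter, Finset.sum_const, nsmul_eq_mul, mul_comm, hcnt]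
      simp only [hel, Ideal.span_singleton_le_iff_mem]
      congr!
  have hterm : ∀ Q ∈ 𝒬, ∑ j ∈ Finset.Icc 1 (L₀ + 1),
      Real.log (Ideal.absNorm Q) * (cnt (Q ^ j) : ℝ) ≤
      Real.log (Ideal.absNorm Q) * cnt Q +
        2 * M * (Real.log (Ideal.absNorm Q) / (Ideal.absNorm Q : ℝ) ^ 2) := by
    intro Q hQ
    have hlog : 0 ≤ Real.log (Ideal.absNorm Q) := Real.log_natCast_nonneg _
    have h2 : (2 : ℝ) ≤ Ideal.absNorm Q := by exact_mod_cast hN2 Q hQ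
    rw [← Finset.insert_Icc_add_one_left_eq_Icc (by omega : 1 ≤ L₀ + 1),
      Finset.sum_insert (by simp), pow_one]
    gcongr
    rw [← Finset.mul_sum]
    have h3 : ∑ j ∈ Finset.Icc (1 + 1) (L₀ + 1), (cnt (Q ^ j) : ℝ) ≤
        M * (2 * (1 / (Ideal.absNorm Q : ℝ)) ^ 2) := by
      have h4 := sum_pow_Icc_two_le (x := 1 / (Ideal.absNorm Q : ℝ)) (by positivity)
        (one_div_le_one_div_of_le two_pos h2) L₀
      refine le_trans ?_ (mul_le_mul_of_nonneg_left h4 hM0)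
      rw [Finset.mul_sum]
      refine Finset.sum_le_sum fun j _ => ?_
      refine (hcrude _ (pow_ne_zero j (h𝒬mem Q hQ).2.1)).trans (le_of_eq ?_)
      rw [map_pow]; push_cast
      rw [one_div, inv_pow, div_eq_mul_inv]
    refine (mul_le_mul_of_nonneg_left h3 hlog).trans (le_of_eq ?_)
    ring
  have hsharp : ∀ Q ∈ 𝒬, Ideal.absNorm Q ∈ Nat.primesLE (Z ^ d) →
      (cnt Q : ℝ) ≤ (1 + 1 / (E : ℝ)) * (X : ℝ) ^ d / Ideal.absNorm Q := by
    intro Q hQ hmem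
    rw [Nat.mem_primesLE] at hmem
    have h1 := card_degree_one_le hθ X hC hmem.2 hmem.1 rfl
    have h2 : (0 : ℝ) < Ideal.absNorm Q := by exact_mod_cast hmem.2.pos
    rw [le_div_iff₀ h2]
    have h3 : ((X + 2 * (C * Z) : ℕ) : ℝ) = X * (1 + 1 / (3 * d * E)) := by
      rw [hX, hr]; push_cast
      field_simp
    have h4 : (1 + 1 / (3 * d * E : ℝ)) ^ d ≤ 1 + 1 / E := by
      have h5 : (1 + 1 / (3 * d * E : ℝ)) ≤ Real.exp (1 / (3 * d * E)) := by
        rw [add_comm]; exact Real.add_one_le_exp _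
      have hd0 : (0 : ℝ) < d := by exact_mod_cast hd
      have h6 : (1 + 1 / (3 * d * E : ℝ)) ^ d ≤ Real.exp (1 / (3 * E)) := by
        refine (pow_le_pow_left₀ (by positivity) h5 d).trans (le_of_eq ?_)
        rw [← Real.exp_nat_mul]; congr 1; field_simp
      refine h6.trans ?_
      have h7 : 1 / (3 * E : ℝ) ≤ 1 / 3 := by
        apply one_div_le_one_div_of_le <;> linarith
      have h8 := Real.exp_bound_div_one_sub_of_interval (x := 1 / (3 * E : ℝ)) (by positivity)
        (by linarith)
      refine h8.trans ?_
      rw [div_le_iff₀ (by linarith)]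
      have h9 : 1 / (3 * E : ℝ) = 1 / E / 3 := by field_simp
      have h10 : 1 / (E : ℝ) ≤ 1 := by rw [div_le_one (by linarith)]; exact hE'
      have h11 : 0 < 1 / (E : ℝ) := by positivity
      rw [h9]
      nlinarith
    calc (cnt Q : ℝ) * Ideal.absNorm Q ≤ ((X + 2 * (C * Z) : ℕ) : ℝ) ^ d := by
          rw [mul_comm]; exact_mod_cast h1
      _ = (X : ℝ) ^ d * (1 + 1 / (3 * d * E)) ^ d := by rw [h3, mul_pow]
      _ ≤ (X : ℝ) ^ d * (1 + 1 / E) := by gcongr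
      _ = _ := mul_comm _ _
  set s₁ := Nat.primesLE (Z ^ d) with hs₁
  set s₂ := Nat.primesLE (k * Z ^ d) \ Nat.primesLE (Z ^ d) with hs₂
  set s₃ := 𝒬.image q with hs₃
  set g₁ : ℕ → ℝ := fun m => (1 + 1 / (E : ℝ)) * (X : ℝ) ^ d * (Real.log m / m) with hg₁
  set g₂ : ℕ → ℝ := fun m => M * (Real.log m / m) with hg₂
  set g₃ : ℕ → ℝ := fun m => 3 * M * d * (Real.log m / (m : ℝ) ^ 2) with hg₃
  have hg₁0 : ∀ m, 0 ≤ g₁ m := fun m => by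
    have := Real.log_natCast_nonneg m
    positivity
  have hg₂0 : ∀ m, 0 ≤ g₂ m := fun m => by
    have := Real.log_natCast_nonneg m
    positivity
  have hg₃0 : ∀ m, 0 ≤ g₃ m := fun m => by
    have := Real.log_natCast_nonneg m
    positivity
  have hbound : ∀ Q ∈ 𝒬, Real.log (Ideal.absNorm Q) * cnt Q +
        2 * M * (Real.log (Ideal.absNorm Q) / (Ideal.absNorm Q : ℝ) ^ 2) ≤
      (if Ideal.absNorm Q ∈ s₁ then g₁ (Ideal.absNorm Q) else 0) +
      (if Ideal.absNorm Q ∈ s₂ then g₂ (Ideal.absNorm Q) else 0) +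
      (if q Q ∈ s₃ then g₃ (q Q) else 0) := by
    intro Q hQ
    have hlog : 0 ≤ Real.log (Ideal.absNorm Q) := Real.log_natCast_nonneg _
    have hq1 : (1 : ℝ) < q Q := by exact_mod_cast (hqp Q hQ).one_lt
    have hlogq : 0 ≤ Real.log (q Q) := Real.log_natCast_nonneg _
    have hlogle : Real.log (Ideal.absNorm Q) ≤ d * Real.log (q Q) := by
      rw [hNq Q hQ, Nat.cast_pow, Real.log_pow]
      have : (f Q : ℝ) ≤ d := by exact_mod_cast hfr ▸ hfd Q hQ
      gcongr
    have hqN : (q Q : ℝ) ≤ Ideal.absNorm Q := by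
      rw [hNq Q hQ]
      exact_mod_cast Nat.le_self_pow (by have := hf1 Q hQ; omega) _
    have h2 : Real.log (Ideal.absNorm Q) / (Ideal.absNorm Q : ℝ) ^ 2 ≤
        d * (Real.log (q Q) / (q Q : ℝ) ^ 2) := by
      rw [← mul_div_assoc]
      exact div_le_div₀ (by positivity) hlogle (by positivity) (by gcongr)
    have h3 : 0 ≤ M * (d * (Real.log (q Q) / (q Q : ℝ) ^ 2)) := by positivity
    have h4 := mul_le_mul_of_nonneg_left h2 hM0
    have hc1 : Real.log (Ideal.absNorm Q) * cnt Q ≤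
        M * (Real.log (Ideal.absNorm Q) / Ideal.absNorm Q) := by
      refine (mul_le_mul_of_nonneg_left (hcrude Q (h𝒬mem Q hQ).2.1) hlog).trans (le_of_eq ?_)
      ring
    rw [if_pos (Finset.mem_image_of_mem q hQ : q Q ∈ s₃)]
    have h5 : g₃ (q Q) = 3 * (M * (d * (Real.log (q Q) / (q Q : ℝ) ^ 2))) := by
      rw [hg₃]; ring
    rw [h5]
    by_cases hp : (Ideal.absNorm Q).Prime
    · by_cases hmem : Ideal.absNorm Q ∈ s₁
      · rw [if_pos hmem]
        have h6 : Real.log (Ideal.absNorm Q) * cnt Q ≤ g₁ (Ideal.absNorm Q) := by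
          refine (mul_le_mul_of_nonneg_left (hsharp Q hQ hmem) hlog).trans (le_of_eq ?_)
          rw [hg₁]; ring
        have h7 : 0 ≤ if Ideal.absNorm Q ∈ s₂ then g₂ (Ideal.absNorm Q) else 0 := by
          split_ifs
          · exact hg₂0 _
          · exact le_rfl
        linarith
      · have hmem2 : Ideal.absNorm Q ∈ s₂ := by
          rw [hs₂, Finset.mem_sdiff, Nat.mem_primesLE]
          exact ⟨⟨(h𝒬mem Q hQ).2.2, hp⟩, hmem⟩
        rw [if_neg hmem, if_pos hmem2]
        have h6 : Real.log (Ideal.absNorm Q) * cnt Q ≤ g₂ (Ideal.absNorm Q) := hc1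
        linarith
    · have hmem : Ideal.absNorm Q ∉ s₁ := fun h => hp (Nat.mem_primesLE.1 h).2
      have hmem2 : Ideal.absNorm Q ∉ s₂ := fun h =>
        hp (Nat.mem_primesLE.1 (Finset.mem_sdiff.1 h).1).2
      rw [if_neg hmem, if_neg hmem2]
      have hf2 : 2 ≤ f Q := by
        by_contra h
        have h6 : f Q = 1 := by have := hf1 Q hQ; omega
        apply hp
        rw [hNq Q hQ, h6, pow_one]
        exact hqp Q hQ
      have hq2N : (q Q : ℝ) ^ 2 ≤ Ideal.absNorm Q := by
        rw [hNq Q hQ]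
        exact_mod_cast Nat.pow_le_pow_right (hqp Q hQ).pos hf2
      have h6 : Real.log (Ideal.absNorm Q) / Ideal.absNorm Q ≤
          d * (Real.log (q Q) / (q Q : ℝ) ^ 2) := by
        rw [← mul_div_assoc]
        exact div_le_div₀ (by positivity) hlogle (by positivity) hq2N
      have h7 := mul_le_mul_of_nonneg_left h6 hM0
      linarith
  have hprimes_above : ∀ p : ℕ, p.Prime → ∀ T : Finset (Ideal (𝓞 K)), T ⊆ 𝒬 →
      (∀ Q ∈ T, (p : 𝓞 K) ∈ Q) → (T.card : ℝ) ≤ d := by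
    intro p hp T hT hpT
    have := card_primes_above_le hp T fun Q hQ =>
      ⟨(h𝒬mem Q (hT hQ)).1, (h𝒬mem Q (hT hQ)).2.1, hpT Q hQ⟩
    rw [hfr] at this
    exact_mod_cast this
  have hS1 := sum_ite_mem_le_of_card_fiber_le 𝒬 Ideal.absNorm s₁ g₁
    (fun m => (normCount K m : ℝ)) (fun m _ => hg₁0 m) fun m _ => by
      exact_mod_cast card_le_normCount _ fun I hI => (Finset.mem_filter.1 hI).2
  have hS2 := sum_ite_mem_le_of_card_fiber_le 𝒬 Ideal.absNorm s₂ g₂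
    (fun _ => (d : ℝ)) (fun m _ => hg₂0 m) fun m hm =>
      hprimes_above m (Nat.mem_primesLE.1 (Finset.mem_sdiff.1 hm).1).2 _
        (Finset.filter_subset _ _) fun Q hQ => by
          rw [← (Finset.mem_filter.1 hQ).2]; exact Ideal.absNorm_mem Q
  have hS3 := sum_ite_mem_le_of_card_fiber_le 𝒬 q s₃ g₃
    (fun _ => (d : ℝ)) (fun m _ => hg₃0 m) fun m hm => by
      obtain ⟨Q₀, hQ₀, rfl⟩ := Finset.mem_image.1 hm
      refine hprimes_above _ (hqp Q₀ hQ₀) _ (Finset.filter_subset _ _) fun Q hQ => ?_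
      rw [← (Finset.mem_filter.1 hQ).2]
      exact hqQ Q (Finset.mem_filter.1 hQ).1
  have hlow := le_sum_log_absNorm hθ hE hrpos hX
  have htot := (hlow.trans hfactor).trans (Finset.sum_le_sum fun Q hQ =>
    (hterm Q hQ).trans (hbound Q hQ))
  rw [Finset.sum_add_distrib, Finset.sum_add_distrib] at htot
  have hS2' : ∑ m ∈ s₂, (d : ℝ) * g₂ m ≤ d * (M * (2 * k)) := by
    rw [← Finset.mul_sum, hg₂, ← Finset.mul_sum]
    have h1 := sum_log_div_primesLE_sdiff_le (Z ^ d) k (by positivity)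
    have h2 : Real.log 4 * k ≤ 2 * k := by
      have := log_four_le_two
      gcongr
    have := h1.trans h2
    gcongr
  have hS3' : ∑ m ∈ s₃, (d : ℝ) * g₃ m ≤ d * (3 * M * d * c₀) := by
    rw [← Finset.mul_sum, hg₃, ← Finset.mul_sum]
    have := hc₀ s₃
    gcongr
  have hS1' : ∑ m ∈ s₁, (normCount K m : ℝ) * g₁ m = (X : ℝ) ^ d * ((1 + 1 / (E : ℝ)) *
      ∑ m ∈ s₁, (normCount K m : ℝ) * (Real.log m / m)) := by
    rw [hg₁, Finset.mul_sum, Finset.mul_sum]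
    exact Finset.sum_congr rfl fun m _ => by ring
  have hXd : (0 : ℝ) < (X : ℝ) ^ d := by positivity
  have hlogr : Real.log Z ≤ Real.log r := by
    refine Real.log_le_log (by exact_mod_cast hZ) ?_
    have : Z ≤ r := by
      calc Z = 1 * Z := by ring
        _ ≤ 2 * C * Z := Nat.mul_le_mul_right _ (by omega)
    exact_mod_cast this
  have h1E : 0 ≤ 1 - 1 / (E : ℝ) := by
    rw [sub_nonneg, div_le_one (by linarith)]; exact hE'
  have hlow' : (X : ℝ) ^ d * ((1 - 1 / (E : ℝ)) * (d * Real.log Z)) ≤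
      (1 - 1 / (E : ℝ)) * (X : ℝ) ^ d * (d * Real.log r) := by
    have : (d : ℝ) * Real.log Z ≤ d * Real.log r := by gcongr
    calc _ = (1 - 1 / (E : ℝ)) * (X : ℝ) ^ d * (d * Real.log Z) := by ring
      _ ≤ _ := by gcongr
  have hkcast : ((k : ℕ) : ℝ) = (6 * d * E * C ^ 2 : ℝ) ^ d := by rw [hk]; push_cast; rfl
  rw [← hkcast]
  refine le_of_mul_le_mul_left ?_ hXd
  rw [mul_sub]
  have hfin : (X : ℝ) ^ d * ((2 * C) ^ d * (2 * d * k + 3 * d ^ 2 * c₀)) =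
      d * (M * (2 * k)) + d * (3 * M * d * c₀) := by
    rw [hM]; ring
  rw [hfin]
  linarith

end LowerBound

/-- A constant controlling multiplication in, and norms from, an order generated by an element
of degree `d` whose conjugates are bounded by `H`. -/
def structConst (d H : ℕ) : ℕ := d * (d * ((2 * H) ^ d + 1)) ^ d

section Constants

open NumberField

variable {K : Type*} [Field K] [NumberField K] {pb : PowerBasis ℚ K} {θ : 𝓞 K}

lemma abs_coeff_minpoly_gen_le (hθ : (θ : K) = pb.gen) {H : ℕ} (hH : 1 ≤ H)
    (hσ : ∀ σ : K →ₐ[ℚ] ℂ, ‖σ θ‖ ≤ H) (i : ℕ) :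
    |(minpoly ℚ pb.gen).coeff i| ≤ ((2 * H) ^ pb.dim : ℕ) := by
  have h1 := NumberField.Embeddings.coeff_bdd_of_norm_le (A := ℂ) (B := H) (x := (θ : K))
    (fun φ => hσ φ.toRatAlgHom) i
  have hH' : (1 : ℝ) ≤ H := by exact_mod_cast hH
  rw [max_eq_left hH', pb.finrank, hθ] at h1
  have h2 : (pb.dim.choose (pb.dim / 2) : ℝ) ≤ 2 ^ pb.dim := by
    exact_mod_cast Nat.choose_le_two_pow _ _
  have h3 : ‖(minpoly ℚ pb.gen).coeff i‖ ≤ (((2 * H) ^ pb.dim : ℕ) : ℝ) := by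
    refine h1.trans ?_
    push_cast
    rw [mul_pow, mul_comm]
    gcongr
  have h4 : ‖(minpoly ℚ pb.gen).coeff i‖ = ((|(minpoly ℚ pb.gen).coeff i| : ℚ) : ℝ) := by
    rw [Rat.cast_abs]; rfl
  rw [h4] at h3
  exact_mod_cast h3

lemma abs_repr_mul_le_structConst (hθ : (θ : K) = pb.gen) {H : ℕ} (hH : 1 ≤ H)
    (hσ : ∀ σ : K →ₐ[ℚ] ℂ, ‖σ θ‖ ≤ H) (x y : K) (a b : ℚ)
    (hx : ∀ i, |pb.basis.repr x i| ≤ a) (hy : ∀ i, |pb.basis.repr y i| ≤ b) (i : Fin pb.dim) :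
    |pb.basis.repr (x * y) i| ≤ structConst pb.dim H * a * b :=
  abs_repr_mul_le pb (fun i => abs_coeff_minpoly_gen_le hθ hH hσ i) hx hy i

lemma absNorm_intComb_le_structConst (hθ : (θ : K) = pb.gen) {H : ℕ} (hH : 1 ≤ H)
    (hσ : ∀ σ : K →ₐ[ℚ] ℂ, ‖σ θ‖ ≤ H) (a : ℕ) (c : Fin pb.dim → ℤ) (hc : ∀ i, |c i| ≤ a) :
    Ideal.absNorm (Ideal.span {intComb θ pb.dim c}) ≤ (structConst pb.dim H * a) ^ pb.dim := by
  have hd := pb.dim_pos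
  refine (absNorm_intComb_le hθ hH hσ hc).trans (Nat.pow_le_pow_left ?_ _)
  refine Nat.mul_le_mul_right _ (Nat.mul_le_mul_left _ ?_)
  calc H ^ pb.dim ≤ (2 * H) ^ pb.dim := Nat.pow_le_pow_left (by omega) _
    _ ≤ 1 * ((2 * H) ^ pb.dim + 1) := by omega
    _ ≤ pb.dim * ((2 * H) ^ pb.dim + 1) := Nat.mul_le_mul_right _ hd
    _ ≤ _ := Nat.le_self_pow hd.ne' _

lemma one_le_structConst {d H : ℕ} (hd : 1 ≤ d) : 1 ≤ structConst d H :=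
  Nat.mul_pos hd (pow_pos (Nat.mul_pos hd (Nat.succ_pos _)) _)

/-- The discriminant of an integral power basis is a bounded nonzero integer. -/
lemma exists_discr_bound (hθ : (θ : K) = pb.gen) {H : ℕ} (hH : 1 ≤ H)
    (hσ : ∀ σ : K →ₐ[ℚ] ℂ, ‖σ θ‖ ≤ H) :
    ∃ Δ : ℕ, Δ ≠ 0 ∧ Δ ≤ (2 * H) ^ (2 * pb.dim ^ 2) ∧
      ∀ x : 𝓞 K, ∃ P : ℤ[X], aeval θ P = Δ * x := by
  have hint : IsIntegral ℤ pb.gen := hθ ▸ θ.2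
  have hint' : IsIntegral ℤ (Algebra.discr ℚ pb.basis) :=
    Algebra.discr_isIntegral ℚ fun i => by
      rw [pb.basis_eq_pow]; exact hint.pow _
  obtain ⟨D, hD⟩ := IsIntegrallyClosed.isIntegral_iff.1 hint'
  rw [algebraMap_int_eq, eq_intCast] at hD
  have hD0 : D ≠ 0 := by
    rintro rfl
    exact Algebra.discr_not_zero_of_basis ℚ pb.basis (by simpa using hD.symm)
  refine ⟨D.natAbs, Int.natAbs_ne_zero.2 hD0, ?_, fun x => ?_⟩
  · let e : Fin pb.dim ≃ (K →ₐ[ℚ] ℂ) :=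
      (Fintype.equivFinOfCardEq (card_embeddings pb)).symm
    have h1 := Algebra.discr_powerBasis_eq_prod ℚ ℂ pb e
    rw [← hD] at h1
    have h2 := congrArg norm h1
    have h2H : (1 : ℝ) ≤ 2 * H := by
      have : (1 : ℝ) ≤ H := by exact_mod_cast hH
      linarith
    have h3 : (D.natAbs : ℝ) ≤ (2 * H : ℝ) ^ (2 * pb.dim ^ 2) := by
      have h4 : ‖(algebraMap ℚ ℂ) (D : ℚ)‖ = (D.natAbs : ℝ) := by
        rw [Nat.cast_natAbs]; simp
      rw [← h4, h2, norm_prod]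
      calc _ ≤ ∏ _i : Fin pb.dim, ((2 * H : ℝ) ^ 2) ^ pb.dim := by
            refine Finset.prod_le_prod (fun _ _ => norm_nonneg _) fun i _ => ?_
            rw [norm_prod]
            have h5 : ∀ j ∈ Finset.Ioi i, ‖((e j) pb.gen - (e i) pb.gen) ^ 2‖ ≤ (2 * H : ℝ) ^ 2 := by
              intro j _
              rw [norm_pow]
              refine pow_le_pow_left₀ (norm_nonneg _) ((norm_sub_le _ _).trans ?_) _
              have h6 := hσ (e j)
              have h7 := hσ (e i)
              rw [hθ] at h6 h7
              linarith
            refine (Finset.prod_le_prod (fun _ _ => norm_nonneg _) h5).trans ?_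
            rw [Finset.prod_const]
            refine pow_le_pow_right₀ (one_le_pow₀ h2H) ?_
            simpa using Finset.card_le_univ (Finset.Ioi i)
        _ = _ := by
            rw [Finset.prod_const, Finset.card_univ, Fintype.card_fin, ← pow_mul, ← pow_mul]
            congr 1; ring
    exact_mod_cast h3
  · have h1 := Algebra.discr_mul_isIntegral_mem_adjoin ℚ hint x.2
    rw [← hD, Algebra.adjoin_singleton_eq_range_aeval] at h1
    obtain ⟨P, hP⟩ := h1
    have hP' : aeval θ P = D * x := by
      apply RingOfIntegers.ext
      have h2 : algebraMap (𝓞 K) K (aeval θ P) = aeval (θ : K) P := (aeval_algebraMap_apply K θ P).symm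
      refine h2.trans ?_
      rw [hθ]
      refine hP.trans ?_
      rw [Algebra.smul_def]
      simp only [map_intCast, map_mul]
      rfl
    rcases Int.natAbs_eq D with h | h
    · refine ⟨P, ?_⟩
      rw [hP']
      conv_lhs => rw [h]
      simp
    · refine ⟨-P, ?_⟩
      rw [map_neg, hP']
      conv_lhs => rw [h]
      simp

end Constants

section Transfer

open NumberField

variable {K : Type*} [Field K] [NumberField K] {pb : PowerBasis ℚ K} {θ : 𝓞 K}

lemma ringHom_ext_of_discr {Δ q : ℕ} [Fact q.Prime] (hqΔ : ¬ q ∣ Δ)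
    (hΔ : ∀ x : 𝓞 K, ∃ P : ℤ[X], aeval θ P = Δ * x) {Ψ Ψ' : 𝓞 K →+* ZMod q}
    (h : Ψ θ = Ψ' θ) : Ψ = Ψ' := by
  ext x
  obtain ⟨P, hP⟩ := hΔ x
  have haev : ∀ Φ : 𝓞 K →+* ZMod q, Φ (aeval θ P) = aeval (Φ θ) P := by
    intro Φ
    rw [aeval_def, hom_eval₂, aeval_def]
    congr 1
    exact RingHom.ext_int _ _
  have h1 : (Δ : ZMod q) * Ψ x = Δ * Ψ' x :=
    calc (Δ : ZMod q) * Ψ x = Ψ (Δ * x) := by rw [map_mul, map_natCast]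
      _ = Ψ' (Δ * x) := by rw [← hP, haev, haev, h]
      _ = Δ * Ψ' x := by rw [map_mul, map_natCast]
  refine mul_left_cancel₀ ?_ h1
  rwa [Ne, ZMod.natCast_eq_zero_iff]

lemma exists_finset_normCount (q : ℕ) : ∃ T : Finset (Ideal (𝓞 K)), normCount K q = T.card ∧
    ∀ I ∈ T, Ideal.absNorm I = q := by
  have hfin : {I : Ideal (𝓞 K) | Ideal.absNorm I = q}.Finite := Ideal.finite_setOfPred_absNorm_eq q
  refine ⟨hfin.toFinset, Set.ncard_eq_toFinset_card _ hfin, fun I hI => ?_⟩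
  simpa using hI

lemma normCount_le_finrank {q : ℕ} (hq : q.Prime) : normCount K q ≤ Module.finrank ℚ K := by
  obtain ⟨T, hT, hT'⟩ := exists_finset_normCount (K := K) q
  rw [hT]
  refine card_primes_above_le hq T fun I hI => ⟨?_, ?_, ?_⟩
  · refine Ideal.isPrime_of_irreducible_absNorm ?_
    rw [hT' I hI]; exact hq
  · rintro rfl
    have := hT' _ hI
    rw [Ideal.absNorm_bot] at this
    exact hq.ne_zero this.symm
  · rw [← hT' I hI]; exact Ideal.absNorm_mem I

/-- Degree one primes inject into ordered pairs of distinct roots. -/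
lemma normCount_le_offDiag {Q : ℤ[X]} {a a' : 𝓞 K} {k : ℤ} (ha : aeval a Q = 0)
    (ha' : aeval a' Q = 0) (hθa : θ = a + k * a') {Δ q : ℕ} (hq : q.Prime) (hqΔ : ¬ q ∣ Δ)
    (hΔ : ∀ x : 𝓞 K, ∃ P : ℤ[X], aeval θ P = Δ * x)
    (hqN : ¬ q ∣ Ideal.absNorm (Ideal.span {a - a'})) :
    normCount K q ≤ (rootsMod Q q).card * (rootsMod Q q).card - (rootsMod Q q).card := by
  have : Fact q.Prime := ⟨hq⟩
  obtain ⟨T, hT, hT'⟩ := exists_finset_normCount (K := K) q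
  rw [hT, ← Finset.offDiag_card]
  rcases T.eq_empty_or_nonempty with rfl | ⟨I₀, hI₀⟩
  · simp
  have : Nonempty (𝓞 K →+* ZMod q) := ⟨(exists_ringHom_of_absNorm_prime hq (hT' I₀ hI₀)).choose⟩
  choose! Ψ hΨ using fun I (hI : I ∈ T) => exists_ringHom_of_absNorm_prime hq (hT' I hI)
  have hroot : ∀ (Φ : 𝓞 K →+* ZMod q) (x : 𝓞 K), aeval x Q = 0 → (Φ x).val ∈ rootsMod Q q := by
    intro Φ x hx
    rw [mem_rootsMod]
    refine ⟨ZMod.val_lt _, ?_⟩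
    rw [← aeval_natCast_zmod_eq_zero_iff, ZMod.natCast_zmod_val]
    have h1 := congrArg Φ hx
    rw [map_zero, aeval_def, hom_eval₂] at h1
    rw [aeval_def, ← h1]
    congr 1
    exact RingHom.ext_int _ _
  refine Finset.card_le_card_of_injOn (fun I => ((Ψ I a).val, (Ψ I a').val)) (fun I hI => ?_) ?_
  · rw [Finset.mem_coe, Finset.mem_offDiag]
    refine ⟨hroot _ _ ha, hroot _ _ ha', fun h => hqN ?_⟩
    have h1 : Ψ I (a - a') = 0 := by
      rw [map_sub, sub_eq_zero]; exact ZMod.val_injective q h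
    rw [← RingHom.mem_ker, hΨ I hI] at h1
    rw [← hT' I hI]
    exact Ideal.absNorm_dvd_absNorm_of_le ((Ideal.span_singleton_le_iff_mem I).2 h1)
  · intro I hI J hJ h
    rw [Prod.mk.injEq] at h
    have h1 := ZMod.val_injective q h.1
    have h2 := ZMod.val_injective q h.2
    have h3 : Ψ I = Ψ J := by
      refine ringHom_ext_of_discr hqΔ hΔ ?_
      rw [hθa, map_add, map_add, map_mul, map_mul, h1, h2, map_intCast, map_intCast]
    rw [← hΨ I hI, ← hΨ J hJ, h3]

lemma sum_normCount_le {Q : ℤ[X]} {a a' : 𝓞 K} {k : ℤ} (ha : aeval a Q = 0)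
    (ha' : aeval a' Q = 0) (haa : a ≠ a') (hθa : θ = a + k * a') {Δ : ℕ} (hΔ0 : Δ ≠ 0)
    (hΔ : ∀ x : 𝓞 K, ∃ P : ℤ[X], aeval θ P = Δ * x) (s : Finset ℕ) (hs : ∀ q ∈ s, q.Prime) :
    ∑ q ∈ s, (normCount K q : ℝ) * (Real.log q / q) ≤
      ∑ q ∈ s, ((rootsMod Q q).card * (rootsMod Q q).card - (rootsMod Q q).card : ℝ) *
        (Real.log q / q) +
      Module.finrank ℚ K * Real.log (Δ * Ideal.absNorm (Ideal.span {a - a'}) : ℕ) := by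
  classical
  have hN0 : Ideal.absNorm (Ideal.span {a - a'}) ≠ 0 := by
    rw [Ne, Ideal.absNorm_eq_zero_iff, Ideal.span_singleton_eq_bot]
    exact sub_ne_zero.2 haa
  set N := Δ * Ideal.absNorm (Ideal.span {a - a'}) with hN
  have hbad := sum_log_le_of_prime_dvd (N := N) (Nat.mul_ne_zero hΔ0 hN0)
    (s.filter fun q => q ∣ N) (fun q hq => by
      rw [Finset.mem_filter] at hq
      exact ⟨hs q hq.1, hq.2⟩)
  refine le_trans ?_ (add_le_add_right (mul_le_mul_of_nonneg_left hbad (Nat.cast_nonneg _)) _)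
  rw [Finset.mul_sum, Finset.sum_filter, ← Finset.sum_add_distrib]
  refine Finset.sum_le_sum fun q hq => ?_
  have hqp := hs q hq
  have hlog : 0 ≤ Real.log q := Real.log_natCast_nonneg q
  have hq1 : (1 : ℝ) ≤ q := by exact_mod_cast hqp.one_le
  have hw : Real.log q / q ≤ Real.log q := div_le_self hlog hq1
  have hw0 : 0 ≤ Real.log q / q := by positivity
  have hself : (rootsMod Q q).card ≤ (rootsMod Q q).card * (rootsMod Q q).card :=
    Nat.le_mul_self _
  have hcast : ((rootsMod Q q).card * (rootsMod Q q).card - (rootsMod Q q).card : ℝ) =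
      (((rootsMod Q q).card * (rootsMod Q q).card - (rootsMod Q q).card : ℕ) : ℝ) := by
    rw [Nat.cast_sub hself]; push_cast; rfl
  rw [hcast]
  by_cases h : q ∣ N
  · rw [if_pos h]
    have h1 : (normCount K q : ℝ) ≤ Module.finrank ℚ K := by
      exact_mod_cast normCount_le_finrank hqp
    have h2 : (normCount K q : ℝ) * (Real.log q / q) ≤ Module.finrank ℚ K * Real.log q := by
      gcongr
    refine h2.trans (le_add_of_nonneg_left (by positivity))
  · rw [if_neg h, add_zero]
    refine mul_le_mul_of_nonneg_right ?_ hw0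
    have h1 : ¬ q ∣ Δ := fun h' => h (h'.mul_right _)
    have h2 : ¬ q ∣ Ideal.absNorm (Ideal.span {a - a'}) := fun h' => h (h'.mul_left _)
    exact_mod_cast normCount_le_offDiag ha ha' hθa hqp h1 hΔ h2

end Transfer

section Fields

open NumberField IntermediateField

lemma exists_pow_ge {n m : ℕ} (hn : 1 ≤ n) (hm : 1 ≤ m) :
    ∃ Z : ℕ, 1 ≤ Z ∧ n ≤ Z ^ m ∧ m * Real.log Z ≤ Real.log n + m * Real.log 2 := by
  have hex : ∃ Z : ℕ, n ≤ Z ^ m := ⟨n, Nat.le_self_pow (by omega) n⟩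
  classical
  have hZ := Nat.find_spec hex
  set Z := Nat.find hex with hZdef
  have hZ1 : 1 ≤ Z := by
    by_contra! h
    have : Z = 0 := by omega
    rw [this, zero_pow (by omega)] at hZ
    omega
  refine ⟨Z, hZ1, hZ, ?_⟩
  have hn0 : (0 : ℝ) < n := by exact_mod_cast hn
  rcases hZ1.eq_or_lt with h | h
  · rw [← h, Nat.cast_one, Real.log_one, mul_zero]
    have := Real.log_natCast_nonneg n
    have := Real.log_pos one_lt_two
    positivity
  · have h1 : (Z - 1) ^ m < n := by
      have := Nat.find_min hex (m := Z - 1) (by omega)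
      omega
    have h2 : Z ^ m ≤ n * 2 ^ m :=
      calc Z ^ m ≤ ((Z - 1) * 2) ^ m := Nat.pow_le_pow_left (by omega) m
        _ = (Z - 1) ^ m * 2 ^ m := mul_pow _ _ _
        _ ≤ n * 2 ^ m := by gcongr
    have h3 : (Z : ℝ) ^ m ≤ n * 2 ^ m := by exact_mod_cast h2
    have hZ0 : (0 : ℝ) < Z := by exact_mod_cast hZ1
    have h4 := Real.log_le_log (by positivity) h3
    rwa [Real.log_mul (by positivity) (by positivity), Real.log_pow, Real.log_pow] at h4

lemma exists_pow_le {n m : ℕ} (hn : 1 ≤ n) (hm : 1 ≤ m) :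
    ∃ Z : ℕ, 1 ≤ Z ∧ Z ^ m ≤ n ∧ Real.log n - m * Real.log 2 ≤ m * Real.log Z := by
  obtain ⟨Z, hZ1, hZ, h⟩ : ∃ Z : ℕ, 1 ≤ Z ∧ Z ^ m ≤ n ∧ n < (Z + 1) ^ m := by
    have hex : ∃ Z : ℕ, n < (Z + 1) ^ m :=
      ⟨n, (Nat.lt_succ_self n).trans_le (Nat.le_self_pow (by omega) _)⟩
    classical
    have hZ := Nat.find_spec hex
    set Z := Nat.find hex with hZdef
    have hZ1 : 1 ≤ Z := by
      by_contra! h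
      have : Z = 0 := by omega
      rw [this, zero_add, one_pow] at hZ
      omega
    refine ⟨Z, hZ1, ?_, hZ⟩
    have := Nat.find_min hex (m := Z - 1) (by omega)
    rw [Nat.sub_add_cancel hZ1] at this
    omega
  refine ⟨Z, hZ1, hZ, ?_⟩
  have h2 : n ≤ Z ^ m * 2 ^ m := by
    rw [← mul_pow]
    exact h.le.trans (Nat.pow_le_pow_left (by omega) m)
  have h3 : (n : ℝ) ≤ Z ^ m * 2 ^ m := by exact_mod_cast h2
  have hn0 : (0 : ℝ) < n := by exact_mod_cast hn
  have hZ0 : (0 : ℝ) < Z := by exact_mod_cast hZ1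
  have h4 := Real.log_le_log hn0 h3
  rw [Real.log_mul (by positivity) (by positivity), Real.log_pow, Real.log_pow] at h4
  linarith

lemma aeval_map_intCast {R : Type*} [Ring R] [Algebra ℚ R] (x : R) (Q : ℤ[X]) :
    aeval x (Q.map (Int.castRingHom ℚ)) = aeval x Q :=
  aeval_map_algebraMap ℚ x Q

lemma sum_card_rootsMod_le_log {Q : ℤ[X]} (hQ : Q.Monic)
    (hirr : Irreducible (Q.map (Int.castRingHom ℚ))) {m H E n : ℕ} (hm : Q.natDegree = m)
    (hm1 : 1 ≤ m) (hH : 1 ≤ H) (hroots : ∀ z : ℂ, aeval z Q = 0 → ‖z‖ ≤ H) (hE : 1 ≤ E)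
    (hn : 1 ≤ n) :
    (1 - 1 / (E : ℝ)) * ∑ q ∈ Nat.primesLE n, ((rootsMod Q q).card : ℝ) * (Real.log q / q) ≤
      Real.log n + m * Real.log 2 +
        m * (Real.log (2 * m * E * structConst m H ^ 2 : ℕ) + 2) := by
  set Qq := Q.map (Int.castRingHom ℚ) with hQq
  have hQqm : Qq.Monic := hQ.map _
  have hdeg : Qq.natDegree = m := by rw [hQq, hQ.natDegree_map, hm]
  obtain ⟨α, hα⟩ := IsAlgClosed.exists_aeval_eq_zero ℂ Qq
    (by rw [degree_eq_natDegree hQqm.ne_zero, hdeg]; exact_mod_cast (by omega : m ≠ 0))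
  have hαint : IsIntegral ℚ α := ⟨Qq, hQqm, hα⟩
  have hmin : minpoly ℚ α = Qq := (minpoly.eq_of_irreducible_of_monic hirr hα hQqm).symm
  let pb := adjoin.powerBasis hαint
  have : FiniteDimensional ℚ ℚ⟮α⟯ := adjoin.finiteDimensional hαint
  have : NumberField ℚ⟮α⟯ := ⟨⟩
  have hdim : pb.dim = m := by
    rw [show pb.dim = (minpoly ℚ α).natDegree from adjoin.powerBasis_dim hαint, hmin, hdeg]
  have hgen : minpoly ℚ pb.gen = Qq := by
    rw [show pb.gen = AdjoinSimple.gen ℚ α from adjoin.powerBasis_gen hαint]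
    exact (minpoly_gen ℚ α).trans hmin
  have hgint : IsIntegral ℤ pb.gen := by
    refine ⟨Q, hQ, ?_⟩
    have h := minpoly.aeval ℚ pb.gen
    rw [hgen, hQq, aeval_map_intCast] at h
    exact h
  let θ : 𝓞 ℚ⟮α⟯ := ⟨pb.gen, hgint⟩
  have hθ : (θ : ℚ⟮α⟯) = pb.gen := rfl
  have hminθ : minpoly ℤ θ = Q := by
    have h := minpoly_map_eq hθ
    rw [hgen, hQq] at h
    exact map_injective _ (Int.cast_injective) h
  have hσ : ∀ σ : ℚ⟮α⟯ →ₐ[ℚ] ℂ, ‖σ θ‖ ≤ (H : ℕ) := by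
    intro σ
    refine hroots _ ?_
    have h := minpoly.aeval ℚ pb.gen
    rw [hgen, hQq, aeval_map_intCast] at h
    have h1 := congrArg σ h
    rw [map_zero] at h1
    rw [← h1]
    exact (Polynomial.aeval_algHom_apply (σ.restrictScalars ℤ) pb.gen Q)
  obtain ⟨Z, hZ1, hZ, hZlog⟩ := exists_pow_ge hn hm1
  have key := sum_card_rootsMod_le hθ (C := structConst pb.dim H) (E := E) (Z := Z)
    (one_le_structConst (by omega)) hE hZ1 (abs_repr_mul_le_structConst hθ hH hσ)
    (absNorm_intComb_le_structConst hθ hH hσ)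
  rw [hminθ, hdim] at key
  have hE' : 0 ≤ 1 - 1 / (E : ℝ) := by
    have : (1 : ℝ) ≤ E := by exact_mod_cast hE
    rw [sub_nonneg, div_le_one (by linarith)]
    exact this
  have hmono : ∑ q ∈ Nat.primesLE n, ((rootsMod Q q).card : ℝ) * (Real.log q / q) ≤
      ∑ q ∈ Nat.primesLE (Z ^ m), ((rootsMod Q q).card : ℝ) * (Real.log q / q) := by
    refine Finset.sum_le_sum_of_subset_of_nonneg (fun q hq => ?_) fun q _ _ => ?_
    · rw [Nat.mem_primesLE] at hq ⊢
      exact ⟨hq.1.trans hZ, hq.2⟩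
    · have := Real.log_natCast_nonneg q
      positivity
  have := mul_le_mul_of_nonneg_left hmono hE'
  linarith

end Fields

section Pair

open NumberField IntermediateField

variable {K : Type*} [Field K] [NumberField K]

lemma exists_primitive_combination {a a' : K}
    (hgen : ∀ φ ψ : K →ₐ[ℚ] ℂ, φ a = ψ a → φ a' = ψ a' → φ = ψ) :
    ∃ k : ℕ, k ≤ Module.finrank ℚ K ^ 2 ∧ ℚ⟮a + k * a'⟯ = ⊤ := by
  classical
  set D := Module.finrank ℚ K with hD
  have hcard : Fintype.card (K →ₐ[ℚ] ℂ) = D := AlgHom.card ℚ K ℂ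
  by_contra! hno
  have hbad : ∀ k ∈ Finset.range (D ^ 2 + 1), ∃ p : (K →ₐ[ℚ] ℂ) × (K →ₐ[ℚ] ℂ),
      p.1 (a + k * a') = p.2 (a + k * a') ∧ p.1 ≠ p.2 := by
    intro k hk
    have h := hno k (by rw [Finset.mem_range] at hk; omega)
    obtain ⟨φ⟩ : Nonempty (K →ₐ[ℚ] ℂ) := by
      rw [← Fintype.card_pos_iff, hcard]
      exact Module.finrank_pos
    rw [Ne, Field.primitive_element_iff_algHom_eq_of_eval ℚ ℂ
      (fun x => IsAlgClosed.splits _) _ φ] at h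
    push Not at h
    obtain ⟨ψ, h1, h2⟩ := h
    exact ⟨(φ, ψ), h1, h2⟩
  obtain ⟨P₀, -⟩ := hbad 0 (by simp)
  have : Nonempty ((K →ₐ[ℚ] ℂ) × (K →ₐ[ℚ] ℂ)) := ⟨P₀⟩
  choose! f hf using hbad
  have hlt : (Finset.univ : Finset ((K →ₐ[ℚ] ℂ) × (K →ₐ[ℚ] ℂ))).card <
      (Finset.range (D ^ 2 + 1)).card := by
    rw [Finset.card_univ, Fintype.card_prod, hcard, Finset.card_range, sq]
    exact Nat.lt_succ_self _
  obtain ⟨k, hk, l, hl, hkl, hfkl⟩ :=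
    Finset.exists_ne_map_eq_of_card_lt_of_maps_to hlt (f := f) fun _ _ => Finset.mem_univ _
  have h1 := (hf k hk).1
  have h2 := (hf l hl).1
  rw [← hfkl] at h2
  have hne := (hf k hk).2
  generalize f k = P at h1 h2 hne
  simp only [map_add, map_mul, map_natCast] at h1 h2
  have h3 : ((k : ℂ) - l) * (P.1 a' - P.2 a') = 0 := by linear_combination h1 - h2
  have hkl' : (k : ℂ) - l ≠ 0 := sub_ne_zero.2 (by exact_mod_cast hkl)
  have h4 : P.1 a' = P.2 a' := sub_eq_zero.1 ((mul_eq_zero.1 h3).resolve_left hkl')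
  have h5 : P.1 a = P.2 a := by rw [h4] at h1; exact add_right_cancel h1
  exact hne (hgen _ _ h5 h4)

lemma aeval_algHom_eq_zero {a : K} {Q : ℤ[X]} (ha : aeval a Q = 0) (σ : K →ₐ[ℚ] ℂ) :
    aeval (σ a) Q = 0 := by
  have h := congrArg σ ha
  rw [map_zero] at h
  rw [← h]
  exact Polynomial.aeval_algHom_apply (σ.restrictScalars ℤ) a Q

lemma finrank_le_natDegree_sq {a a' : K} {Q : ℤ[X]} (hQ : Q.Monic) (ha : aeval a Q = 0)
    (ha' : aeval a' Q = 0)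
    (hgen : ∀ φ ψ : K →ₐ[ℚ] ℂ, φ a = ψ a → φ a' = ψ a' → φ = ψ) :
    Module.finrank ℚ K ≤ Q.natDegree ^ 2 := by
  classical
  rw [← AlgHom.card ℚ K ℂ]
  set R := (Q.map (Int.castRingHom ℂ)).roots.toFinset with hR
  have hRcard : R.card ≤ Q.natDegree :=
    calc R.card ≤ (Q.map (Int.castRingHom ℂ)).roots.card := Multiset.toFinset_card_le _
      _ ≤ (Q.map (Int.castRingHom ℂ)).natDegree := card_roots' _
      _ ≤ Q.natDegree := natDegree_map_le
  have hmem : ∀ (σ : K →ₐ[ℚ] ℂ) (x : K), aeval x Q = 0 → σ x ∈ R := by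
    intro σ x hx
    rw [hR, Multiset.mem_toFinset, mem_roots (hQ.map _).ne_zero, IsRoot, eval_map]
    exact aeval_algHom_eq_zero hx σ
  calc Fintype.card (K →ₐ[ℚ] ℂ) ≤ (R ×ˢ R).card := by
        rw [← Finset.card_univ]
        refine Finset.card_le_card_of_injOn (fun σ => (σ a, σ a')) (fun σ _ => ?_) ?_
        · rw [Finset.mem_coe, Finset.mem_product]
          exact ⟨hmem σ a ha, hmem σ a' ha'⟩
        · intro φ _ ψ _ h
          rw [Prod.mk.injEq] at h
          exact hgen φ ψ h.1 h.2
    _ = R.card ^ 2 := by rw [Finset.card_product, sq]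
    _ ≤ Q.natDegree ^ 2 := Nat.pow_le_pow_left hRcard 2

/-- Lower bound for a weighted count of ordered pairs of distinct roots modulo primes, from a
number field generated by two roots. -/
lemma le_sum_rootsMod_pairs_of_field {a a' : 𝓞 K} {Q : ℤ[X]} (hQ : Q.Monic) (ha : aeval a Q = 0)
    (ha' : aeval a' Q = 0) (haa : a ≠ a')
    (hgen : ∀ φ ψ : K →ₐ[ℚ] ℂ, φ a = ψ a → φ a' = ψ a' → φ = ψ) {H E n : ℕ} (hH : 1 ≤ H)
    (hroots : ∀ z : ℂ, aeval z Q = 0 → ‖z‖ ≤ H) (hE : 1 ≤ E) (hn : 1 ≤ n)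
    {c₀ : ℝ} (hc₀ : ∀ s : Finset ℕ, ∑ k ∈ s, Real.log k / k ^ 2 ≤ c₀) :
    ∃ D H' C B : ℕ, 1 ≤ D ∧ D ≤ Q.natDegree ^ 2 ∧ H' = H * (1 + Q.natDegree ^ 4) ∧
      C = structConst D H' ∧ B ≤ (2 * H') ^ (2 * D ^ 2) * (2 * H) ^ D ∧
      (1 - 1 / (E : ℝ)) * (Real.log n - D * Real.log 2) -
        (2 * C) ^ D * (2 * D * (6 * D * E * C ^ 2) ^ D + 3 * D ^ 2 * c₀) ≤
      (1 + 1 / (E : ℝ)) * (∑ q ∈ Nat.primesLE n,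
        ((rootsMod Q q).card * (rootsMod Q q).card - (rootsMod Q q).card : ℝ) *
          (Real.log q / q) + D * Real.log B) := by
  obtain ⟨k, hk, hktop⟩ := exists_primitive_combination hgen
  have haK : aeval (a : K) Q = 0 := by
    rw [aeval_algebraMap_apply, ha, map_zero]
  have haK' : aeval (a' : K) Q = 0 := by
    rw [aeval_algebraMap_apply, ha', map_zero]
  set D := Module.finrank ℚ K with hD
  have hD1 : 1 ≤ D := Module.finrank_pos
  have hDm : D ≤ Q.natDegree ^ 2 := finrank_le_natDegree_sq hQ haK haK' hgen
  set θ : 𝓞 K := a + (k : ℤ) * a' with hθdef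
  have hθK : (θ : K) = a + k * a' := by
    have h : algebraMap (𝓞 K) K θ = algebraMap (𝓞 K) K a +
        algebraMap (𝓞 K) K (k : ℤ) * algebraMap (𝓞 K) K a' := by
      rw [hθdef, map_add, map_mul]
    rw [map_intCast, Int.cast_natCast] at h
    exact h
  have hint : IsIntegral ℚ (θ : K) := Algebra.IsIntegral.isIntegral _
  have htop : Algebra.adjoin ℚ {(θ : K)} = ⊤ := by
    rw [← adjoin_simple_eq_top_iff_of_isAlgebraic hint.isAlgebraic, hθK]
    exact hktop
  set pb := PowerBasis.ofAdjoinEqTop hint htop with hpb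
  have hθ : (θ : K) = pb.gen := (PowerBasis.ofAdjoinEqTop_gen hint htop).symm
  have hdim : pb.dim = D := pb.finrank.symm
  have hσa : ∀ (σ : K →ₐ[ℚ] ℂ) (x : 𝓞 K), aeval (x : K) Q = 0 → ‖σ x‖ ≤ H := fun σ x hx =>
    hroots _ (aeval_algHom_eq_zero hx σ)
  set H' := H * (1 + Q.natDegree ^ 4) with hH'
  have hH'1 : 1 ≤ H' := Nat.mul_pos hH (by omega)
  have hσ : ∀ σ : K →ₐ[ℚ] ℂ, ‖σ θ‖ ≤ H' := by
    intro σ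
    rw [hθK, map_add, map_mul, map_natCast]
    have h1 := hσa σ a haK
    have h2 := hσa σ a' haK'
    have hk4 : (k : ℝ) ≤ (Q.natDegree : ℝ) ^ 4 := by
      have : k ≤ Q.natDegree ^ 4 :=
        hk.trans ((Nat.pow_le_pow_left hDm 2).trans_eq (by rw [← pow_mul]))
      exact_mod_cast this
    calc ‖σ (a : K) + k * σ (a' : K)‖ ≤ ‖σ (a : K)‖ + ‖(k : ℂ) * σ (a' : K)‖ := norm_add_le _ _
      _ = ‖σ (a : K)‖ + k * ‖σ (a' : K)‖ := by rw [norm_mul, Complex.norm_natCast]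
      _ ≤ H + (Q.natDegree : ℝ) ^ 4 * H := by gcongr
      _ = H' := by rw [hH']; push_cast; ring
  obtain ⟨Δ, hΔ0, hΔle, hΔ⟩ := exists_discr_bound hθ hH'1 hσ
  have htrans := sum_normCount_le ha ha' haa hθdef hΔ0 hΔ (Nat.primesLE n)
    fun q hq => (Nat.mem_primesLE.1 hq).2
  rw [← hD] at htrans
  obtain ⟨Z, hZ1, hZ, hZlog⟩ := exists_pow_le hn hD1
  have key := le_sum_normCount hθ (C := structConst pb.dim H') (E := E) (Z := Z)
    (one_le_structConst (by omega)) hE hZ1 (abs_repr_mul_le_structConst hθ hH'1 hσ)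
    (absNorm_intComb_le_structConst hθ hH'1 hσ) hc₀
  rw [hdim] at key hΔle
  refine ⟨D, H', structConst D H', Δ * Ideal.absNorm (Ideal.span {a - a'}), hD1, hDm, rfl, rfl,
    Nat.mul_le_mul hΔle ?_, ?_⟩
  · have h1 : (Ideal.absNorm (Ideal.span {a - a'}) : ℝ) ≤ ((2 * H) ^ D : ℕ) := by
      rw [absNorm_span_eq_prod]
      push_cast
      rw [← hdim, ← prod_const_embeddings pb]
      refine Finset.prod_le_prod (fun _ _ => norm_nonneg _) fun σ _ => ?_
      rw [map_sub]
      have h1 := hσa σ a haK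
      have h2 := hσa σ a' haK'
      linarith [norm_sub_le (σ (a : K)) (σ (a' : K))]
    exact_mod_cast h1
  · have hE1 : (1 : ℝ) ≤ E := by exact_mod_cast hE
    have hE' : 0 ≤ 1 - 1 / (E : ℝ) := by
      rw [sub_nonneg, div_le_one (by linarith)]
      exact hE1
    have hmono : ∑ q ∈ Nat.primesLE (Z ^ D), (normCount K q : ℝ) * (Real.log q / q) ≤
        ∑ q ∈ Nat.primesLE n, (normCount K q : ℝ) * (Real.log q / q) := by
      refine Finset.sum_le_sum_of_subset_of_nonneg (fun q hq => ?_) fun q _ _ => ?_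
      · rw [Nat.mem_primesLE] at hq ⊢
        exact ⟨hq.1.trans hZ, hq.2⟩
      · have := Real.log_natCast_nonneg q
        positivity
    have h1 := mul_le_mul_of_nonneg_left hZlog hE'
    have h2 := mul_le_mul_of_nonneg_left (hmono.trans htrans)
      (by positivity : 0 ≤ 1 + 1 / (E : ℝ))
    linarith

end Pair

section Pair

open NumberField IntermediateField

lemma exists_ne_roots {Q : ℤ[X]} (hQ : Q.Monic)
    (hirr : Irreducible (Q.map (Int.castRingHom ℚ))) (hm2 : 2 ≤ Q.natDegree) :
    ∃ α α' : ℂ, aeval α Q = 0 ∧ aeval α' Q = 0 ∧ α ≠ α' := by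
  have hcard := card_rootSet_eq_natDegree (K := ℂ) hirr.separable (IsAlgClosed.splits _)
  rw [hQ.natDegree_map] at hcard
  obtain ⟨⟨α, hα⟩, ⟨α', hα'⟩, hne⟩ := Fintype.one_lt_card_iff.1 (by omega :
    1 < Fintype.card ((Q.map (Int.castRingHom ℚ)).rootSet ℂ))
  refine ⟨α, α', ?_, ?_, fun h => hne (Subtype.ext h)⟩
  · rw [← aeval_map_intCast]; exact (mem_rootSet.1 hα).2
  · rw [← aeval_map_intCast]; exact (mem_rootSet.1 hα').2

lemma le_sum_rootsMod_pairs {Q : ℤ[X]} (hQ : Q.Monic)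
    (hirr : Irreducible (Q.map (Int.castRingHom ℚ))) (hm2 : 2 ≤ Q.natDegree)
    {H E n : ℕ} (hH : 1 ≤ H)
    (hroots : ∀ z : ℂ, aeval z Q = 0 → ‖z‖ ≤ H) (hE : 1 ≤ E) (hn : 1 ≤ n)
    {c₀ : ℝ} (hc₀ : ∀ s : Finset ℕ, ∑ k ∈ s, Real.log k / k ^ 2 ≤ c₀) :
    ∃ D H' C B : ℕ, 1 ≤ D ∧ D ≤ Q.natDegree ^ 2 ∧ H' = H * (1 + Q.natDegree ^ 4) ∧
      C = structConst D H' ∧ B ≤ (2 * H') ^ (2 * D ^ 2) * (2 * H) ^ D ∧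
      (1 - 1 / (E : ℝ)) * (Real.log n - D * Real.log 2) -
        (2 * C) ^ D * (2 * D * (6 * D * E * C ^ 2) ^ D + 3 * D ^ 2 * c₀) ≤
      (1 + 1 / (E : ℝ)) * (∑ q ∈ Nat.primesLE n,
        ((rootsMod Q q).card * (rootsMod Q q).card - (rootsMod Q q).card : ℝ) *
          (Real.log q / q) + D * Real.log B) := by
  obtain ⟨α, α', hα, hα', hne⟩ := exists_ne_roots hQ hirr hm2
  have hint : ∀ x : ℂ, aeval x Q = 0 → IsIntegral ℤ x := fun x hx => ⟨Q, hQ, hx⟩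
  set S : Set ℂ := {α, α'} with hS
  have : FiniteDimensional ℚ (adjoin ℚ S) := by
    refine finiteDimensional_adjoin fun x hx => ?_
    rcases hx with rfl | hx
    · exact (hint _ hα).tower_top
    · rw [Set.mem_singleton_iff.1 hx]
      exact (hint _ hα').tower_top
  have : NumberField (adjoin ℚ S) := ⟨⟩
  have hlift : ∀ x : adjoin ℚ S, aeval (x : ℂ) Q = 0 → aeval x Q = 0 := by
    intro x hx
    have h : aeval (algebraMap (adjoin ℚ S) ℂ x) Q = 0 := hx
    rw [aeval_algebraMap_apply] at h
    exact (map_eq_zero _).1 h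
  let x : adjoin ℚ S := ⟨α, subset_adjoin ℚ S (Set.mem_insert _ _)⟩
  let x' : adjoin ℚ S := ⟨α', subset_adjoin ℚ S (Set.mem_insert_of_mem _ rfl)⟩
  have hx : aeval x Q = 0 := hlift x hα
  have hx' : aeval x' Q = 0 := hlift x' hα'
  let a : 𝓞 (adjoin ℚ S) := ⟨x, ⟨Q, hQ, hx⟩⟩
  let a' : 𝓞 (adjoin ℚ S) := ⟨x', ⟨Q, hQ, hx'⟩⟩
  have hO : ∀ y : 𝓞 (adjoin ℚ S), aeval (y : adjoin ℚ S) Q = 0 → aeval y Q = 0 := by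
    intro y hy
    rw [aeval_algebraMap_apply] at hy
    exact (map_eq_zero_iff _ RingOfIntegers.coe_injective).1 hy
  refine le_sum_rootsMod_pairs_of_field (a := a) (a' := a') hQ (hO a hx) (hO a' hx') ?_ ?_ hH
    hroots hE hn hc₀
  · intro h
    have h1 : x = x' := congrArg (algebraMap (𝓞 (adjoin ℚ S)) (adjoin ℚ S)) h
    exact hne (congrArg Subtype.val h1)
  · intro φ ψ h h'
    refine algHom_ext_of_eq_adjoin ℚ (s := S) rfl fun y hy => ?_
    rcases hy with rfl | hy
    · exact h
    · have hy' : y = α' := hy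
      subst hy'
      exact h'

end Pair

section Constants

variable {N a b i j d : ℕ}

lemma mul_le_pow_add (ha : a ≤ N ^ i) (hb : b ≤ N ^ j) : a * b ≤ N ^ (i + j) := by
  rw [pow_add]; exact Nat.mul_le_mul ha hb

lemma pow_le_pow_mul_of_le (hN : 1 ≤ N) (ha : a ≤ N ^ i) (hd : d ≤ j) : a ^ d ≤ N ^ (i * j) :=
  (Nat.pow_le_pow_left ha d).trans (by
    rw [← pow_mul]; exact Nat.pow_le_pow_right hN (Nat.mul_le_mul_left i hd))

lemma add_le_pow_succ (hN : 2 ≤ N) (ha : a ≤ N ^ i) (hb : b ≤ N ^ i) : a + b ≤ N ^ (i + 1) := by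
  rw [pow_succ]; nlinarith [Nat.zero_le (N ^ i)]

lemma structConst_le_pow {D H : ℕ} (hN : 8 ≤ N) (hD : D ≤ N ^ 2) (hH : H ≤ N ^ 6) :
    structConst D H ≤ N ^ N ^ 5 := by
  have hN1 : 1 ≤ N := by omega
  have h2 : 2 ≤ N ^ 1 := by rw [pow_one]; omega
  have h1 : (2 * H) ^ D ≤ N ^ ((1 + 6) * N ^ 2) :=
    pow_le_pow_mul_of_le hN1 (mul_le_pow_add h2 hH) hD
  have h3 : (2 * H) ^ D + 1 ≤ N ^ ((1 + 6) * N ^ 2 + 1) :=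
    add_le_pow_succ (by omega) h1 (Nat.one_le_pow _ _ hN1)
  refine (mul_le_pow_add hD (pow_le_pow_mul_of_le hN1 (mul_le_pow_add hD h3) hD)).trans
    (Nat.pow_le_pow_right hN1 ?_)
  have h4 : 8 * N ^ 4 ≤ N ^ 5 := by
    rw [pow_succ N 4, mul_comm]; exact Nat.mul_le_mul_left _ hN
  have h5 : 64 * N ^ 2 ≤ N ^ 4 := by
    rw [pow_add N 2 2]; exact Nat.mul_le_mul_right _ (by nlinarith)
  have h6 : 64 ≤ N ^ 2 := by nlinarith
  have h7 : N ^ 2 * N ^ 2 = N ^ 4 := by ring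
  nlinarith

lemma lowerConst_le_pow {D C E : ℕ} (hN : 8 ≤ N) (hD : D ≤ N ^ 2) (hC : C ≤ N ^ N ^ 5)
    (hE : E ≤ N ^ 3) :
    (2 * C) ^ D * (2 * D * (6 * D * E * C ^ 2) ^ D + 3 * D ^ 2 * N) ≤ N ^ N ^ 10 := by
  have hN1 : 1 ≤ N := by omega
  have h2 : 2 ≤ N ^ 1 := by rw [pow_one]; omega
  have h3 : 3 ≤ N ^ 1 := by rw [pow_one]; omega
  have h6 : 6 ≤ N ^ 1 := by rw [pow_one]; omega
  have e1 : (2 * C) ^ D ≤ N ^ ((1 + N ^ 5) * N ^ 2) :=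
    pow_le_pow_mul_of_le hN1 (mul_le_pow_add h2 hC) hD
  have e2 : 2 * D * (6 * D * E * C ^ 2) ^ D ≤ N ^ (1 + 2 + (1 + 2 + 3 + N ^ 5 * 2) * N ^ 2) :=
    mul_le_pow_add (mul_le_pow_add h2 hD) (pow_le_pow_mul_of_le hN1 (mul_le_pow_add
      (mul_le_pow_add (mul_le_pow_add h6 hD) hE) (pow_le_pow_mul_of_le hN1 hC le_rfl)) hD)
  have e3 : 3 * D ^ 2 * N ≤ N ^ (1 + 2 + (1 + 2 + 3 + N ^ 5 * 2) * N ^ 2) := by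
    refine (mul_le_pow_add (mul_le_pow_add h3 (pow_le_pow_mul_of_le hN1 hD le_rfl))
      (pow_one N).ge).trans (Nat.pow_le_pow_right hN1 ?_)
    nlinarith [Nat.zero_le (N ^ 5 * 2 * N ^ 2)]
  refine (mul_le_pow_add e1 (add_le_pow_succ (by omega) e2 e3)).trans
    (Nat.pow_le_pow_right hN1 ?_)
  have h7 : N ^ 5 * N ^ 2 = N ^ 7 := by ring
  have h8 : 8 * N ^ 7 ≤ N ^ 8 := by
    rw [pow_succ N 7, mul_comm]; exact Nat.mul_le_mul_left _ hN
  have h9 : N ^ 8 ≤ N ^ 10 := Nat.pow_le_pow_right hN1 (by omega)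
  have h10 : N ^ 2 * 64 ≤ N ^ 7 := by
    rw [← h7, mul_comm]
    exact Nat.mul_le_mul_right _ (le_trans (by norm_num) (Nat.pow_le_pow_left hN 5))
  have h11 : 64 ≤ N ^ 2 := by nlinarith
  nlinarith

lemma upperConst_le_pow {m C E : ℕ} (hN : 8 ≤ N) (hm : m ≤ N) (hC : C ≤ N ^ N ^ 5)
    (hE : E ≤ N ^ 3) : m * (2 * m * E * C ^ 2 + 3) ≤ N ^ N ^ 10 := by
  have hN1 : 1 ≤ N := by omega
  have h2 : 2 ≤ N ^ 1 := by rw [pow_one]; omega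
  have h3 : 3 ≤ N ^ 1 := by rw [pow_one]; omega
  have hm1 : m ≤ N ^ 1 := by rw [pow_one]; omega
  have e1 : 2 * m * E * C ^ 2 ≤ N ^ (1 + 1 + 3 + N ^ 5 * 2) :=
    mul_le_pow_add (mul_le_pow_add (mul_le_pow_add h2 hm1) hE)
      (pow_le_pow_mul_of_le hN1 hC le_rfl)
  refine (mul_le_pow_add hm1 (add_le_pow_succ (by omega) e1
    (h3.trans (Nat.pow_le_pow_right hN1 (by omega))))).trans (Nat.pow_le_pow_right hN1 ?_)
  have h5 : 8 ≤ N ^ 5 := le_trans (by norm_num) (Nat.pow_le_pow_left hN 5)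
  have h6 : N ^ 5 * N ^ 5 = N ^ 10 := by ring
  nlinarith

lemma discrConst_le_pow {D H H' B : ℕ} (hN : 8 ≤ N) (hD : D ≤ N ^ 2) (hH : H ≤ N)
    (hH' : H' ≤ N ^ 6) (hB : B ≤ (2 * H') ^ (2 * D ^ 2) * (2 * H) ^ D) :
    D * B ≤ N ^ N ^ 10 := by
  have hN1 : 1 ≤ N := by omega
  have h2 : 2 ≤ N ^ 1 := by rw [pow_one]; omega
  have hH1 : H ≤ N ^ 1 := by rw [pow_one]; omega
  have e0 : 2 * D ^ 2 ≤ N ^ (1 + 2 * 2) :=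
    mul_le_pow_add h2 (pow_le_pow_mul_of_le hN1 hD le_rfl)
  have e1 := hB.trans (mul_le_pow_add
    (pow_le_pow_mul_of_le hN1 (mul_le_pow_add h2 hH') e0)
    (pow_le_pow_mul_of_le hN1 (mul_le_pow_add h2 hH1) hD))
  refine (mul_le_pow_add hD e1).trans (Nat.pow_le_pow_right hN1 ?_)
  have h3 : N ^ 2 ≤ N ^ 5 := Nat.pow_le_pow_right hN1 (by omega)
  have h5 : 64 ≤ N ^ 5 := le_trans (by norm_num) (Nat.pow_le_pow_left hN 5)
  have h6 : N ^ 5 * N ^ 5 = N ^ 10 := by ring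
  norm_num
  nlinarith

/-- Comparing linear and quadratic averages of root counts forces `W` to be bounded. -/
lemma le_of_average_inequalities {W G R₁ R₂ S S₀ m η : ℝ} (hm : 1 ≤ m) (hη : 0 < η)
    (hηm : 8 * (m + 1) ^ 2 * η ≤ 1) (hW : 0 ≤ W) (hG : 0 ≤ G) (hR₁ : (1 - η) * R₁ ≤ W + G)
    (hR₂ : (1 - η) * W - 2 * G ≤ (1 + η) * (R₂ + G)) (hS : W - G ≤ S)
    (hS₀ : S₀ ≤ W / (m + 1) + G) (hR : R₂ ≤ m * R₁ - m * S + m * S₀) :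
    W ≤ 100 * (m + 1) ^ 2 * G := by
  have hη1 : η ≤ 1 / 8 := by nlinarith
  have h1 : R₁ ≤ (1 + 2 * η) * (W + G) := by
    have h2 : (1 + 2 * η) * ((1 - η) * R₁) ≤ (1 + 2 * η) * (W + G) :=
      mul_le_mul_of_nonneg_left hR₁ (by linarith)
    by_cases hR0 : 0 ≤ R₁
    · nlinarith [mul_nonneg (mul_nonneg hη.le (by linarith : 0 ≤ 1 - 2 * η)) hR0]
    · push Not at hR0
      have : 0 ≤ (1 + 2 * η) * (W + G) := by positivity
      linarith
  have h2 : R₂ ≤ m * ((1 + 2 * η) * (W + G)) - m * (W - G) + m * (W / (m + 1) + G) := by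
    have a1 := mul_le_mul_of_nonneg_left h1 (by linarith : 0 ≤ m)
    have a2 := mul_le_mul_of_nonneg_left hS (by linarith : 0 ≤ m)
    have a3 := mul_le_mul_of_nonneg_left hS₀ (by linarith : 0 ≤ m)
    linarith
  set V := W / (m + 1) with hV
  have hVW : W = V * (m + 1) := by rw [hV]; field_simp
  have hV0 : 0 ≤ V := by positivity
  have h3 := hR₂.trans (mul_le_mul_of_nonneg_left (by linarith [h2] :
    R₂ + G ≤ (2 * m * η * W + m * V) + (5 * m + 1) * G - m * (1 - 2 * η) * G - m * G)
    (by linarith : 0 ≤ 1 + η))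
  have h4 : (1 + η) * ((2 * m * η * W + m * V) + (5 * m + 1) * G - m * (1 - 2 * η) * G - m * G) ≤
      (1 + η) * (2 * m * η * W + m * V) + 2 * ((5 * m + 1) * G) := by
    have : 0 ≤ m * (1 - 2 * η) * G := mul_nonneg (mul_nonneg (by linarith) (by linarith)) hG
    have : 0 ≤ m * G := by positivity
    have : 0 ≤ (5 * m + 1) * G := by positivity
    nlinarith
  have h5 : (1 - η) * W - (1 + η) * (2 * m * η * W + m * V) ≤ (10 * m + 4) * G := by linarith
  have h6 : V / 2 ≤ (1 - η) * W - (1 + η) * (2 * m * η * W + m * V) := by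
    rw [hVW]
    have e : (1 - η) * (V * (m + 1)) - (1 + η) * (2 * m * η * (V * (m + 1)) + m * V) =
      V * (1 - η * ((2 * m + 1) + 2 * m * (m + 1) * (1 + η))) := by ring
    rw [e]
    have : η * ((2 * m + 1) + 2 * m * (m + 1) * (1 + η)) ≤ 1 / 2 := by
      have : (2 * m + 1) + 2 * m * (m + 1) * (1 + η) ≤ 4 * (m + 1) ^ 2 := by nlinarith
      have := mul_le_mul_of_nonneg_left this hη.le
      linarith
    nlinarith
  have h7 : V ≤ 2 * ((10 * m + 4) * G) := by linarith
  rw [hVW]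
  nlinarith [mul_le_mul_of_nonneg_right h7 (by linarith : 0 ≤ m + 1), mul_nonneg (by linarith : 0 ≤ m) hG, mul_nonneg (by positivity : 0 ≤ m^2) hG]

end Constants

section Core

lemma sum_rootsMod_pairs_le {Q : ℤ[X]} (hQ : Q.Monic) {m : ℕ} (hm : Q.natDegree = m)
    (s : Finset ℕ) (hs : ∀ q ∈ s, q.Prime) :
    ∑ q ∈ s, ((rootsMod Q q).card * (rootsMod Q q).card - (rootsMod Q q).card : ℝ) *
        (Real.log q / q) ≤
      m * ∑ q ∈ s, ((rootsMod Q q).card : ℝ) * (Real.log q / q) -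
        m * ∑ q ∈ s, Real.log q / q +
        m * ∑ q ∈ s with (rootsMod Q q).card = 0, Real.log q / q := by
  rw [Finset.sum_filter, Finset.mul_sum, Finset.mul_sum, Finset.mul_sum,
    ← Finset.sum_sub_distrib, ← Finset.sum_add_distrib]
  refine Finset.sum_le_sum fun q hq => ?_
  have hle := card_rootsMod_le hQ (hs q hq)
  rw [hm] at hle
  have hw : 0 ≤ Real.log q / q := div_nonneg (Real.log_natCast_nonneg q) (Nat.cast_nonneg q)
  set w := Real.log q / q
  split_ifs with h
  · rw [h]; simp
  · have h1 : (1 : ℝ) ≤ (rootsMod Q q).card := by exact_mod_cast Nat.one_le_iff_ne_zero.2 h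
    have h2 : ((rootsMod Q q).card : ℝ) ≤ m := by exact_mod_cast hle
    nlinarith [mul_nonneg (mul_nonneg (sub_nonneg.2 h1) (sub_nonneg.2 h2)) hw]

/-- If the primes modulo which an irreducible polynomial has no root carry little mass up to `n`,
then `n` is bounded in terms of the degree and the size of the roots. -/
lemma exists_log_le_of_sum_rootless_le : ∃ N₀ : ℕ, ∀ N ≥ N₀, ∀ Q : ℤ[X], Q.Monic →
    Irreducible (Q.map (Int.castRingHom ℚ)) → 2 ≤ Q.natDegree → Q.natDegree + 1 ≤ N →
    (∀ z : ℂ, aeval z Q = 0 → ‖z‖ ≤ N) → ∀ n : ℕ, 1 ≤ n →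
    ∑ q ∈ Nat.primesLE n with (rootsMod Q q).card = 0, Real.log q / q ≤
      Real.log n / (Q.natDegree + 1) + N →
    Real.log n ≤ (N : ℝ) ^ N ^ 11 := by
  obtain ⟨c₀, hc₀0, hc₀⟩ := exists_sum_log_div_sq_le
  obtain ⟨c₁, hc₁0, hc₁⟩ := exists_log_sub_le_sum_primesLE
  refine ⟨8 + ⌈c₀⌉₊ + ⌈c₁⌉₊, fun N hN Q hQ hirr hm2 hmN hroots n hn hS₀ => ?_⟩
  have hN8 : 8 ≤ N := by omega
  have hN1 : 1 ≤ N := by omega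
  have hc₀N : c₀ ≤ N := (Nat.le_ceil c₀).trans (by exact_mod_cast (by omega : ⌈c₀⌉₊ ≤ N))
  have hc₁N : c₁ ≤ N := (Nat.le_ceil c₁).trans (by exact_mod_cast (by omega : ⌈c₁⌉₊ ≤ N))
  generalize hm : Q.natDegree = m at *
  set E := 8 * N ^ 2 with hE
  have hEN : E ≤ N ^ 3 := by rw [hE, pow_succ N 2, mul_comm]; exact Nat.mul_le_mul_left _ hN8
  have hE1 : 1 ≤ E := Nat.mul_pos (by norm_num) (pow_pos hN1 2)
  set G : ℝ := (N : ℝ) ^ N ^ 10 with hG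
  have hNG : (N : ℝ) ≤ G := le_self_pow₀ (by exact_mod_cast hN1) (pow_pos hN1 10).ne'
  have hG0 : 0 ≤ G := by positivity
  have hlog2 : Real.log 2 ≤ 1 := by linarith [Real.log_two_lt_d9]
  have hlog2' : 0 ≤ Real.log 2 := (Real.log_pos one_lt_two).le
  have hEr : (1 : ℝ) ≤ E := by exact_mod_cast hE1
  have hη1 : 0 ≤ 1 - 1 / (E : ℝ) := by rw [sub_nonneg, div_le_one (by linarith)]; exact hEr
  have hη0 : 0 < 1 / (E : ℝ) := by positivity
  have hmr : (2 : ℝ) ≤ m := by exact_mod_cast hm2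
  have hmNr : (m + 1 : ℝ) ≤ N := by exact_mod_cast hmN
  have hfinal : Real.log n ≤ 100 * ((m : ℝ) + 1) ^ 2 * G := by
    refine le_of_average_inequalities (by linarith) hη0 ?_ (Real.log_natCast_nonneg n) hG0
      ?_ ?_ ((sub_le_sub_left (hc₁N.trans hNG) _).trans (hc₁ n hn))
      (hS₀.trans (by linarith)) (sum_rootsMod_pairs_le hQ hm _ fun q hq =>
        (Nat.mem_primesLE.1 hq).2)
    · rw [mul_one_div, div_le_one (by positivity), hE]
      push_cast
      gcongr
    · have h := sum_card_rootsMod_le_log hQ hirr hm (by omega) hN1 hroots hE1 hn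
      have hC : structConst m N ≤ N ^ N ^ 5 :=
        structConst_le_pow hN8 ((by omega : m ≤ N).trans (Nat.le_self_pow two_ne_zero N))
          (Nat.le_self_pow (by norm_num) N)
      have h1 : ((m * (2 * m * E * structConst m N ^ 2 + 3) : ℕ) : ℝ) ≤ G := by
        rw [hG]; exact_mod_cast upperConst_le_pow hN8 (by omega) hC hEN
      have h2 : Real.log (2 * m * E * structConst m N ^ 2 : ℕ) ≤
          (2 * m * E * structConst m N ^ 2 : ℕ) := Real.log_le_self (Nat.cast_nonneg _)
      rw [Nat.cast_mul, Nat.cast_add, Nat.cast_ofNat] at h1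
      have h3 := mul_le_mul_of_nonneg_left (add_le_add h2 hlog2) (Nat.cast_nonneg (α := ℝ) m)
      linarith
    · obtain ⟨D, H', C, B, hD1, hD, hH', hC, hB, h⟩ :=
        le_sum_rootsMod_pairs hQ hirr (hm.symm ▸ hm2) hN1 hroots hE1 hn hc₀
      rw [hm] at hD hH'
      have hDN : D ≤ N ^ 2 := hD.trans (Nat.pow_le_pow_left (by omega) 2)
      have hHN : H' ≤ N ^ 6 := by
        rw [hH']
        have h1 : m ^ 4 ≤ N ^ 4 := Nat.pow_le_pow_left (by omega) 4
        have h2 : 1 ≤ N ^ 4 := Nat.one_le_pow _ _ hN1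
        calc N * (1 + m ^ 4) ≤ N * (N * N ^ 4) := Nat.mul_le_mul_left _ (by nlinarith)
          _ = N ^ 6 := by ring
      have hCN : C ≤ N ^ N ^ 5 := hC ▸ structConst_le_pow hN8 hDN hHN
      have h1 : (((2 * C) ^ D * (2 * D * (6 * D * E * C ^ 2) ^ D + 3 * D ^ 2 * N) : ℕ) : ℝ) ≤ G := by
        rw [hG]; exact_mod_cast lowerConst_le_pow hN8 hDN hCN hEN
      have h2 : ((D * B : ℕ) : ℝ) ≤ G := by
        rw [hG]; exact_mod_cast discrConst_le_pow hN8 hDN le_rfl hHN hB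
      have h3 : (D : ℝ) * Real.log B ≤ G := by
        refine le_trans ?_ h2
        rw [Nat.cast_mul]
        exact mul_le_mul_of_nonneg_left (Real.log_le_self (Nat.cast_nonneg _)) (Nat.cast_nonneg _)
      have h4 : (2 * (C : ℝ)) ^ D * (2 * D * (6 * D * E * C ^ 2) ^ D + 3 * D ^ 2 * c₀) ≤ G := by
        refine le_trans ?_ h1
        push_cast
        gcongr
      have h5 : (D : ℝ) * Real.log 2 ≤ G := by
        have h6 : (D : ℝ) ≤ (N : ℝ) ^ 2 := by exact_mod_cast hDN
        have h7 : (N : ℝ) ^ 2 ≤ G := by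
          refine pow_le_pow_right₀ (by exact_mod_cast hN1) ?_
          exact (by omega : 2 ≤ N).trans (Nat.le_self_pow (by norm_num) N)
        nlinarith
      have h6 : (1 - 1 / (E : ℝ)) * (D * Real.log 2) ≤ G := by
        have : 0 ≤ (D : ℝ) * Real.log 2 := by positivity
        nlinarith
      have h7 := mul_le_mul_of_nonneg_left (add_le_add_right h3 (∑ q ∈ Nat.primesLE n,
        ((rootsMod Q q).card * (rootsMod Q q).card - (rootsMod Q q).card : ℝ) *
          (Real.log q / q))) (by positivity : 0 ≤ 1 + 1 / (E : ℝ))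
      linarith
  refine hfinal.trans ?_
  have h1 : 100 * N ^ 2 * N ^ N ^ 10 ≤ N ^ N ^ 11 := by
    have h2 : 100 ≤ N ^ 3 := le_trans (by norm_num) (Nat.pow_le_pow_left hN8 3)
    refine (mul_le_pow_add (mul_le_pow_add h2 le_rfl) le_rfl).trans
      (Nat.pow_le_pow_right hN1 ?_)
    have h3 : 8 ≤ N ^ 10 := hN8.trans (Nat.le_self_pow (by norm_num) N)
    rw [pow_succ N 10]
    nlinarith
  have h2 : (100 : ℝ) * (N : ℝ) ^ 2 * (N : ℝ) ^ N ^ 10 ≤ (N : ℝ) ^ N ^ 11 := by exact_mod_cast h1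
  refine le_trans ?_ h2
  rw [hG]
  gcongr

end Core

section Growth

open Filter

lemma exists_pow_pow_lt_log (K : ℕ) : ∃ n₀ : ℕ, 0 < n₀ ∧ ∀ n ≥ n₀, ∀ A : ℕ,
    (A : ℝ) < 0.5 * Real.log (Real.log (Real.log n)) /
      Real.log (Real.log (Real.log (Real.log n))) →
    ((A + K : ℕ) : ℝ) ^ (A + K) ^ 11 < Real.log n := by
  have h1 : Tendsto (fun n : ℕ => Real.log n) atTop atTop :=
    Real.tendsto_log_atTop.comp tendsto_natCast_atTop_atTop
  have h2 := Real.tendsto_log_atTop.comp h1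
  have h3 := Real.tendsto_log_atTop.comp h2
  have h4 := Real.tendsto_log_atTop.comp h3
  have hexp : ∀ᶠ t : ℝ in atTop, t ^ 12 < Real.exp t := by
    have h := (Real.isLittleO_pow_exp_atTop (n := 12)).bound (c := 1 / 2) (by norm_num)
    filter_upwards [h, eventually_ge_atTop 0] with t ht h0
    rw [Real.norm_of_nonneg (by positivity), Real.norm_of_nonneg (Real.exp_pos t).le] at ht
    linarith [Real.exp_pos t]
  obtain ⟨n₀, hn₀⟩ := eventually_atTop.1 <| (h1.eventually_gt_atTop 0).and <|
    (h2.eventually_gt_atTop 0).and <| (h3.eventually_ge_atTop (2 * (K + 1))).and <|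
    (h4.eventually_ge_atTop 1).and (h3.eventually hexp)
  refine ⟨n₀ + 1, Nat.succ_pos _, fun n hn A hA => ?_⟩
  obtain ⟨p1, p2, p3, p4, p5⟩ := hn₀ n (by omega)
  simp only [Function.comp_apply] at p1 p2 p3 p4 p5
  set T := Real.log (Real.log (Real.log n)) with hT
  have hn' : Real.log n = Real.exp (Real.exp T) := by
    rw [hT, Real.exp_log p2, Real.exp_log p1]
  have hT0 : 0 < T := lt_of_lt_of_le (by positivity) p3
  have hAT : (A : ℝ) < T / 2 := by
    refine hA.trans_le ?_
    rw [div_le_iff₀ (by linarith)]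
    nlinarith
  have hx : ((A + K : ℕ) : ℝ) ≤ T := by push_cast; linarith
  set x := A + K with hxdef
  rw [hn']
  rcases Nat.eq_zero_or_pos x with h0 | h0
  · rw [h0]
    simp only [CharP.cast_eq_zero]
    norm_num
    exact Real.exp_pos T
  · have hx0 : (0 : ℝ) < x := by exact_mod_cast h0
    rw [← Real.exp_log (pow_pos hx0 _), Real.log_pow, Real.exp_lt_exp]
    refine lt_of_le_of_lt ?_ p5
    calc ((x ^ 11 : ℕ) : ℝ) * Real.log x ≤ (x : ℝ) ^ 11 * x := by
          push_cast
          exact mul_le_mul_of_nonneg_left (Real.log_le_self hx0.le) (by positivity)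
      _ = (x : ℝ) ^ 12 := by ring
      _ ≤ T ^ 12 := by gcongr

end Growth

section Arithmetic

lemma pow_dvd_factorial_mul {b : ℕ} (hb : 0 < b) (k : ℕ) : b ^ k ∣ (b * k).factorial := by
  induction k with
  | zero => simp
  | succ k ih =>
    have h : (b * (k + 1)).factorial = (b * (k + 1)) * (b * k + (b - 1)).factorial := by
      have : b * (k + 1) = (b * k + (b - 1)) + 1 := by rw [mul_add]; omega
      rw [this, Nat.factorial_succ]
    rw [h, pow_succ, mul_comm]
    exact Nat.mul_dvd_mul (dvd_mul_right _ _) (ih.trans (Nat.factorial_dvd_factorial (by omega)))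

lemma dvd_one_add_of_dvd_geom {p : ℕ} (hp : 1 ≤ p) {a b N : ℤ} (hb : b ∣ N)
    (h : N = (∑ i ∈ Finset.range p, b ^ i) + a) : b ∣ 1 + a := by
  obtain ⟨k, rfl⟩ := Nat.exists_eq_add_of_le' hp
  rw [Finset.sum_range_succ', pow_zero] at h
  have h1 : b ∣ ∑ i ∈ Finset.range k, b ^ (i + 1) :=
    Finset.dvd_sum fun i _ => dvd_pow_self b (Nat.succ_ne_zero i)
  have h2 : 1 + a = N - ∑ i ∈ Finset.range k, b ^ (i + 1) := by linarith
  rw [h2]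
  exact dvd_sub hb h1

lemma prime_le_of_factorial_eq {p n : ℕ} (hp : p.Prime) (hpn : p ≤ n) {a b : ℤ} (ha : a ≠ 0)
    (ha1 : a ≠ -1) (h : (n.factorial : ℤ) = (∑ i ∈ Finset.range p, b ^ i) + a) :
    p ≤ a.natAbs + 1 := by
  have : Fact p.Prime := ⟨hp⟩
  have h0 : (0 : ZMod p) = (∑ i ∈ Finset.range p, (b : ZMod p) ^ i) + a := by
    have h1 := congrArg (Int.cast : ℤ → ZMod p) h
    push_cast at h1
    rwa [(ZMod.natCast_eq_zero_iff _ _).2 (Nat.dvd_factorial hp.pos hpn)] at h1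
  have hgeom := geom_sum_mul (b : ZMod p) p
  rw [ZMod.pow_card] at hgeom
  by_cases hb : (b : ZMod p) = 1
  · rw [hb] at h0
    simp only [one_pow, Finset.sum_const, Finset.card_range, nsmul_eq_mul, mul_one,
      CharP.cast_eq_zero, zero_add] at h0
    have h1 : (p : ℤ) ∣ a := (ZMod.intCast_zmod_eq_zero_iff_dvd _ _).1 h0.symm
    have := Nat.le_of_dvd (Int.natAbs_pos.2 ha) (Int.natCast_dvd.1 h1)
    omega
  · have h1 : ∑ i ∈ Finset.range p, (b : ZMod p) ^ i = 1 :=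
      mul_right_cancel₀ (sub_ne_zero.2 hb) (by rw [hgeom, one_mul])
    rw [h1] at h0
    have h2 : (p : ℤ) ∣ 1 + a :=
      (ZMod.intCast_zmod_eq_zero_iff_dvd _ _).1 (by push_cast; exact h0.symm)
    have := Nat.le_of_dvd (Int.natAbs_pos.2 (by omega)) (Int.natCast_dvd.1 h2)
    omega

lemma pow_le_factorial_add {p n : ℕ} (hp : 1 ≤ p) {a : ℤ} {b : ℕ}
    (h : (n.factorial : ℤ) = (∑ i ∈ Finset.range p, (b : ℤ) ^ i) + a) :
    b ^ (p - 1) ≤ n.factorial + a.natAbs := by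
  have h1 : (b : ℤ) ^ (p - 1) ≤ ∑ i ∈ Finset.range p, (b : ℤ) ^ i :=
    Finset.single_le_sum (f := fun i => (b : ℤ) ^ i) (fun i _ => by positivity)
      (Finset.mem_range.2 (by omega))
  have h2 : (b : ℤ) ^ (p - 1) ≤ n.factorial + a.natAbs := by omega
  exact_mod_cast h2

/-- The exponent cannot exceed `n` when `n` is large in terms of `a`. -/
lemma prime_le_of_large {p n : ℕ} (hp : 1 ≤ p) {a : ℤ} {b : ℕ} (hb : 2 ≤ b)
    (ha1 : a ≠ -1) (hn3 : 3 ≤ n) (hn : (a.natAbs + 1) ^ 3 ≤ n)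
    (h : (n.factorial : ℤ) = (∑ i ∈ Finset.range p, (b : ℤ) ^ i) + a) : p ≤ n := by
  by_contra! hpn
  set A := a.natAbs with hA
  have hAn : A + 1 ≤ n := (Nat.le_self_pow (by norm_num) _).trans hn
  have hbn : b ≤ n := by
    by_contra! hbn
    have h1 : (n + 1) ^ n ≤ b ^ (p - 1) :=
      (Nat.pow_le_pow_left hbn n).trans (Nat.pow_le_pow_right (by omega) (by omega))
    have h2 : n.factorial ≤ n ^ n := Nat.factorial_le_pow n
    have h3 : n ^ n + n ≤ (n + 1) ^ n := by
      have : (n + 1) ^ n = (n + 1) ^ (n - 1) * (n + 1) := by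
        rw [← pow_succ, Nat.sub_add_cancel (by omega)]
      have h4 : n ^ n = n ^ (n - 1) * n := by
        rw [← pow_succ, Nat.sub_add_cancel (by omega)]
      have h5 : n ^ (n - 1) ≤ (n + 1) ^ (n - 1) := Nat.pow_le_pow_left (by omega) _
      have h6 : n + 1 ≤ (n + 1) ^ (n - 1) := Nat.le_self_pow (by omega) _
      nlinarith
    have := pow_le_factorial_add hp h
    omega
  have hb1 : b ≤ A + 1 := by
    have h1 : (b : ℤ) ∣ 1 + a :=
      dvd_one_add_of_dvd_geom hp (Int.natCast_dvd_natCast.2 (Nat.dvd_factorial (by omega) hbn)) h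
    have := Nat.le_of_dvd (Int.natAbs_pos.2 (by omega)) (Int.natCast_dvd.1 h1)
    omega
  have hgeom := geom_sum_mul (b : ℤ) p
  have hkey : (b : ℤ) ^ p + (a * (b - 1) - 1) = n.factorial * (b - 1) := by
    rw [h]; linear_combination -hgeom
  set k := n / b with hk
  have hkn : b * k ≤ n := Nat.mul_div_le n b
  have hkp : k ≤ p := (Nat.div_le_self n b).trans hpn.le
  have hdvd : ((b ^ k : ℕ) : ℤ) ∣ a * (b - 1) - 1 := by
    have h1 : ((b ^ k : ℕ) : ℤ) ∣ n.factorial * (b - 1) :=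
      (Int.natCast_dvd_natCast.2 ((pow_dvd_factorial_mul (by omega) k).trans
        (Nat.factorial_dvd_factorial hkn))).mul_right _
    have h2 : ((b ^ k : ℕ) : ℤ) ∣ (b : ℤ) ^ p := by push_cast; exact pow_dvd_pow _ hkp
    rw [← hkey] at h1
    exact (dvd_add_right h2).1 h1
  by_cases hzero : a * ((b : ℤ) - 1) - 1 = 0
  · have h1 : (b : ℤ) - 1 ∣ 1 := ⟨a, by linarith⟩
    have h2 := Int.le_of_dvd one_pos h1
    have hb2 : b = 2 := by omega
    rw [hzero, hb2] at hkey
    have h3 : n.factorial = 2 ^ p := by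
      have : (n.factorial : ℤ) = 2 ^ p := by push_cast at hkey; linarith
      exact_mod_cast this
    have h4 : 3 ∣ 2 ^ p := h3 ▸ Nat.dvd_factorial (by norm_num) hn3
    have := Nat.le_of_dvd (by norm_num) (Nat.prime_three.dvd_of_dvd_pow h4)
    omega
  · have h1 := Nat.le_of_dvd (Int.natAbs_pos.2 hzero) (Int.natCast_dvd.1 hdvd)
    have h2 : (a * ((b : ℤ) - 1) - 1).natAbs ≤ A * A + 1 := by
      have e1 := Int.natAbs_sub_le (a * ((b : ℤ) - 1)) 1
      rw [Int.natAbs_mul] at e1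
      have e2 : ((b : ℤ) - 1).natAbs ≤ A := by omega
      have e3 := Nat.mul_le_mul_left a.natAbs e2
      rw [← hA] at e1 e3
      simp only [Int.natAbs_one] at e1
      omega
    have h3 : (A + 1) ^ 2 ≤ k := by
      rw [hk, Nat.le_div_iff_mul_le (by omega)]
      exact (Nat.mul_le_mul_left _ hb1).trans hn
    have h4 : k < b ^ k := Nat.lt_pow_self (by omega)
    nlinarith

end Arithmetic

section Factor

lemma monic_cyclotomic_add_C {p : ℕ} (hp : p.Prime) (a : ℤ) :
    (cyclotomic p ℤ + C a).Monic ∧ (cyclotomic p ℤ + C a).natDegree = p - 1 := by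
  have hdeg : (cyclotomic p ℤ).natDegree = p - 1 := by
    rw [natDegree_cyclotomic, Nat.totient_prime hp]
  have hlt : (C a).degree < (cyclotomic p ℤ).degree := by
    rw [degree_eq_natDegree (cyclotomic.monic p ℤ).ne_zero, hdeg]
    refine degree_C_le.trans_lt ?_
    have := hp.two_le
    exact_mod_cast (by omega : 0 < p - 1)
  refine ⟨(cyclotomic.monic p ℤ).add_of_left hlt, ?_⟩
  rw [natDegree_add_eq_left_of_degree_lt hlt, hdeg]

lemma exists_monic_factor {p : ℕ} (hp : p.Prime) {a : ℤ}
    (h : Irreducible ((cyclotomic p ℚ) + C (a : ℚ)) ∨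
      ∃ L Q : ℤ[X], L.degree = 1 ∧ Irreducible (Q.map (Int.castRingHom ℚ)) ∧
        (cyclotomic p ℤ) + C a = L * Q) :
    ∃ L Q : ℤ[X], cyclotomic p ℤ + C a = L * Q ∧ Q.Monic ∧
      Irreducible (Q.map (Int.castRingHom ℚ)) ∧
      ((L = 1 ∧ Q.natDegree + 1 = p) ∨ ∃ r, L = X - C r ∧ Q.natDegree + 2 = p) := by
  obtain ⟨hmonic, hdeg⟩ := monic_cyclotomic_add_C hp a
  have hp2 := hp.two_le
  rcases h with h | ⟨L, Q, hL, hQ, hLQ⟩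
  · refine ⟨1, _, (one_mul _).symm, hmonic, ?_, Or.inl ⟨rfl, by omega⟩⟩
    rwa [Polynomial.map_add, map_cyclotomic, map_C]
  · have hlc : L.leadingCoeff * Q.leadingCoeff = 1 := by
      rw [← leadingCoeff_mul, ← hLQ, hmonic]
    set u := L.leadingCoeff with hu
    have huu : u * u = 1 := by
      rcases Int.isUnit_iff.1 (IsUnit.of_mul_eq_one _ hlc) with h | h <;> rw [h] <;> norm_num
    have hCu : (C u * C u : ℤ[X]) = 1 := by rw [← C_mul, huu, C_1]
    have hQu : Q.leadingCoeff = u := by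
      calc Q.leadingCoeff = u * u * Q.leadingCoeff := by rw [huu, one_mul]
        _ = u := by rw [mul_assoc, hlc, mul_one]
    have hL0 : L ≠ 0 := by rintro rfl; simp at hL
    have hunit : IsUnit (C (u : ℚ)) := by
      refine isUnit_C.2 (IsUnit.of_mul_eq_one (u : ℚ) ?_)
      exact_mod_cast huu
    have hu0 : u ≠ 0 := by rintro h0; rw [h0] at huu; norm_num at huu
    have hQ0 : Q ≠ 0 := by rintro rfl; simp at hQ
    have hLdeg : L.natDegree = 1 := natDegree_eq_of_degree_eq_some hL
    have hsum : L.natDegree + Q.natDegree = p - 1 := by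
      rw [← natDegree_mul hL0 hQ0, ← hLQ, hdeg]
    refine ⟨C u * L, C u * Q, ?_, ?_, ?_, Or.inr ⟨-(u * L.coeff 0), ?_, ?_⟩⟩
    · rw [hLQ]; linear_combination -(L * Q) * hCu
    · rw [Monic, leadingCoeff_mul, leadingCoeff_C, hQu, huu]
    · rw [Polynomial.map_mul, map_C]
      exact (irreducible_isUnit_mul hunit).2 hQ
    · have h1 : L = C u * X + C (L.coeff 0) := by
        have := eq_X_add_C_of_natDegree_le_one hLdeg.le
        rwa [show L.coeff 1 = u by rw [hu, leadingCoeff, hLdeg]] at this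
      conv_lhs => rw [h1]
      rw [C_neg, C_mul, sub_neg_eq_add]
      linear_combination X * hCu
    · rw [natDegree_C_mul hu0]
      have := hp.two_le
      omega

lemma eval_ne_zero_of_irreducible_map {Q : ℤ[X]} (hQ : Q.Monic)
    (hirr : Irreducible (Q.map (Int.castRingHom ℚ))) (hm : 2 ≤ Q.natDegree) (x : ℤ) :
    Q.eval x ≠ 0 := by
  intro h
  have hroot : IsRoot (Q.map (Int.castRingHom ℚ)) (x : ℚ) := by
    rw [IsRoot, eval_intCast_map, Int.cast_id, h, map_zero]
  have h1 := natDegree_eq_of_degree_eq_some (degree_eq_one_of_irreducible_of_root hirr hroot)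
  rw [hQ.natDegree_map] at h1
  exact absurd (hm.trans_eq h1) (by decide)

lemma eval_cyclotomic_add_C {p : ℕ} (hp : p.Prime) (a x : ℤ) :
    (cyclotomic p ℤ + C a).eval x = (∑ i ∈ Finset.range p, x ^ i) + a := by
  have : Fact p.Prime := ⟨hp⟩
  rw [cyclotomic_prime, eval_add, eval_C, eval_finsetSum]
  simp

lemma norm_root_le {p : ℕ} (hp : p.Prime) {a : ℤ} {z : ℂ}
    (hz : aeval z (cyclotomic p ℤ + C a) = 0) : ‖z‖ ≤ a.natAbs + 2 := by
  have : Fact p.Prime := ⟨hp⟩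
  have h1 : (∑ i ∈ Finset.range p, z ^ i) + a = 0 := by
    rw [← hz, cyclotomic_prime]; simp
  have h2 : z ^ p = 1 - a * (z - 1) := by
    linear_combination (z - 1) * h1 - geom_sum_mul z p
  by_contra! hlt
  set t := ‖z‖ with ht
  set A : ℝ := (a.natAbs : ℝ) with hA
  have hA0 : 0 ≤ A := Nat.cast_nonneg _
  have haA : ‖(a : ℂ)‖ = A := by
    rw [Complex.norm_intCast, hA, Nat.cast_natAbs, Int.cast_abs]
  have h3 : t ^ p ≤ 1 + A * (t + 1) := by
    rw [ht, ← norm_pow, h2, ← haA]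
    calc ‖1 - (a : ℂ) * (z - 1)‖ ≤ ‖(1 : ℂ)‖ + ‖(a : ℂ) * (z - 1)‖ := norm_sub_le _ _
      _ = 1 + ‖(a : ℂ)‖ * ‖z - 1‖ := by rw [norm_one, norm_mul]
      _ ≤ 1 + ‖(a : ℂ)‖ * (‖z‖ + 1) := by
        have := norm_sub_le z 1
        rw [norm_one] at this
        gcongr
  have h4 : t ^ 2 ≤ t ^ p := pow_le_pow_right₀ (by linarith) hp.two_le
  nlinarith

end Factor

section Main

lemma ne_neg_one_of_factor {p : ℕ} (hp : p.Prime) {a : ℤ} {L Q : ℤ[X]}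
    (hLQ : cyclotomic p ℤ + C a = L * Q) (hQ0 : ∀ x : ℤ, Q.eval x ≠ 0) (hp3 : 3 ≤ p)
    (hL : L = 1 ∨ ∃ r, L = X - C r) : a ≠ -1 := by
  rintro rfl
  have hL0 : ∀ x : ℤ, (∑ i ∈ Finset.range p, x ^ i) = 1 → L.eval x = 0 := by
    intro x hx
    have h := congrArg (Polynomial.eval x) hLQ
    rw [eval_cyclotomic_add_C hp, hx, eval_mul] at h
    exact (mul_eq_zero.1 (by linarith : L.eval x * Q.eval x = 0)).resolve_right (hQ0 x)
  have h0 := hL0 0 (by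
    have h := geom_sum_mul (0 : ℤ) p
    rw [zero_pow hp.ne_zero] at h
    linarith)
  have h1 := hL0 (-1) (by
    have h := geom_sum_mul (-1 : ℤ) p
    rw [(hp.odd_of_ne_two (by omega)).neg_one_pow] at h
    linarith)
  rcases hL with rfl | ⟨r, rfl⟩
  · simp at h0
  · rw [eval_sub, eval_X, eval_C] at h0 h1
    omega

/-- Primes modulo which the large factor has no root only contribute through the linear factor. -/
lemma sum_rootless_le {Q : ℤ[X]} {n : ℕ} (hn : 0 < n) {l b : ℤ} (hl : l ≠ 0)
    (h : (n.factorial : ℤ) = l * Q.eval b) :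
    ∑ q ∈ Nat.primesLE n with (rootsMod Q q).card = 0, Real.log q / q ≤
      Real.log l.natAbs / n + Real.log 4 := by
  refine sum_log_div_le_of_dvd hn (Int.natAbs_ne_zero.2 hl) _ (Finset.filter_subset _ _)
    fun q hq => ?_
  rw [Finset.mem_filter, Nat.mem_primesLE, Finset.card_eq_zero] at hq
  obtain ⟨⟨-, hqp⟩, hempty⟩ := hq
  have hndvd : ¬ (q : ℤ) ∣ Q.eval b := by
    intro hdvd
    have hq0 : (q : ℤ) ≠ 0 := by exact_mod_cast hqp.ne_zero
    have hmem : (b % q).toNat ∈ rootsMod Q q := by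
      rw [mem_rootsMod]
      have h0 := Int.emod_nonneg b hq0
      have h1 := Int.emod_lt_of_pos b (by exact_mod_cast hqp.pos : (0 : ℤ) < q)
      refine ⟨by omega, ?_⟩
      rw [Int.toNat_of_nonneg h0]
      have h2 : (b - b % q) ∣ Q.eval b - Q.eval (b % q) := sub_dvd_eval_sub _ _ _
      have h3 : (q : ℤ) ∣ b - b % q := Int.dvd_self_sub_emod
      exact (dvd_sub_right hdvd).1 (h3.trans h2)
    rw [hempty] at hmem
    simp at hmem
  have h1 : q ^ padicValNat q n.factorial ∣ n.factorial := pow_padicValNat_dvd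
  have h2 : n.factorial = l.natAbs * (Q.eval b).natAbs := by
    rw [← Int.natAbs_mul, ← h, Int.natAbs_natCast]
  have hcop : Nat.Coprime (q ^ padicValNat q n.factorial) (Q.eval b).natAbs :=
    Nat.Coprime.pow_left _ ((Nat.Prime.coprime_iff_not_dvd hqp).2 fun h' =>
      hndvd (Int.natCast_dvd.2 h'))
  exact hcop.dvd_of_dvd_mul_right (h2 ▸ h1)

lemma log_natAbs_sub_le {p n A b : ℕ} (hp : 2 ≤ p) (hn : 1 ≤ n) (hb : 1 ≤ b) (hA : A ≤ n ^ n)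
    {r : ℤ} (hr : r.natAbs ≤ A + 2) (hbr : (b : ℤ) - r ≠ 0)
    (h : b ^ (p - 1) ≤ n.factorial + A) :
    Real.log ((b : ℤ) - r).natAbs ≤ n * Real.log n / ((p - 1 : ℕ) : ℝ) + (A + 4) := by
  have hb0 : (0 : ℝ) < b := by exact_mod_cast hb
  have hn0 : (0 : ℝ) < n := by exact_mod_cast hn
  have hp1 : (1 : ℝ) ≤ ((p - 1 : ℕ) : ℝ) := by exact_mod_cast (by omega : 1 ≤ p - 1)
  have h1 : ((b : ℤ) - r).natAbs ≤ b * (A + 3) := by nlinarith [(by omega :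
    ((b : ℤ) - r).natAbs ≤ b + (A + 2))]
  have h2 : b ^ (p - 1) ≤ 2 * n ^ n := by
    have := Nat.factorial_le_pow n
    omega
  have h3 : ((p - 1 : ℕ) : ℝ) * Real.log b ≤ Real.log 2 + n * Real.log n := by
    have h4 : (b : ℝ) ^ (p - 1) ≤ 2 * (n : ℝ) ^ n := by exact_mod_cast h2
    have h5 := Real.log_le_log (by positivity) h4
    rwa [Real.log_mul (by norm_num) (by positivity), Real.log_pow, Real.log_pow] at h5
  have h6 : Real.log ((b : ℤ) - r).natAbs ≤ Real.log b + (A + 2) := by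
    have h7 : (((b : ℤ) - r).natAbs : ℝ) ≤ b * (A + 3) := by exact_mod_cast h1
    have h8 : (0 : ℝ) < ((b : ℤ) - r).natAbs := by
      exact_mod_cast Int.natAbs_pos.2 hbr
    have h9 := Real.log_le_log h8 h7
    rw [Real.log_mul hb0.ne' (by positivity)] at h9
    have := Real.log_le_sub_one_of_pos (by positivity : (0 : ℝ) < A + 3)
    linarith
  have h10 : Real.log b ≤ n * Real.log n / ((p - 1 : ℕ) : ℝ) + 1 := by
    rw [← sub_le_iff_le_add, le_div_iff₀ (by linarith)]
    have : Real.log 2 ≤ 1 := by linarith [Real.log_two_lt_d9]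
    nlinarith
  linarith

end Main

/-- **Theorem 2 (ii).** There exists a positive integer `n₀` with the following
property. Let `p ≥ 7` be prime and `a` a nonzero integer such that `Φ_p(X) + a`
is either irreducible over `ℚ`, or a product of a linear polynomial and an
irreducible polynomial in `ℤ[X]`. If `n ≥ n₀` and `b ≥ 2` are integers with
`n! = (b^p − 1)/(b − 1) + a`, then `|a| ≥ 0.5·(log log log n)/(log log log log n)`. -/
theorem thm2_part2 :
    ∃ n₀ : ℕ, 0 < n₀ ∧ ∀ (p : ℕ) (a : ℤ),
      Nat.Prime p → 7 ≤ p → a ≠ 0 →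
      (Irreducible ((cyclotomic p ℚ) + C (a : ℚ)) ∨
        ∃ L Q : ℤ[X], L.degree = 1 ∧ Irreducible (Q.map (Int.castRingHom ℚ)) ∧
          (cyclotomic p ℤ) + C a = L * Q) →
      ∀ (n : ℕ) (b : ℤ), n₀ ≤ n → 2 ≤ b →
        (Nat.factorial n : ℤ) = (∑ i ∈ Finset.range p, b ^ i) + a →
        0.5 * Real.log (Real.log (Real.log n)) /
            Real.log (Real.log (Real.log (Real.log n))) ≤ |(a : ℝ)| := by
  
  obtain ⟨N₀, hcore⟩ := exists_log_le_of_sum_rootless_le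
  obtain ⟨n₀, hn₀0, hgrowth⟩ := exists_pow_pow_lt_log (N₀ + 10)
  refine ⟨n₀ + 3, by omega, fun p a hp hp7 ha hfac n b hn hb heq => ?_⟩
  by_contra! hlt
  set A := a.natAbs with hA
  rw [show |(a : ℝ)| = (A : ℝ) by rw [hA, Nat.cast_natAbs, Int.cast_abs]] at hlt
  have hlog := hgrowth n (by omega) A hlt
  set N := A + (N₀ + 10) with hN
  have hA1 : 1 ≤ A := Int.natAbs_pos.2 ha
  have hcube : (A + 1) ^ 3 ≤ n := by
    have h1 : ((N ^ N ^ 11 : ℕ) : ℝ) ≤ n := by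
      push_cast
      exact hlog.le.trans (Real.log_le_self (Nat.cast_nonneg n))
    have h2 : N ^ N ^ 11 ≤ n := by exact_mod_cast h1
    calc (A + 1) ^ 3 ≤ N ^ 3 := Nat.pow_le_pow_left (by omega) 3
      _ ≤ N ^ N ^ 11 := Nat.pow_le_pow_right (by omega)
        ((by omega : 3 ≤ N).trans (Nat.le_self_pow (by norm_num) N))
      _ ≤ n := h2
  obtain ⟨L, Q, hLQ, hQm, hQirr, hL⟩ := exists_monic_factor hp hfac
  have hm2 : 2 ≤ Q.natDegree := by
    rcases hL with ⟨-, h⟩ | ⟨r, -, h⟩ <;> omega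
  have ha1 : a ≠ -1 := ne_neg_one_of_factor hp hLQ
    (eval_ne_zero_of_irreducible_map hQm hQirr hm2) (by omega)
    (hL.imp And.left fun ⟨r, h⟩ => ⟨r, h.1⟩)
  lift b to ℕ using by omega
  have hb2 : 2 ≤ b := by exact_mod_cast hb
  have hpn : p ≤ n := prime_le_of_large hp.one_le hb2 ha1 (by omega) hcube heq
  have hpA : p ≤ A + 1 := prime_le_of_factorial_eq hp hpn ha ha1 heq
  have hroot : ∀ z : ℂ, aeval z (cyclotomic p ℤ + C a) = 0 → ‖z‖ ≤ A + 2 := fun z hz =>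
    norm_root_le hp hz
  have hmul : (n.factorial : ℤ) = L.eval (b : ℤ) * Q.eval (b : ℤ) := by
    rw [← eval_mul, ← hLQ, eval_cyclotomic_add_C hp, heq]
  have hLb : L.eval (b : ℤ) ≠ 0 := by
    intro h
    rw [h, zero_mul] at hmul
    exact n.factorial_ne_zero (by exact_mod_cast hmul)
  have hn1 : 1 ≤ n := by omega
  have hn0 : (0 : ℝ) < n := by exact_mod_cast hn1
  have hroots : ∀ z : ℂ, aeval z Q = 0 → ‖z‖ ≤ N := by
    intro z hz
    have h := hroot z (by rw [hLQ, map_mul, hz, mul_zero])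
    refine h.trans ?_
    rw [hN]; push_cast; linarith [Nat.cast_nonneg (α := ℝ) N₀]
  have hLlog : Real.log (L.eval (b : ℤ)).natAbs / n ≤
      Real.log n / (Q.natDegree + 1) + (A + 4) := by
    rcases hL with ⟨rfl, -⟩ | ⟨r, rfl, hdeg⟩
    · rw [eval_one, Int.natAbs_one, Nat.cast_one, Real.log_one, zero_div]
      have := Real.log_natCast_nonneg n
      positivity
    · have hr : r.natAbs ≤ A + 2 := by
        have h := hroot (r : ℂ) (by rw [hLQ, map_mul]; simp)
        rw [Complex.norm_intCast, ← Int.cast_abs, ← Nat.cast_natAbs] at h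
        exact_mod_cast h
      rw [eval_sub, eval_X, eval_C] at hLb ⊢
      have hAn : A ≤ n ^ n :=
        ((by omega : A ≤ A + 1).trans ((Nat.le_self_pow (by norm_num) _).trans hcube)).trans
          (Nat.le_self_pow (by omega) n)
      have h := log_natAbs_sub_le hp.two_le hn1 (by omega) hAn hr hLb
        (pow_le_factorial_add hp.one_le heq)
      have hpm : ((p - 1 : ℕ) : ℝ) = Q.natDegree + 1 := by
        rw [show p - 1 = Q.natDegree + 1 by omega]; push_cast; rfl
      rw [hpm] at h
      rw [div_le_iff₀ hn0]
      refine h.trans ?_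
      have hn1' : (1 : ℝ) ≤ n := by exact_mod_cast hn1
      have h2 : ((A : ℝ) + 4) ≤ (A + 4) * n := le_mul_of_one_le_right (by positivity) hn1'
      have h3 : n * Real.log n / ((Q.natDegree : ℝ) + 1) =
        Real.log n / (Q.natDegree + 1) * n := by ring
      rw [h3]
      linarith
  have hS := sum_rootless_le (by omega) hLb hmul
  have hbound := hcore N (by omega) Q hQm hQirr hm2 (by
    rcases hL with ⟨-, h⟩ | ⟨r, -, h⟩ <;> omega) hroots n hn1 (hS.trans (by
      rw [hN]; push_cast
      linarith [log_four_le_two, Nat.cast_nonneg (α := ℝ) N₀]))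
  linarith
end
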